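/- With the above hypotheses, let a_i^max (respectively b_i^max) denote the largest integer a (respectively b) such that β_{i,(a,b)}^S(S/J) ≠ 0 for some b (respectively a). Then a_i^max = min{i, n−1} for 0 ≤ i ≤ m; moreover, if m ≤ 2n−1, then b_i^max = n−1+i for 1 ≤ i ≤ m−n and b_i^max = m for m−n+1 ≤ i ≤ m. -/

import Mathlib

open MvPolynomial

noncomputable section

/-- The bigraded polynomial ring `S = k[x₁,…,xₙ,y₁,…,y_p]`. -/
abbrev PolyS (k : Type) [Field k] (n p : ℕ) : Type := MvPolynomial (Fin n ⊕ Fin p) k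

/-- The bigrading with `deg xᵢ = (1,0)` and `deg yⱼ = (0,1)`. -/
def bideg (n p : ℕ) : (Fin n ⊕ Fin p) → ℤ × ℤ :=
  Sum.elim (fun _ => ((1 : ℤ), (0 : ℤ))) (fun _ => ((0 : ℤ), (1 : ℤ)))

/-- The bihomogeneous component of `S` of bidegree `d`. -/
def piece (k : Type) [Field k] (n p : ℕ) (d : ℤ × ℤ) : Submodule k (PolyS k n p) :=
  weightedHomogeneousSubmodule k (bideg n p) d

/-- The sequence `z` defined by `[z₁ … z_m] = [x₁ … xₙ]·φ`. -/
def zseq (k : Type) [Field k] (n m p : ℕ) (φ : Matrix (Fin n) (Fin m) (PolyS k n p))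
    (j : Fin m) : PolyS k n p :=
  ∑ i : Fin n, X (Sum.inl i) * φ i j

/-- The ideal of `t × t` minors of a matrix. -/
def minorsIdeal {R : Type} [CommRing R] {a b : ℕ} (t : ℕ) (φ : Matrix (Fin a) (Fin b) R) :
    Ideal R :=
  Ideal.span { d : R | ∃ (r : Fin t ↪ Fin a) (c : Fin t ↪ Fin b),
    d = (φ.submatrix r c).det }

/-- `J = (z₁,…,z_m) + Iₙ(φ)`. -/
def resJ (k : Type) [Field k] (n m p : ℕ) (φ : Matrix (Fin n) (Fin m) (PolyS k n p)) :
    Ideal (PolyS k n p) :=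
  Ideal.span (Set.range (zseq k n m p φ)) ⊔ minorsIdeal n φ

/-- The height of an ideal. -/
def idealHeight {R : Type} [CommRing R] (I : Ideal R) : ℕ∞ :=
  ⨅ (P : PrimeSpectrum R) (_ : I ≤ P.asIdeal), Order.height P

/-- `grade I ≥ t`: there is a regular sequence of length `t` inside `I`. -/
def gradeGE {R : Type} [CommRing R] (I : Ideal R) (t : ℕ) : Prop :=
  ∃ rs : List R, rs.length = t ∧ (∀ r ∈ rs, r ∈ I) ∧ RingTheory.Sequence.IsRegular R rs

/-- The ideal `(x₁,…,xₙ)` of `S`. -/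
def xIdeal (k : Type) [Field k] (n p : ℕ) : Ideal (PolyS k n p) :=
  Ideal.span (Set.range fun i : Fin n => (X (Sum.inl i) : PolyS k n p))

/-- The geometric residual intersection condition: `(z)_𝔭 = (x)_𝔭` for all primes
`𝔭 ⊇ (x)` of height at most `m`. -/
def geomResCond (k : Type) [Field k] (n m p : ℕ)
    (φ : Matrix (Fin n) (Fin m) (PolyS k n p)) : Prop :=
  ∀ P : PrimeSpectrum (PolyS k n p), xIdeal k n p ≤ P.asIdeal →
    Order.height P ≤ (m : ℕ∞) →
    Ideal.map (algebraMap (PolyS k n p) (Localization.AtPrime P.asIdeal))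
        (Ideal.span (Set.range (zseq k n m p φ)))
      = Ideal.map (algebraMap (PolyS k n p) (Localization.AtPrime P.asIdeal))
          (xIdeal k n p)

/-- The multiplicity `r(i,j)`. -/
def rMult (n m i j : ℕ) : ℕ :=
  (n + i - 2 * j - 2).choose (i - 1 - j) * (n + i - 1 - j).choose j *
    m.choose (n + i - 1 - j)

/-- The predicted bigraded Betti numbers of `S/J`: `C(m,i)` in bidegree `(i,i)` for
`0 ≤ i ≤ n-1`, and `r(i,a)` in bidegree `(a, n+i-1-a)` for `1 ≤ i ≤ m` and
`max{0, i-(m-n+1)} ≤ a ≤ min{i-1, n-1}`. -/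
def bettiFormula (n m : ℕ) (i : ℕ) (d : ℤ × ℤ) : ℕ :=
  if i ≤ n - 1 ∧ d.1 = (i : ℤ) ∧ d.2 = (i : ℤ) then m.choose i
  else if 1 ≤ i ∧ i ≤ m ∧ ((i - (m - n + 1) : ℕ) : ℤ) ≤ d.1 ∧
      d.1 ≤ ((min (i - 1) (n - 1) : ℕ) : ℤ) ∧ d.2 = (n : ℤ) + (i : ℤ) - 1 - d.1 then
    rMult n m i d.1.toNat
  else 0

/-- Index type of the free bigraded module with multiplicities `β i`. -/
def RIdx (β : ℕ → ℤ × ℤ → ℕ) (i : ℕ) : Type := { q : (ℤ × ℤ) × ℕ // q.2 < β i q.1 }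

/-- The free bigraded `S`-module `⊕_{(a,b)} S(-a,-b)^{β i (a,b)}`. -/
abbrev FMod (k : Type) [Field k] (n p : ℕ) (β : ℕ → ℤ × ℤ → ℕ) (i : ℕ) : Type :=
  RIdx β i →₀ PolyS k n p

/-- `v` lies in the bigraded component of bidegree `d` of `FMod β i`
(the generator indexed by `q` sits in bidegree `q.1.1`, so its coefficient must lie in
`S(-q.1.1)_d = S_{d - q.1.1}`). -/
def inPiece (k : Type) [Field k] (n p : ℕ) (β : ℕ → ℤ × ℤ → ℕ) (i : ℕ) (d : ℤ × ℤ)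
    (v : FMod k n p β i) : Prop :=
  ∀ q : RIdx β i, v q ∈ piece k n p (d - q.1.1)

/-- The irrelevant ideal of `S`, generated by all the variables. -/
def varIdeal (k : Type) [Field k] (n p : ℕ) : Ideal (PolyS k n p) :=
  Ideal.span (Set.range (X : (Fin n ⊕ Fin p) → PolyS k n p))

/-- `β` records the shifts of a bigraded free resolution of `S/J` over `S`:
there are bidegree-preserving `S`-linear maps forming an exact sequence
`⋯ → F_{i+1} → F_i → ⋯ → F_0 → S/J → 0` where `F_i = ⊕ S(-a,-b)^{β i (a,b)}`
(since `β i = 0` for large `i`, this is a finite resolution). -/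
def IsBigradedFreeRes (k : Type) [Field k] (n p : ℕ) (J : Ideal (PolyS k n p))
    (β : ℕ → ℤ × ℤ → ℕ) : Prop :=
  ∃ (f : ∀ i : ℕ, FMod k n p β (i + 1) →ₗ[PolyS k n p] FMod k n p β i)
    (π : FMod k n p β 0 →ₗ[PolyS k n p] (PolyS k n p ⧸ J)),
    Function.Surjective π ∧ Function.Exact (f 0) π ∧
    (∀ i, Function.Exact (f (i + 1)) (f i)) ∧
    (∀ i d v, inPiece k n p β (i + 1) d v → inPiece k n p β i d (f i v)) ∧
    (∀ d v, inPiece k n p β 0 d v →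
      π v ∈ (piece k n p d).map (Ideal.Quotient.mkₐ k J).toLinearMap)

/-- `β` records the shifts of a *minimal* bigraded free resolution of `S/J` over `S`,
i.e. a bigraded free resolution whose differentials have image inside `𝔪·F` where `𝔪`
is the ideal generated by all the variables.  The multiplicities `β i (a,b)` of a
minimal bigraded free resolution are exactly the bigraded Betti numbers
`β_{i,(a,b)}(S/J) = dim_k Tor_i(S/J, k)_{(a,b)}`. -/
def IsMinBigradedFreeRes (k : Type) [Field k] (n p : ℕ) (J : Ideal (PolyS k n p))
    (β : ℕ → ℤ × ℤ → ℕ) : Prop :=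
  ∃ (f : ∀ i : ℕ, FMod k n p β (i + 1) →ₗ[PolyS k n p] FMod k n p β i)
    (π : FMod k n p β 0 →ₗ[PolyS k n p] (PolyS k n p ⧸ J)),
    Function.Surjective π ∧ Function.Exact (f 0) π ∧
    (∀ i, Function.Exact (f (i + 1)) (f i)) ∧
    (∀ i d v, inPiece k n p β (i + 1) d v → inPiece k n p β i d (f i v)) ∧
    (∀ d v, inPiece k n p β 0 d v →
      π v ∈ (piece k n p d).map (Ideal.Quotient.mkₐ k J).toLinearMap) ∧
    (∀ i, LinearMap.range (f i) ≤
      (varIdeal k n p) • (⊤ : Submodule (PolyS k n p) (FMod k n p β i)))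

/-! ### Koszul operators -/

/-- The sign picked up by moving the `j`-th basis vector into position inside `I`. -/
def koszulSign {N : ℕ} (j : Fin N) (I : Finset (Fin N)) : ℤ := (-1) ^ (I.filter (· < j)).card

section Koszul

variable {R : Type} [CommRing R] {N : ℕ} {M : Type} [AddCommGroup M] [Module R M]

/-- Interior product with the `j`-th dual basis vector. -/
def contr (R : Type) [CommRing R] {N : ℕ} {M : Type} [AddCommGroup M] [Module R M] (j : Fin N) :
    (Finset (Fin N) → M) →ₗ[R] (Finset (Fin N) → M) where
  toFun u I := if j ∈ I then 0 else koszulSign j I • u (insert j I)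
  map_add' u v := by ext I; by_cases h : j ∈ I <;> simp [h]
  map_smul' c u := by ext I; by_cases h : j ∈ I <;> simp [h, smul_comm c]

/-- Exterior product with the `j`-th basis vector. -/
def wedge (R : Type) [CommRing R] {N : ℕ} {M : Type} [AddCommGroup M] [Module R M] (j : Fin N) :
    (Finset (Fin N) → M) →ₗ[R] (Finset (Fin N) → M) where
  toFun u I := if j ∈ I then koszulSign j I • u (I.erase j) else 0
  map_add' u v := by ext I; by_cases h : j ∈ I <;> simp [h]
  map_smul' c u := by ext I; by_cases h : j ∈ I <;> simp [h, smul_comm c]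

lemma contr_apply (j : Fin N) (u : Finset (Fin N) → M) (I : Finset (Fin N)) :
    contr R j u I = if j ∈ I then 0 else koszulSign j I • u (insert j I) := rfl

lemma wedge_apply (j : Fin N) (u : Finset (Fin N) → M) (I : Finset (Fin N)) :
    wedge R j u I = if j ∈ I then koszulSign j I • u (I.erase j) else 0 := rfl

lemma koszulSign_insert (i j : Fin N) {I : Finset (Fin N)} (h : i ∉ I) :
    koszulSign j (insert i I) = (if i < j then -1 else 1) * koszulSign j I := by
  unfold koszulSign
  rw [Finset.filter_insert]
  split_ifs with hij
  · rw [Finset.card_insert_of_notMem (by simp [h]), pow_succ]; ring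
  · simp

lemma koszulSign_mul_self (j : Fin N) (I : Finset (Fin N)) :
    koszulSign j I * koszulSign j I = 1 := by
  unfold koszulSign; rw [← mul_pow]; simp

lemma koszulSign_erase (i j : Fin N) {I : Finset (Fin N)} (h : i ∈ I) :
    koszulSign j (I.erase i) = (if i < j then -1 else 1) * koszulSign j I := by
  have := koszulSign_insert i j (Finset.notMem_erase i I)
  rw [Finset.insert_erase h] at this
  rw [this]; split_ifs <;> ring

lemma contr_contr_self (j : Fin N) (u : Finset (Fin N) → M) : contr R j (contr R j u) = 0 := by
  ext I; simp [contr_apply]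

lemma contr_contr_of_ne {i j : Fin N} (hij : i ≠ j) (u : Finset (Fin N) → M) :
    contr R i (contr R j u) = -contr R j (contr R i u) := by
  ext I
  simp only [contr_apply, Pi.neg_apply, Finset.mem_insert, hij, hij.symm, false_or]
  by_cases hi : i ∈ I <;> by_cases hj : j ∈ I <;> simp only [hi, hj, if_true, if_false, smul_zero,
    neg_zero]
  rw [koszulSign_insert i j hi, koszulSign_insert j i hj, Finset.insert_comm, smul_smul, smul_smul,
    ← neg_smul]
  congr 1
  rcases lt_or_gt_of_ne hij with h | h
  · simp only [h, h.not_gt, if_true, if_false]; ring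
  · simp only [h, h.not_gt, if_true, if_false]; ring

lemma contr_wedge_self (j : Fin N) (u : Finset (Fin N) → M) :
    contr R j (wedge R j u) + wedge R j (contr R j u) = u := by
  ext I
  by_cases h : j ∈ I
  · simp [contr_apply, wedge_apply, h, smul_smul, koszulSign_erase, koszulSign_mul_self]
  · simp [contr_apply, wedge_apply, h, smul_smul, koszulSign_insert, koszulSign_mul_self]

lemma contr_wedge_of_ne {i j : Fin N} (hij : i ≠ j) (u : Finset (Fin N) → M) :
    contr R i (wedge R j u) + wedge R j (contr R i u) = 0 := by
  ext I
  simp only [contr_apply, wedge_apply, Pi.add_apply, Pi.zero_apply, Finset.mem_insert, hij,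
    hij.symm, false_or, Finset.mem_erase, ne_eq, not_false_iff, true_and]
  by_cases hi : i ∈ I <;> by_cases hj : j ∈ I <;> simp only [hi, hj, if_true, if_false, smul_zero,
    add_zero]
  rw [koszulSign_insert i j hi, koszulSign_erase j i hj, Finset.erase_insert_of_ne hij,
    smul_smul, smul_smul, ← add_smul]
  convert zero_smul ℤ _
  rcases lt_or_gt_of_ne hij with h | h
  · simp only [h, h.not_gt, if_true, if_false]; ring
  · simp only [h, h.not_gt, if_true, if_false]; ring

/-- The Koszul differential associated with the sequence `c`. -/
def koszulD (c : Fin N → R) : (Finset (Fin N) → M) →ₗ[R] (Finset (Fin N) → M) :=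
  ∑ j, c j • contr R j

/-- Exterior multiplication by the vector `e`. -/
def koszulW (e : Fin N → R) : (Finset (Fin N) → M) →ₗ[R] (Finset (Fin N) → M) :=
  ∑ j, e j • wedge R j

lemma koszulD_eq_sum (c : Fin N → R) (u : Finset (Fin N) → M) :
    koszulD c u = ∑ j, c j • contr R j u := by
  simp [koszulD, LinearMap.sum_apply]

lemma koszulW_eq_sum (e : Fin N → R) (u : Finset (Fin N) → M) :
    koszulW e u = ∑ j, e j • wedge R j u := by
  simp [koszulW, LinearMap.sum_apply]

lemma koszulD_apply (c : Fin N → R) (u : Finset (Fin N) → M) (I : Finset (Fin N)) :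
    koszulD c u I = ∑ j, c j • (if j ∈ I then 0 else koszulSign j I • u (insert j I)) := by
  rw [koszulD_eq_sum, Finset.sum_apply]; rfl

lemma koszulD_koszulD (c : Fin N → R) (u : Finset (Fin N) → M) :
    koszulD c (koszulD c u) = 0 := by
  have key : ∀ s : Finset (Fin N), ∑ i ∈ s, ∑ j ∈ s,
      (c i * c j) • contr R i (contr R j u) = 0 := by
    intro s
    induction s using Finset.induction_on with
    | empty => simp
    | insert a s ha ih =>
      rw [Finset.sum_insert ha, Finset.sum_insert ha, contr_contr_self, smul_zero, zero_add]
      simp_rw [Finset.sum_insert ha]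
      rw [Finset.sum_add_distrib, ih, add_zero, ← Finset.sum_add_distrib]
      refine Finset.sum_eq_zero fun i hi => ?_
      rw [contr_contr_of_ne (by rintro rfl; exact ha hi : a ≠ i), mul_comm (c i), smul_neg]
      exact neg_add_cancel _
  rw [koszulD_eq_sum, ← key Finset.univ]
  refine Finset.sum_congr rfl fun i _ => ?_
  rw [koszulD_eq_sum, map_sum, Finset.smul_sum]
  refine Finset.sum_congr rfl fun j _ => ?_
  rw [map_smul, smul_smul]

lemma koszulD_koszulW (c e : Fin N → R) (u : Finset (Fin N) → M) :
    koszulD c (koszulW e u) + koszulW e (koszulD c u) = (∑ j, e j * c j) • u := by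
  simp only [koszulD_eq_sum, koszulW_eq_sum, map_sum, map_smul, Finset.smul_sum, smul_smul]
  rw [Finset.sum_comm (γ := Fin N), ← Finset.sum_add_distrib, Finset.sum_smul]
  refine Finset.sum_congr rfl fun i _ => ?_
  rw [← Finset.sum_add_distrib, Finset.sum_eq_single i]
  · rw [mul_comm (c i), ← smul_add, contr_wedge_self]
  · intro j _ hj
    rw [mul_comm (c i), ← smul_add, contr_wedge_of_ne hj.symm, smul_zero]
  · simp

/-- Functions supported on sets of cardinality `s`. -/
def cardPart (R : Type) [CommRing R] (N : ℕ) (M : Type) [AddCommGroup M] [Module R M] (s : ℤ) :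
    Submodule R (Finset (Fin N) → M) where
  carrier := {u | ∀ I, (I.card : ℤ) ≠ s → u I = 0}
  add_mem' hu hv I hI := by simp [hu I hI, hv I hI]
  zero_mem' _ _ := rfl
  smul_mem' c u hu I hI := by simp [hu I hI]

lemma koszulD_mem_cardPart (c : Fin N → R) {s : ℤ} {u : Finset (Fin N) → M}
    (hu : u ∈ cardPart R N M (s + 1)) : koszulD c u ∈ cardPart R N M s := by
  intro I hI
  rw [koszulD_apply]
  refine Finset.sum_eq_zero fun j _ => ?_
  split_ifs with hj
  · simp
  · rw [hu _ (by rw [Finset.card_insert_of_notMem hj]; push_cast; omega)]; simp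

lemma koszulW_mem_cardPart (e : Fin N → R) {s : ℤ} {u : Finset (Fin N) → M}
    (hu : u ∈ cardPart R N M s) : koszulW e u ∈ cardPart R N M (s + 1) := by
  intro I hI
  rw [koszulW_eq_sum, Finset.sum_apply]
  refine Finset.sum_eq_zero fun j _ => ?_
  rw [Pi.smul_apply, wedge_apply]
  split_ifs with hj
  · rw [hu _ (by have := Finset.card_erase_add_one hj; omega)]; simp
  · simp

/-- Projection to the part supported on sets of cardinality `s`. -/
def cardProj (s : ℤ) (u : Finset (Fin N) → M) : Finset (Fin N) → M :=
  fun I => if (I.card : ℤ) = s then u I else 0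

lemma cardProj_mem (s : ℤ) (u : Finset (Fin N) → M) : cardProj s u ∈ cardPart R N M s := by
  intro I hI; simp [cardProj, hI]

lemma cardProj_of_mem {s : ℤ} {u : Finset (Fin N) → M} (hu : u ∈ cardPart R N M s) :
    cardProj s u = u := by
  ext I; unfold cardProj; split_ifs with h
  · rfl
  · exact (hu I h).symm

lemma koszulD_cardProj (c : Fin N → R) (s : ℤ) (u : Finset (Fin N) → M) :
    koszulD c (cardProj (s + 1) u) = cardProj s (koszulD c u) := by
  ext I
  simp only [cardProj, koszulD_apply]
  split_ifs with h
  · refine Finset.sum_congr rfl fun j _ => ?_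
    split_ifs with hj h'
    · rfl
    · rfl
    · exact absurd (by rw [Finset.card_insert_of_notMem hj]; push_cast; omega) h'
  · refine Finset.sum_eq_zero fun j _ => ?_
    split_ifs with hj h'
    · simp
    · rw [Finset.card_insert_of_notMem hj] at h'; push_cast at h'; omega
    · simp

lemma koszulD_compLeft {M' : Type} [AddCommGroup M'] [Module R M'] (c : Fin N → R)
    (f : M →ₗ[R] M') (u : Finset (Fin N) → M) :
    koszulD c (fun I => f (u I)) = fun I => f (koszulD c u I) := by
  ext I
  simp only [koszulD_apply, map_sum, map_smul]
  refine Finset.sum_congr rfl fun j _ => ?_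
  split_ifs <;> simp

end Koszul

open RingTheory.Sequence Pointwise in
/-- Cycles of the Koszul complex are boundaries, up to a power of `g`, as soon as `g` multiplies a
sufficiently long weakly regular sequence into the ideal generated by `z`. -/
lemma koszul_depth {R : Type} [CommRing R] {N : ℕ} (z : Fin N → R) (g : R) (rs : List R) :
    (∀ r ∈ rs, g * r ∈ Ideal.span (Set.range z)) →
    ∀ (M : Type) [AddCommGroup M] [Module R M], IsWeaklyRegular M rs →
    ∀ (i : ℕ), N < i + rs.length →
    ∀ h ∈ cardPart R N M i, koszulD z h = 0 → ∃ u, koszulD z u = g ^ rs.length • h := by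
  induction rs with
  | nil =>
    intro _ M _ _ _ i hi h hh _
    refine ⟨0, ?_⟩
    have : h = 0 := by
      ext I
      refine hh I ?_
      have := I.card_le_univ
      simp only [Fintype.card_fin] at this
      simp only [List.length_nil] at hi
      omega
    simp [this]
  | cons r rs ih =>
    intro hg M _ _ hreg i hi h hh hD
    rw [isWeaklyRegular_cons_iff] at hreg
    obtain ⟨e, he⟩ := (Ideal.mem_span_range_iff_exists_fun).1 (hg r (by simp))
    have hDW : koszulD z (koszulW e h) = (g * r) • h := by
      rw [← he, ← koszulD_koszulW, hD, map_zero, add_zero]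
    let mk : M →ₗ[R] QuotSMulTop r M := Submodule.mkQ _
    have hmk : ∀ x, mk x = 0 ↔ ∃ y, x = r • y := by
      intro x
      rw [Submodule.mkQ_apply, Submodule.Quotient.mk_eq_zero,
        Submodule.mem_smul_pointwise_iff_exists]
      simp [eq_comm]
    obtain ⟨v', hv'⟩ := ih (fun r' hr' => hg r' (by simp [hr'])) (QuotSMulTop r M) hreg.2 (i + 1)
      (by simp only [List.length_cons] at hi; omega) (fun I => mk (koszulW e h I))
      (by
        intro I hI
        simp only
        rw [koszulW_mem_cardPart e hh I (by exact_mod_cast hI), map_zero])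
      (by
        rw [koszulD_compLeft, hDW]
        ext I
        rw [Pi.smul_apply, mul_comm, mul_smul]
        exact (hmk _).2 ⟨_, rfl⟩)
    choose v hv using fun I => Submodule.mkQ_surjective _ (v' I)
    have hv2 : v' = fun I => mk (v I) := by ext I; exact (hv I).symm
    rw [hv2, koszulD_compLeft] at hv'
    have : ∀ I, ∃ y, g ^ rs.length • koszulW e h I - koszulD z v I = r • y := by
      intro I
      rw [← hmk, map_sub, map_smul, sub_eq_zero]
      exact (congrFun hv' I).symm
    choose w hw using this
    refine ⟨w, ?_⟩
    have hw2 : g ^ rs.length • koszulW e h - koszulD z v = r • w := by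
      ext I; exact hw I
    have h3 := congrArg (koszulD z) hw2
    rw [map_sub, map_smul, hDW, koszulD_koszulD, sub_zero, map_smul] at h3
    have hr : IsSMulRegular (Finset (Fin N) → M) r := by
      intro a b hab
      ext I; exact hreg.1 (congrFun hab I)
    refine hr ?_
    simp only
    rw [← h3, smul_smul, smul_smul, List.length_cons]
    congr 1; ring

/-! ### Bigraded modules -/

/-- A bigrading on an `S`-module, given by the projections to the homogeneous components. -/
structure Bigrading (k : Type) [Field k] (n p : ℕ) (M : Type) [AddCommGroup M]
    [Module (PolyS k n p) M] where
  pr : ℤ × ℤ → M →+ M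
  pr_pr : ∀ d e u, pr d (pr e u) = if d = e then pr e u else 0
  pr_smul : ∀ d e s u, s ∈ piece k n p e → pr (d + e) (s • u) = s • pr d u

section Bigrading

variable {k : Type} [Field k] {n p : ℕ} {M : Type} [AddCommGroup M] [Module (PolyS k n p) M]
  {M' : Type} [AddCommGroup M'] [Module (PolyS k n p) M']

/-- The homogeneous component of bidegree `d`. -/
def Bigrading.H (G : Bigrading k n p M) (d : ℤ × ℤ) : AddSubgroup M where
  carrier := {u | G.pr d u = u}
  add_mem' {u v} hu hv := by
    simp only [Set.mem_ofPred_eq] at hu hv ⊢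
    rw [map_add, hu, hv]
  zero_mem' := by simp
  neg_mem' {u} hu := by
    simp only [Set.mem_ofPred_eq] at hu ⊢
    rw [map_neg, hu]

lemma Bigrading.mem_H {G : Bigrading k n p M} {d : ℤ × ℤ} {u : M} : u ∈ G.H d ↔ G.pr d u = u :=
  Iff.rfl

lemma Bigrading.pr_mem (G : Bigrading k n p M) (d : ℤ × ℤ) (u : M) : G.pr d u ∈ G.H d := by
  rw [mem_H, G.pr_pr, if_pos rfl]

lemma Bigrading.pr_of_mem_ne {G : Bigrading k n p M} {d e : ℤ × ℤ} {u : M} (hu : u ∈ G.H e)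
    (h : d ≠ e) : G.pr d u = 0 := by
  rw [← mem_H.1 hu, G.pr_pr, if_neg h]

lemma Bigrading.smul_mem {G : Bigrading k n p M} {d e : ℤ × ℤ} {s : PolyS k n p} {u : M}
    (hs : s ∈ piece k n p e) (hu : u ∈ G.H d) : s • u ∈ G.H (d + e) := by
  rw [mem_H, G.pr_smul _ _ _ _ hs, mem_H.1 hu]

lemma Bigrading.pr_smul' (G : Bigrading k n p M) {d e : ℤ × ℤ} {s : PolyS k n p} {u : M}
    (hs : s ∈ piece k n p e) : G.pr d (s • u) = s • G.pr (d - e) u := by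
  rw [← G.pr_smul _ _ _ _ hs, sub_add_cancel]

/-- Bidegree preserving maps. -/
def IsGraded (G : Bigrading k n p M) (G' : Bigrading k n p M') (f : M → M') : Prop :=
  ∀ d u, G'.pr d (f u) = f (G.pr d u)

lemma IsGraded.mem {G : Bigrading k n p M} {G' : Bigrading k n p M'} {f : M → M'}
    (hf : IsGraded G G' f) {d : ℤ × ℤ} {u : M} (hu : u ∈ G.H d) : f u ∈ G'.H d := by
  rw [Bigrading.mem_H, hf, Bigrading.mem_H.1 hu]

lemma IsGraded.lift {G : Bigrading k n p M} {G' : Bigrading k n p M'} {f : M → M'}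
    (hf : IsGraded G G' f) {d : ℤ × ℤ} {u : M} {c : M'} (hc : c ∈ G'.H d) (h : f u = c) :
    ∃ u' ∈ G.H d, f u' = c :=
  ⟨G.pr d u, G.pr_mem d u, by rw [← hf, h, Bigrading.mem_H.1 hc]⟩

variable (k n p) in
/-- The standard bigrading of `S`. -/
def polyBigrading : Bigrading k n p (PolyS k n p) where
  pr d := (weightedHomogeneousComponent (bideg n p) d).toAddMonoidHom
  pr_pr d e u := by
    have h := weightedHomogeneousComponent_isWeightedHomogeneous (w := bideg n p) e u
    simpa [eq_comm] using weightedHomogeneousComponent_of_mem (m := d) h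
  pr_smul d e s u hs := by
    induction u using MvPolynomial.induction_on' with
    | add u v hu hv => simp only [smul_add, map_add, hu, hv]
    | monomial c a =>
      have h := isWeightedHomogeneous_monomial (R := k) (bideg n p) c a rfl
      have h1 := weightedHomogeneousComponent_of_mem (m := d) h
      have h2 := weightedHomogeneousComponent_of_mem (m := e + d)
        (IsWeightedHomogeneous.mul ((mem_weightedHomogeneousSubmodule _ _ _ _).1 hs) h)
      simp only [LinearMap.toAddMonoidHom_coe, smul_eq_mul, h1, h2, add_comm d e, add_right_inj,
        mul_ite, mul_zero]

lemma mem_polyBigrading {d : ℤ × ℤ} {u : PolyS k n p} :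
    u ∈ (polyBigrading k n p).H d ↔ u ∈ piece k n p d := by
  refine ⟨fun h => ?_, fun h => weightedHomogeneousComponent_eq_self h⟩
  rw [← Bigrading.mem_H.1 h]
  exact weightedHomogeneousComponent_isWeightedHomogeneous _ _

/-- The induced bigrading on a quotient. -/
def Bigrading.quot (G : Bigrading k n p M) (N : Submodule (PolyS k n p) M)
    (hN : ∀ d, ∀ u ∈ N, G.pr d u ∈ N) : Bigrading k n p (M ⧸ N) where
  pr d := QuotientAddGroup.map N.toAddSubgroup N.toAddSubgroup (G.pr d) (fun u hu => hN d u hu)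
  pr_pr d e u := by
    obtain ⟨u, rfl⟩ := N.mkQ_surjective u
    change N.mkQ (G.pr d (G.pr e u)) = if d = e then N.mkQ (G.pr e u) else 0
    rw [G.pr_pr]; split_ifs <;> simp
  pr_smul d e s u hs := by
    obtain ⟨u, rfl⟩ := N.mkQ_surjective u
    change N.mkQ (G.pr (d + e) (s • u)) = N.mkQ (s • G.pr d u)
    rw [G.pr_smul _ _ _ _ hs]

lemma Bigrading.quot_mkQ (G : Bigrading k n p M) (N : Submodule (PolyS k n p) M)
    (hN : ∀ d, ∀ u ∈ N, G.pr d u ∈ N) : IsGraded G (G.quot N hN) N.mkQ := fun _ _ => rfl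

/-- The induced bigrading on a submodule. -/
def Bigrading.sub (G : Bigrading k n p M) (N : Submodule (PolyS k n p) M)
    (hN : ∀ d, ∀ u ∈ N, G.pr d u ∈ N) : Bigrading k n p N where
  pr d := ((G.pr d).comp N.toAddSubgroup.subtype).codRestrict N.toAddSubgroup
    (fun u => hN d u u.2)
  pr_pr d e u := by
    apply Subtype.ext
    change G.pr d (G.pr e u) = _
    rw [G.pr_pr]; split_ifs <;> rfl
  pr_smul d e s u hs := by
    apply Subtype.ext
    exact G.pr_smul _ _ _ _ hs

/-- Functions to a bigraded module, with the factor of index `i` shifted by `w i`. -/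
def Bigrading.pi {ι : Type} (G : Bigrading k n p M) (w : ι → ℤ × ℤ) :
    Bigrading k n p (ι → M) where
  pr d :=
    { toFun := fun u i => G.pr (d - w i) (u i)
      map_zero' := by ext i; simp
      map_add' := fun u v => by ext i; simp }
  pr_pr d e u := by
    ext i
    simp only [AddMonoidHom.coe_mk, ZeroHom.coe_mk, G.pr_pr, sub_left_inj]
    split_ifs <;> rfl
  pr_smul d e s u hs := by
    ext i
    simp only [AddMonoidHom.coe_mk, ZeroHom.coe_mk, Pi.smul_apply]
    rw [add_sub_right_comm, G.pr_smul _ _ _ _ hs]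

lemma Bigrading.pi_pr {ι : Type} (G : Bigrading k n p M) (w : ι → ℤ × ℤ) (d : ℤ × ℤ) (u : ι → M)
    (i : ι) : (G.pi w).pr d u i = G.pr (d - w i) (u i) := rfl

lemma Bigrading.mem_pi {ι : Type} {G : Bigrading k n p M} {w : ι → ℤ × ℤ} {d : ℤ × ℤ}
    {u : ι → M} : u ∈ (G.pi w).H d ↔ ∀ i, u i ∈ G.H (d - w i) := by
  rw [mem_H, funext_iff]; rfl

/-- The bigrading of a free module. -/
def freeBigrading {ι : Type} (w : ι → ℤ × ℤ) : Bigrading k n p (ι →₀ PolyS k n p) where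
  pr d := Finsupp.liftAddHom fun i =>
    (Finsupp.singleAddHom i).comp ((polyBigrading k n p).pr (d - w i))
  pr_pr d e u := by
    induction u using Finsupp.induction_linear with
    | zero => simp
    | add u v hu hv => simp only [map_add, hu, hv]; split_ifs <;> simp
    | single i c =>
      simp only [Finsupp.liftAddHom_apply_single, AddMonoidHom.comp_apply,
        Finsupp.singleAddHom_apply, Bigrading.pr_pr, sub_left_inj]
      split_ifs <;> simp
  pr_smul d e s u hs := by
    induction u using Finsupp.induction_linear with
    | zero => simp
    | add u v hu hv => simp only [map_add, hu, hv, smul_add]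
    | single i c =>
      simp only [Finsupp.smul_single, Finsupp.liftAddHom_apply_single, AddMonoidHom.comp_apply,
        Finsupp.singleAddHom_apply]
      rw [add_sub_right_comm, (polyBigrading k n p).pr_smul _ _ _ _ hs]

lemma freeBigrading_pr_single {ι : Type} (w : ι → ℤ × ℤ) (d : ℤ × ℤ) (i : ι) (c : PolyS k n p) :
    (freeBigrading w).pr d (Finsupp.single i c) =
      Finsupp.single i ((polyBigrading k n p).pr (d - w i) c) := by
  simp [freeBigrading]

lemma freeBigrading_pr_apply {ι : Type} (w : ι → ℤ × ℤ) (d : ℤ × ℤ) (u : ι →₀ PolyS k n p)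
    (i : ι) : (freeBigrading w).pr d u i = (polyBigrading k n p).pr (d - w i) (u i) := by
  induction u using Finsupp.induction_linear with
  | zero => simp
  | add u v hu hv => simp only [map_add, Finsupp.add_apply, hu, hv]
  | single j c =>
    rw [freeBigrading_pr_single]
    by_cases h : j = i
    · subst h; simp
    · simp [h]

lemma mem_freeBigrading {ι : Type} {w : ι → ℤ × ℤ} {d : ℤ × ℤ} {u : ι →₀ PolyS k n p} :
    u ∈ (freeBigrading w).H d ↔ ∀ i, u i ∈ piece k n p (d - w i) := by
  rw [Bigrading.mem_H, DFunLike.ext_iff]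
  simp only [freeBigrading_pr_apply, ← mem_polyBigrading, Bigrading.mem_H]

end Bigrading

/-! ### Double complexes built from the Koszul complex of some variables -/

/-- A chain complex of bigraded `S`-modules. -/
structure BGComplex (k : Type) [Field k] (n p : ℕ) where
  X : ℕ → Type
  [grp : ∀ i, AddCommGroup (X i)]
  [mod : ∀ i, Module (PolyS k n p) (X i)]
  gr : ∀ i, Bigrading k n p (X i)
  d : ∀ i, X (i + 1) →ₗ[PolyS k n p] X i
  d_graded : ∀ i, IsGraded (gr (i + 1)) (gr i) (d i)
  d_d : ∀ i u, d i (d (i + 1) u) = 0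

attribute [instance] BGComplex.grp BGComplex.mod

section Graded

variable {k : Type} [Field k] {n p N : ℕ} {M : Type} [AddCommGroup M] [Module (PolyS k n p) M]
  {M' : Type} [AddCommGroup M'] [Module (PolyS k n p) M']

/-- The bigrading of a Koszul complex whose `j`-th generator has degree `w j`. -/
def Bigrading.koszul (G : Bigrading k n p M) (w : Fin N → ℤ × ℤ) :
    Bigrading k n p (Finset (Fin N) → M) :=
  G.pi fun I => ∑ j ∈ I, w j

lemma koszulD_graded (G : Bigrading k n p M) (w : Fin N → ℤ × ℤ) {c : Fin N → PolyS k n p}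
    (hc : ∀ j, c j ∈ piece k n p (w j)) :
    IsGraded (G.koszul w) (G.koszul w) (koszulD c) := by
  intro d u
  ext I
  rw [Bigrading.koszul, G.pi_pr, koszulD_apply, koszulD_apply, map_sum]
  refine Finset.sum_congr rfl fun j _ => ?_
  split_ifs with hj
  · simp
  · rw [G.pr_smul' (hc j), map_zsmul, G.pi_pr, Finset.sum_insert hj]
    congr 3
    abel_nf

lemma koszul_map_graded {G : Bigrading k n p M} {G' : Bigrading k n p M'} (w : Fin N → ℤ × ℤ)
    {f : M → M'} (hf : IsGraded G G' f) :
    IsGraded (G.koszul w) (G'.koszul w) (fun u I => f (u I)) := by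
  intro d u
  ext I
  exact hf _ _

lemma cardProj_mem_koszul {G : Bigrading k n p M} {w : Fin N → ℤ × ℤ} {d : ℤ × ℤ} (s : ℤ)
    {u : Finset (Fin N) → M} (hu : u ∈ (G.koszul w).H d) : cardProj s u ∈ (G.koszul w).H d := by
  rw [Bigrading.koszul, Bigrading.mem_pi] at hu ⊢
  intro I
  unfold cardProj
  split_ifs
  · exact hu I
  · exact zero_mem _

variable (k) in
/-- The Koszul differential of the variables `ν`. -/
def varD (ν : Fin N → Fin n ⊕ Fin p) :
    (Finset (Fin N) → M) →ₗ[PolyS k n p] (Finset (Fin N) → M) :=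
  koszulD fun j => X (ν j)

lemma X_mem_piece (v : Fin n ⊕ Fin p) : (X v : PolyS k n p) ∈ piece k n p (bideg n p v) :=
  isWeightedHomogeneous_X _ _ _

lemma varD_graded (G : Bigrading k n p M) (ν : Fin N → Fin n ⊕ Fin p) :
    IsGraded (G.koszul (bideg n p ∘ ν)) (G.koszul (bideg n p ∘ ν)) (varD k ν) :=
  koszulD_graded G _ fun j => X_mem_piece (ν j)

/-- Elements of the Koszul complex of the variables `ν` with coefficients in `M`, of homological
degree `s` and bidegree `d`. -/
def Bigrading.kpart (G : Bigrading k n p M) (ν : Fin N → Fin n ⊕ Fin p) (d : ℤ × ℤ) (s : ℤ) :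
    AddSubgroup (Finset (Fin N) → M) :=
  (cardPart (PolyS k n p) N M s).toAddSubgroup ⊓ (G.koszul (bideg n p ∘ ν)).H d

variable {G : Bigrading k n p M} {G' : Bigrading k n p M'} {ν : Fin N → Fin n ⊕ Fin p}
  {d : ℤ × ℤ} {s : ℤ}

lemma mem_kpart {u : Finset (Fin N) → M} : u ∈ G.kpart ν d s ↔
    u ∈ cardPart (PolyS k n p) N M s ∧ ∀ I, u I ∈ G.H (d - ∑ j ∈ I, bideg n p (ν j)) := by
  rw [Bigrading.kpart, AddSubgroup.mem_inf, Bigrading.koszul, Bigrading.mem_pi]; rfl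

lemma varD_mem {u : Finset (Fin N) → M} (hu : u ∈ G.kpart ν d (s + 1)) :
    varD k ν u ∈ G.kpart ν d s :=
  ⟨koszulD_mem_cardPart _ hu.1, (varD_graded G ν).mem hu.2⟩

lemma varD_varD (u : Finset (Fin N) → M) : varD k ν (varD k ν u) = 0 :=
  koszulD_koszulD (fun j => (X (ν j) : PolyS k n p)) u

lemma kmap_mem {f : M →ₗ[PolyS k n p] M'} (hf : IsGraded G G' f) {u : Finset (Fin N) → M}
    (hu : u ∈ G.kpart ν d s) : f.compLeft (Finset (Fin N)) u ∈ G'.kpart ν d s := by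
  refine ⟨fun I hI => ?_, (koszul_map_graded _ hf).mem hu.2⟩
  change f (u I) = 0
  rw [hu.1 I hI, map_zero]

lemma varD_kmap (f : M →ₗ[PolyS k n p] M') (u : Finset (Fin N) → M) :
    varD k ν (f.compLeft (Finset (Fin N)) u) = f.compLeft (Finset (Fin N)) (varD k ν u) :=
  koszulD_compLeft _ f u

lemma kpart_smul_mem {e : ℤ × ℤ} {r : PolyS k n p} (hr : r ∈ piece k n p e)
    {u : Finset (Fin N) → M} (hu : u ∈ G.kpart ν d s) : r • u ∈ G.kpart ν (d + e) s :=
  ⟨Submodule.smul_mem _ _ hu.1, Bigrading.smul_mem hr hu.2⟩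

lemma pow_mem_piece {e : ℤ × ℤ} {r : PolyS k n p} (hr : r ∈ piece k n p e) (Q : ℕ) :
    r ^ Q ∈ piece k n p (Q • e) :=
  IsWeightedHomogeneous.pow hr Q

lemma varD_lift {u : Finset (Fin N) → M} {c : Finset (Fin N) → M} (hc : c ∈ G.kpart ν d s)
    (h : varD k ν u = c) : ∃ w ∈ G.kpart ν d (s + 1), varD k ν w = c := by
  obtain ⟨u', hu', h'⟩ := (varD_graded G ν).lift hc.2 h
  refine ⟨cardProj (s + 1) u', ⟨cardProj_mem (R := PolyS k n p) _ _, cardProj_mem_koszul _ hu'⟩, ?_⟩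
  rw [varD, koszulD_cardProj]
  change cardProj s (varD k ν u') = c
  rw [h', cardProj_of_mem (R := PolyS k n p) hc.1]

open RingTheory.Sequence in
lemma varD_exact (hreg : IsWeaklyRegular M (List.ofFn fun j => (X (ν j) : PolyS k n p)))
    (hs : 1 ≤ s) {c : Finset (Fin N) → M} (hc : c ∈ G.kpart ν d s) (h : varD k ν c = 0) :
    ∃ w ∈ G.kpart ν d (s + 1), varD k ν w = c := by
  obtain ⟨t, rfl⟩ := Int.eq_ofNat_of_zero_le (by omega : 0 ≤ s)
  obtain ⟨u, hu⟩ := koszul_depth (fun j => (X (ν j) : PolyS k n p)) 1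
    (List.ofFn fun j => X (ν j)) (by
      intro r hr
      rw [List.mem_ofFn] at hr
      obtain ⟨j, rfl⟩ := hr
      rw [one_mul]
      exact Ideal.subset_span ⟨j, rfl⟩) M hreg t (by simp; omega) c hc.1 h
  rw [one_pow, one_smul] at hu
  exact varD_lift hc hu

/-- Liftability of homogeneous elements along a coefficient map. -/
lemma kmap_lift (f : M →ₗ[PolyS k n p] M') {c : Finset (Fin N) → M'} (hc : c ∈ G'.kpart ν d s)
    (h : ∀ I : Finset (Fin N), (I.card : ℤ) = s →
      ∃ w ∈ G.H (d - ∑ j ∈ I, bideg n p (ν j)), f w = c I) :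
    ∃ w ∈ G.kpart ν d s, f.compLeft (Finset (Fin N)) w = c := by
  choose! w hw hfw using h
  refine ⟨fun I => if (I.card : ℤ) = s then w I else 0, mem_kpart.2 ⟨fun I hI => if_neg hI,
    fun I => ?_⟩, ?_⟩
  · split_ifs with hI
    · exact hw I hI
    · exact zero_mem _
  · ext I
    change f (if _ then _ else _) = _
    split_ifs with hI
    · exact hfw I hI
    · rw [map_zero, hc.1 I hI]

end Graded

section Staircase

variable {k : Type} [Field k] {n p N : ℕ} (Y : BGComplex k n p) (ν : Fin N → Fin n ⊕ Fin p)

/-- The differential of `Y` applied to the coefficients of a Koszul complex. -/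
def BGComplex.kd (N : ℕ) (i : ℕ) :
    (Finset (Fin N) → Y.X (i + 1)) →ₗ[PolyS k n p] (Finset (Fin N) → Y.X i) :=
  (Y.d i).compLeft _

variable {Y ν}

lemma kd_mem {i : ℕ} {d : ℤ × ℤ} {s : ℤ} {u : Finset (Fin N) → Y.X (i + 1)}
    (hu : u ∈ (Y.gr (i + 1)).kpart ν d s) : Y.kd N i u ∈ (Y.gr i).kpart ν d s :=
  kmap_mem (Y.d_graded i) hu

lemma varD_kd {i : ℕ} (u : Finset (Fin N) → Y.X (i + 1)) :
    varD k ν (Y.kd N i u) = Y.kd N i (varD k ν u) := varD_kmap _ _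

lemma kd_kd {i : ℕ} (u : Finset (Fin N) → Y.X (i + 2)) : Y.kd N i (Y.kd N (i + 1) u) = 0 := by
  ext I; exact Y.d_d i _

variable (Y ν)

/-- The vertical boundary of `c` is a horizontal boundary. -/
def CondZ (d : ℤ × ℤ) (s : ℤ) : (i : ℕ) → (Finset (Fin N) → Y.X i) → Prop
  | 0, _ => True
  | j + 1, c => ∃ e ∈ (Y.gr j).kpart ν d (s + 1), Y.kd N j c = varD k ν e

/-- The horizontal boundary of `c` is a vertical boundary. -/
def CondX (d : ℤ × ℤ) (s : ℤ) (i : ℕ) (c : Finset (Fin N) → Y.X i) : Prop :=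
  ∃ e ∈ (Y.gr (i + 1)).kpart ν d (s - 1), varD k ν c = Y.kd N i e

/-- The `g`-torsion statement propagated along staircases in the double complex. -/
def Stair (g : PolyS k n p) (e : ℤ × ℤ) (D : Set (ℤ × ℤ)) (s : ℤ) (i : ℕ) : Prop :=
  ∀ d ∈ D, ∀ c ∈ (Y.gr i).kpart ν d s, CondX Y ν d s i c → CondZ Y ν d s i c →
    ∃ Q : ℕ, ∃ w ∈ (Y.gr i).kpart ν (d + Q • e) (s + 1),
      ∃ v ∈ (Y.gr (i + 1)).kpart ν (d + Q • e) s, g ^ Q • c = varD k ν w + Y.kd N i v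

/-- Exactness in the direction of `Y`, up to powers of `g`. -/
def VertExact (g : PolyS k n p) (e : ℤ × ℤ) (D : Set (ℤ × ℤ)) (s : ℤ) (i : ℕ) : Prop :=
  ∀ d ∈ D, ∀ c ∈ (Y.gr (i + 1)).kpart ν d s, Y.kd N i c = 0 →
    ∃ Q : ℕ, ∃ w ∈ (Y.gr (i + 2)).kpart ν (d + Q • e) s, Y.kd N (i + 1) w = g ^ Q • c

open RingTheory.Sequence

variable {Y ν}

variable {g : PolyS k n p} {e : ℤ × ℤ} {D : Set (ℤ × ℤ)} {s : ℤ} {i : ℕ}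

lemma stair_down (hg : g ∈ piece k n p e) (hD : ∀ d ∈ D, ∀ Q : ℕ, d + Q • e ∈ D)
    (hreg : ∀ i, IsWeaklyRegular (Y.X i) (List.ofFn fun j => (X (ν j) : PolyS k n p)))
    (hs : 0 ≤ s) (hZ : VertExact Y ν g e D s i) (h : Stair Y ν g e D (s + 1) i) :
    Stair Y ν g e D s (i + 1) := by
  intro d hd c hc _ hcz
  obtain ⟨e', he', hce⟩ := hcz
  have hez : CondZ Y ν d (s + 1) i e' := by
    cases i with
    | zero => trivial
    | succ j =>
      have h0 : varD k ν (Y.kd N j e') = 0 := by rw [varD_kd, ← hce, kd_kd]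
      obtain ⟨w, hw, hw'⟩ := varD_exact (hreg j) (by omega) (kd_mem he') h0
      exact ⟨w, hw, hw'.symm⟩
  obtain ⟨Q, w, hw, w', hw', heq⟩ := h d hd e' he'
    ⟨c, by rwa [add_sub_cancel_right], hce.symm⟩ hez
  have hcyc : Y.kd N i (g ^ Q • c - varD k ν w') = 0 := by
    rw [map_sub, map_smul, hce, ← varD_kd, ← map_smul, heq, map_add, varD_varD, zero_add, sub_self]
  have hmem : g ^ Q • c - varD k ν w' ∈ (Y.gr (i + 1)).kpart ν (d + Q • e) s :=
    sub_mem (kpart_smul_mem (pow_mem_piece hg Q) hc) (varD_mem hw')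
  obtain ⟨Q', w'', hw'', heq'⟩ := hZ _ (hD d hd Q) _ hmem hcyc
  refine ⟨Q + Q', g ^ Q' • w', ?_, w'', ?_, ?_⟩
  · rw [add_smul, ← add_assoc]
    exact kpart_smul_mem (pow_mem_piece hg Q') hw'
  · rwa [add_smul, ← add_assoc]
  · rw [heq', map_smul, smul_sub, smul_smul, ← pow_add, add_comm Q']
    abel

lemma stair_up (hg : g ∈ piece k n p e)
    (hreg : ∀ i, IsWeaklyRegular (Y.X i) (List.ofFn fun j => (X (ν j) : PolyS k n p)))
    (hs : 0 ≤ s) (hD : ∀ d ∈ D, ∀ Q : ℕ, d + Q • e ∈ D)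
    (hZ : 1 ≤ s → VertExact Y ν g e D (s - 1) i) (h : Stair Y ν g e D s (i + 1)) :
    Stair Y ν g e D (s + 1) i := by
  intro d hd c hc hcx _
  obtain ⟨e', he', hce⟩ := hcx
  rw [add_sub_cancel_right] at he'
  have hex : ∃ Q : ℕ, CondX Y ν (d + Q • e) s (i + 1) (g ^ Q • e') := by
    have hm : varD k ν e' ∈ (Y.gr (i + 1)).kpart ν d (s - 1) := varD_mem (by rwa [sub_add_cancel])
    rcases eq_or_lt_of_le hs with h0 | h0
    · refine ⟨0, 0, zero_mem _, ?_⟩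
      have : varD k ν e' = 0 := by
        ext I; exact hm.1 I (by omega)
      rw [map_smul, this, map_zero, smul_zero]
    · obtain ⟨Q, w, hw, hw'⟩ := hZ (by omega) d hd _ hm (by rw [← varD_kd, ← hce, varD_varD])
      exact ⟨Q, w, hw, by rw [hw', map_smul]⟩
  obtain ⟨Q, hex⟩ := hex
  obtain ⟨Q', w, hw, w', hw', heq⟩ := h _ (hD d hd Q) (g ^ Q • e')
    (kpart_smul_mem (pow_mem_piece hg Q) he') hex
    ⟨g ^ Q • c, kpart_smul_mem (pow_mem_piece hg Q) hc, by rw [map_smul, map_smul, hce]⟩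
  rw [add_assoc, ← add_smul] at hw
  have hcyc : varD k ν (g ^ (Q + Q') • c - Y.kd N i w) = 0 := by
    rw [map_sub, map_smul, hce, varD_kd, pow_add, mul_comm, mul_smul, ← map_smul, ← map_smul, heq,
      map_add, kd_kd, add_zero, sub_self]
  have hmem : g ^ (Q + Q') • c - Y.kd N i w ∈ (Y.gr i).kpart ν (d + (Q + Q') • e) (s + 1) :=
    sub_mem (kpart_smul_mem (pow_mem_piece hg _) hc) (kd_mem hw)
  obtain ⟨w'', hw'', heq'⟩ := varD_exact (hreg i) (by omega) hmem hcyc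
  exact ⟨Q + Q', w'', hw'', w, hw, by rw [heq']; abel⟩

lemma stair_down_all (hg : g ∈ piece k n p e) (hD : ∀ d ∈ D, ∀ Q : ℕ, d + Q • e ∈ D)
    (hreg : ∀ i, IsWeaklyRegular (Y.X i) (List.ofFn fun j => (X (ν j) : PolyS k n p)))
    {q : ℕ} (hZ : ∀ s i : ℕ, s + i + 1 = q → VertExact Y ν g e D s i)
    (h : Stair Y ν g e D q 0) : Stair Y ν g e D 0 q := by
  have : ∀ i s : ℕ, s + i = q → Stair Y ν g e D s i := by
    intro i
    induction i with
    | zero => intro s hs; rw [add_zero] at hs; exact hs ▸ h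
    | succ i ih =>
      intro s hs
      refine stair_down hg hD hreg (by omega) (hZ s i (by omega)) ?_
      exact_mod_cast ih (s + 1) (by omega)
  exact_mod_cast this q 0 (by omega)

lemma stair_up_to (hg : g ∈ piece k n p e) (hD : ∀ d ∈ D, ∀ Q : ℕ, d + Q • e ∈ D)
    (hreg : ∀ i, IsWeaklyRegular (Y.X i) (List.ofFn fun j => (X (ν j) : PolyS k n p)))
    {q : ℕ} (hZ : ∀ s i : ℕ, s + i + 2 = q → VertExact Y ν g e D s i)
    (h : Stair Y ν g e D 0 q) : ∀ s i : ℕ, s + i = q → Stair Y ν g e D s i := by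
  intro s
  induction s with
  | zero => intro i hi; rw [zero_add] at hi; subst hi; exact_mod_cast h
  | succ s ih =>
    intro i hi
    push_cast
    refine stair_up hg hreg (by omega) hD (fun hs => ?_) (ih (i + 1) (by omega))
    obtain ⟨t, rfl⟩ : ∃ t, s = t + 1 := ⟨s - 1, by omega⟩
    have := hZ t i (by omega)
    push_cast
    rwa [add_sub_cancel_right]

/-- Vertical exactness can be checked on coefficients. -/
lemma vertExact_of_coeff {Q : ℕ} (hg : g ∈ piece k n p e)
    (h : ∀ d ∈ D, ∀ I : Finset (Fin N), (I.card : ℤ) = s →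
      ∀ u ∈ (Y.gr (i + 1)).H (d - ∑ j ∈ I, bideg n p (ν j)), Y.d i u = 0 →
        ∃ w, Y.d (i + 1) w = g ^ Q • u) : VertExact Y ν g e D s i := by
  intro d hd c hc hcyc
  refine ⟨Q, kmap_lift (Y.d (i + 1)) (kpart_smul_mem (pow_mem_piece hg Q) hc) fun I hI => ?_⟩
  obtain ⟨w, hw⟩ := h d hd I hI (c I) ((mem_kpart.1 hc).2 I) (congrFun hcyc I)
  refine (Y.d_graded (i + 1)).lift ?_ hw
  have := Bigrading.smul_mem (pow_mem_piece hg Q) ((mem_kpart.1 hc).2 I)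
  rwa [sub_add_eq_add_sub] at this

end Staircase

/-! ### Augmented complexes -/

section Augmentation

variable {k : Type} [Field k] {n p N : ℕ} {M : Type} [AddCommGroup M] [Module (PolyS k n p) M]

/-- Vanishing, up to powers of `g`, of the Koszul homology of `M` in homological degree `s`. -/
def KoszulVanish (G : Bigrading k n p M) (ν : Fin N → Fin n ⊕ Fin p) (g : PolyS k n p)
    (e : ℤ × ℤ) (D : Set (ℤ × ℤ)) (s : ℤ) : Prop :=
  ∀ d ∈ D, ∀ c ∈ G.kpart ν d s, varD k ν c = 0 →
    ∃ Q : ℕ, ∃ w ∈ G.kpart ν (d + Q • e) (s + 1), varD k ν w = g ^ Q • c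

/-- Exactness at `Y₀` of the augmentation of `Y`, up to powers of `g`. -/
def AugExact (Y : BGComplex k n p) (ν : Fin N → Fin n ⊕ Fin p) (π : Y.X 0 →ₗ[PolyS k n p] M)
    (g : PolyS k n p) (e : ℤ × ℤ) (D : Set (ℤ × ℤ)) (s : ℤ) : Prop :=
  ∀ d ∈ D, ∀ c ∈ (Y.gr 0).kpart ν d s, π.compLeft (Finset (Fin N)) c = 0 →
    ∃ Q : ℕ, ∃ w ∈ (Y.gr 1).kpart ν (d + Q • e) s, Y.kd N 0 w = g ^ Q • c

variable {Y : BGComplex k n p} {G : Bigrading k n p M} {ν : Fin N → Fin n ⊕ Fin p}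
  {π : Y.X 0 →ₗ[PolyS k n p] M} {g : PolyS k n p} {e : ℤ × ℤ} {D : Set (ℤ × ℤ)} {s : ℤ}

lemma kmap_lift_of_surjective (hπ : IsGraded (Y.gr 0) G π) (hsurj : Function.Surjective π)
    {d : ℤ × ℤ} {c : Finset (Fin N) → M} (hc : c ∈ G.kpart ν d s) :
    ∃ w ∈ (Y.gr 0).kpart ν d s, π.compLeft (Finset (Fin N)) w = c :=
  kmap_lift π hc fun I _ => by
    obtain ⟨u, hu⟩ := hsurj (c I)
    exact hπ.lift ((mem_kpart.1 hc).2 I) hu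

lemma koszulVanish_of_stair (hg : g ∈ piece k n p e) (hD : ∀ d ∈ D, ∀ Q : ℕ, d + Q • e ∈ D)
    (hπ : IsGraded (Y.gr 0) G π) (hsurj : Function.Surjective π) (hcomp : ∀ u, π (Y.d 0 u) = 0)
    (hex : AugExact Y ν π g e D (s - 1)) (h : Stair Y ν g e D s 0) :
    KoszulVanish G ν g e D s := by
  intro d hd c hc hcyc
  obtain ⟨c', hc', rfl⟩ := kmap_lift_of_surjective hπ hsurj hc
  rw [varD_kmap] at hcyc
  obtain ⟨Q, w, hw, hw'⟩ := hex d hd _ (varD_mem (by rwa [sub_add_cancel])) hcyc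
  obtain ⟨Q', u, hu, u', hu', heq⟩ := h _ (hD d hd Q) (g ^ Q • c')
    (kpart_smul_mem (pow_mem_piece hg Q) hc') ⟨w, hw, by rw [hw', map_smul]⟩ trivial
  rw [add_assoc, ← add_smul] at hu
  refine ⟨Q + Q', π.compLeft _ u, kmap_mem hπ hu, ?_⟩
  have := congrArg (π.compLeft (Finset (Fin N))) heq
  rw [map_add, map_smul, map_smul, smul_smul, ← pow_add, add_comm Q', ← varD_kmap] at this
  rw [this]
  convert (add_zero _).symm using 2
  ext I
  exact hcomp _

lemma stair_of_koszulVanish (hg : g ∈ piece k n p e) (hD : ∀ d ∈ D, ∀ Q : ℕ, d + Q • e ∈ D)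
    (hπ : IsGraded (Y.gr 0) G π) (hsurj : Function.Surjective π) (hcomp : ∀ u, π (Y.d 0 u) = 0)
    (hex : AugExact Y ν π g e D s) (h : KoszulVanish G ν g e D s) :
    Stair Y ν g e D s 0 := by
  intro d hd c hc hcx _
  obtain ⟨e', _, hce⟩ := hcx
  have hz : ∀ u : Finset (Fin N) → Y.X 1, π.compLeft (Finset (Fin N)) (Y.kd N 0 u) = 0 := by
    intro u; ext I; exact hcomp _
  obtain ⟨Q, w, hw, hw'⟩ := h d hd _ (kmap_mem hπ hc) (by rw [varD_kmap, hce, hz])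
  obtain ⟨u, hu, rfl⟩ := kmap_lift_of_surjective hπ hsurj hw
  obtain ⟨Q', w', hw'', heq⟩ := hex _ (hD d hd Q) (g ^ Q • c - varD k ν u)
    (sub_mem (kpart_smul_mem (pow_mem_piece hg Q) hc) (varD_mem hu))
    (by rw [map_sub, map_smul, ← varD_kmap, hw', sub_self])
  rw [add_assoc, ← add_smul] at hw''
  refine ⟨Q + Q', g ^ Q' • u, ?_, w', hw'', ?_⟩
  · rw [add_smul, ← add_assoc]
    exact kpart_smul_mem (pow_mem_piece hg Q') hu
  · rw [heq, map_smul, smul_sub, smul_smul, ← pow_add, add_comm Q']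
    abel

/-- Exactness of the augmentation can be checked on coefficients. -/
lemma augExact_of_coeff {Q : ℕ} (hg : g ∈ piece k n p e)
    (h : ∀ d ∈ D, ∀ I : Finset (Fin N), (I.card : ℤ) = s →
      ∀ u ∈ (Y.gr 0).H (d - ∑ j ∈ I, bideg n p (ν j)), π u = 0 →
        ∃ w, Y.d 0 w = g ^ Q • u) : AugExact Y ν π g e D s := by
  intro d hd c hc hcyc
  refine ⟨Q, kmap_lift (Y.d 0) (kpart_smul_mem (pow_mem_piece hg Q) hc) fun I hI => ?_⟩
  obtain ⟨w, hw⟩ := h d hd I hI (c I) ((mem_kpart.1 hc).2 I) (congrFun hcyc I)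
  refine (Y.d_graded 0).lift ?_ hw
  have := Bigrading.smul_mem (pow_mem_piece hg Q) ((mem_kpart.1 hc).2 I)
  rwa [sub_add_eq_add_sub] at this

end Augmentation

/-! ### Regular sequences of powers of variables -/

section Regular

open RingTheory.Sequence

lemma isWeaklyRegular_of_flat {R : Type} [CommRing R] {M : Type} [AddCommGroup M] [Module R M]
    [Module.Flat R M] {rs : List R} (h : IsWeaklyRegular R rs) : IsWeaklyRegular M rs := by
  have := h.isWeaklyRegular_lTensor (M₂ := M)
  exact ((TensorProduct.rid R M).isWeaklyRegular_congr rs).1 this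

lemma mem_span_X_pow {k : Type} [Field k] {σ ι : Type} (ν : ι → σ) (e : ι → ℕ) (J : Set ι)
    (f : MvPolynomial σ k) :
    f ∈ Ideal.span ((fun j => (X (ν j) : MvPolynomial σ k) ^ e j) '' J) ↔
      ∀ m ∈ f.support, ∃ j ∈ J, e j ≤ m (ν j) := by
  have : (fun j => (X (ν j) : MvPolynomial σ k) ^ e j) '' J =
      (fun s => monomial s 1) '' ((fun j => Finsupp.single (ν j) (e j)) '' J) := by
    rw [Set.image_image]
    simp only [X_pow_eq_monomial]
  rw [this, mem_ideal_span_monomial_image]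
  simp

lemma isWeaklyRegular_X_pow {k : Type} [Field k] {σ : Type} {N : ℕ} (ν : Fin N → σ)
    (hν : Function.Injective ν) (e : Fin N → ℕ) :
    IsWeaklyRegular (MvPolynomial σ k)
      (List.ofFn fun j => (X (ν j) : MvPolynomial σ k) ^ e j) := by
  rw [isWeaklyRegular_iff_Fin]
  intro i
  rw [isSMulRegular_quotient_iff_mem_of_smul_mem]
  have hlen : i.1 < N := by simpa using i.2
  have hI : (Ideal.ofList ((List.ofFn fun j => (X (ν j) : MvPolynomial σ k) ^ e j).take i) • ⊤ :
      Submodule (MvPolynomial σ k) (MvPolynomial σ k)) =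
      Ideal.span ((fun j => (X (ν j) : MvPolynomial σ k) ^ e j) '' {j | j.1 < i.1}) := by
    rw [smul_eq_mul, Ideal.mul_top, Ideal.ofList]
    congr 1
    ext r
    simp only [Set.mem_ofPred_eq, List.mem_take_iff_getElem, List.getElem_ofFn, Set.mem_image]
    constructor
    · rintro ⟨j, hj, rfl⟩
      simp only [List.length_ofFn] at hj
      exact ⟨⟨j, by omega⟩, by simp only; omega, rfl⟩
    · rintro ⟨j, hj, rfl⟩
      have hj' : j.1 < i.1 := hj
      exact ⟨j.1, lt_min hj' (by rw [List.length_ofFn]; exact j.2), rfl⟩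
  rw [hI]
  intro f hf
  rw [mem_span_X_pow] at hf ⊢
  intro m hm
  obtain ⟨j, hj, hjm⟩ := hf (Finsupp.single (ν ⟨i, hlen⟩) (e ⟨i, hlen⟩) + m) (by
    simp only [Fin.getElem_fin, List.getElem_ofFn, X_pow_eq_monomial, mem_support_iff, smul_eq_mul,
      coeff_monomial_mul, one_mul]
    exact mem_support_iff.1 hm)
  refine ⟨j, hj, ?_⟩
  have hne : ν ⟨i, hlen⟩ ≠ ν j := fun h => by
    have h1 : i.1 = j.1 := congrArg Fin.val (hν h)
    have h2 : j.1 < i.1 := hj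
    omega
  simpa [Finsupp.single_apply, hne] using hjm

end Regular

section Free

variable {k : Type} [Field k] {n p : ℕ} {M : Type} [AddCommGroup M] [Module (PolyS k n p) M]

lemma isGraded_of_mem {ι : Type} {w : ι → ℤ × ℤ} {G : Bigrading k n p M}
    (f : (ι →₀ PolyS k n p) →ₗ[PolyS k n p] M)
    (h : ∀ d, ∀ v ∈ (freeBigrading w).H d, f v ∈ G.H d) : IsGraded (freeBigrading w) G f := by
  intro d u
  induction u using Finsupp.induction_linear with
  | zero => simp
  | add u v hu hv => simp only [map_add, hu, hv]
  | single i c =>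
    induction c using MvPolynomial.induction_on' with
    | add c c' hc hc' => simp only [Finsupp.single_add, map_add, hc, hc']
    | monomial a r =>
      have hm : (Finsupp.single i (monomial a r) : ι →₀ PolyS k n p) ∈
          (freeBigrading w).H (Finsupp.weight (bideg n p) a + w i) := by
        rw [Bigrading.mem_H, freeBigrading_pr_single, add_sub_cancel_right]
        congr 1
        exact Bigrading.mem_H.1 (mem_polyBigrading.2
          (isWeightedHomogeneous_monomial (R := k) (bideg n p) a r rfl))
      by_cases hd : d = Finsupp.weight (bideg n p) a + w i
      · subst hd
        rw [Bigrading.mem_H.1 hm, Bigrading.mem_H.1 (h _ _ hm)]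
      · rw [Bigrading.pr_of_mem_ne hm hd, Bigrading.pr_of_mem_ne (h _ _ hm) hd, map_zero]

end Free

/-! ### The complexes attached to the residual intersection -/

section Pieces

variable {k : Type} [Field k] {n p : ℕ}

lemma weight_bideg (a : (Fin n ⊕ Fin p) →₀ ℕ) :
    Finsupp.weight (bideg n p) a =
      ((∑ i, (a (Sum.inl i) : ℤ)), ∑ j, (a (Sum.inr j) : ℤ)) := by
  rw [Finsupp.weight_apply, Finsupp.sum_fintype _ _ (by simp), Fintype.sum_sum_type]
  simp [bideg, Prod.ext_iff, Prod.fst_sum, Prod.snd_sum]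

lemma piece_eq_zero_of_neg {d : ℤ × ℤ} {u : PolyS k n p} (hu : u ∈ piece k n p d)
    (hd : d.1 < 0 ∨ d.2 < 0) : u = 0 := by
  by_contra h
  obtain ⟨a, ha⟩ := support_nonempty.2 h
  have := hu (mem_support_iff.1 ha)
  rw [weight_bideg] at this
  have h1 : (0 : ℤ) ≤ d.1 := by rw [← this]; positivity
  have h2 : (0 : ℤ) ≤ d.2 := by rw [← this]; positivity
  omega

/-- An ideal generated by homogeneous elements is stable under taking components. -/
lemma pr_mem_span {T : Set (PolyS k n p)} (hT : ∀ t ∈ T, ∃ e, t ∈ piece k n p e)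
    (d : ℤ × ℤ) (u : PolyS k n p) (hu : u ∈ Ideal.span T) :
    (polyBigrading k n p).pr d u ∈ Ideal.span T := by
  induction hu using Submodule.span_induction generalizing d with
  | mem t ht =>
    obtain ⟨e, he⟩ := hT t ht
    by_cases h : d = e
    · subst h
      rw [Bigrading.mem_H.1 (mem_polyBigrading.2 he)]
      exact Ideal.subset_span ht
    · rw [Bigrading.pr_of_mem_ne (mem_polyBigrading.2 he) h]
      exact zero_mem _
  | zero => rw [map_zero]; exact zero_mem _
  | add u v _ _ hu hv => rw [map_add]; exact add_mem (hu d) (hv d)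
  | smul s u _ hu =>
    induction s using MvPolynomial.induction_on' with
    | add s s' hs hs' => rw [add_smul, map_add]; exact add_mem hs hs'
    | monomial c a =>
      rw [Bigrading.pr_smul' _ (isWeightedHomogeneous_monomial (R := k) (bideg n p) c a rfl)]
      exact Ideal.mul_mem_left _ _ (hu _)

end Pieces

section Koszul

variable {k : Type} [Field k] {n m p : ℕ} (z : Fin m → PolyS k n p)

lemma koszul_pr_mem_cardPart (w : Fin m → ℤ × ℤ) (i : ℕ) (d : ℤ × ℤ)
    (u : Finset (Fin m) → PolyS k n p) (hu : u ∈ cardPart (PolyS k n p) m (PolyS k n p) i) :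
    ((polyBigrading k n p).koszul w).pr d u ∈ cardPart (PolyS k n p) m (PolyS k n p) i := by
  intro I hI
  rw [Bigrading.koszul, Bigrading.pi_pr, hu I hI, map_zero]

/-- The Koszul complex of a sequence of forms of bidegree `(1,1)`. -/
def koszulComplex (hz : ∀ j, z j ∈ piece k n p (1, 1)) : BGComplex k n p where
  X i := cardPart (PolyS k n p) m (PolyS k n p) i
  gr i := ((polyBigrading k n p).koszul fun _ => (1, 1)).sub _
    fun d u hu => koszul_pr_mem_cardPart _ i d u hu
  d i := (koszulD z).restrict fun u hu => koszulD_mem_cardPart z (by exact_mod_cast hu)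
  d_graded i d u := Subtype.ext (koszulD_graded (polyBigrading k n p) _ hz d u.1)
  d_d i u := Subtype.ext (koszulD_koszulD z u.1)

variable {z} {hz : ∀ j, z j ∈ piece k n p (1, 1)}

lemma coe_koszulComplex_d (i : ℕ) (u : (koszulComplex z hz).X (i + 1)) :
    ((koszulComplex z hz).d i u).1 = koszulD z u.1 := rfl

lemma mem_koszulComplex_gr {i : ℕ} {d : ℤ × ℤ} {u : (koszulComplex z hz).X i} :
    u ∈ ((koszulComplex z hz).gr i).H d ↔
      ∀ T : Finset (Fin m), u.1 T ∈ piece k n p (d - (i : ℤ) • (1, 1)) := by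
  refine Subtype.ext_iff.trans (funext_iff.trans (forall_congr' fun T => ?_))
  change (polyBigrading k n p).pr (d - ∑ _j ∈ T, ((1 : ℤ), (1 : ℤ))) (u.1 T) = _ ↔ _
  by_cases hT : (T.card : ℤ) = i
  · rw [← Bigrading.mem_H, mem_polyBigrading, Finset.sum_const, ← natCast_zsmul, hT]
  · rw [u.2 T hT, map_zero]
    simp [zero_mem]

instance (i : ℕ) : Module.Flat (PolyS k n p) ((koszulComplex z hz).X i) := by
  let r : (Finset (Fin m) → PolyS k n p) →ₗ[PolyS k n p]
      cardPart (PolyS k n p) m (PolyS k n p) (i : ℤ) :=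
    { toFun u := ⟨cardProj i u, cardProj_mem _ _⟩
      map_add' u v := by
        apply Subtype.ext; ext I; simp only [cardProj, Submodule.coe_add, Pi.add_apply]
        split_ifs <;> simp
      map_smul' c u := by
        apply Subtype.ext; ext I
        simp only [cardProj, SetLike.val_smul, Pi.smul_apply, RingHom.id_apply]
        split_ifs <;> simp }
  refine Module.Flat.of_retract (cardPart (PolyS k n p) m (PolyS k n p) (i : ℤ)).subtype r ?_
  ext1 u
  exact Subtype.ext (cardProj_of_mem (R := PolyS k n p) u.2)

/-- The element of degree zero of the Koszul complex with a given value. -/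
def koszulZeroEquiv (hz : ∀ j, z j ∈ piece k n p (1, 1)) :
    (koszulComplex z hz).X 0 →ₗ[PolyS k n p] PolyS k n p :=
  (LinearMap.proj ∅).comp (Submodule.subtype _)

lemma koszulZero_graded :
    IsGraded ((koszulComplex z hz).gr 0) (polyBigrading k n p) (koszulZeroEquiv hz) := by
  intro d u
  change _ = (polyBigrading k n p).pr (d - ∑ _j ∈ ∅, ((1 : ℤ), (1 : ℤ))) (u.1 ∅)
  rw [Finset.sum_empty, sub_zero]; rfl

lemma koszulZero_ext {u v : (koszulComplex z hz).X 0}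
    (h : koszulZeroEquiv hz u = koszulZeroEquiv hz v) : u = v := by
  apply Subtype.ext
  ext1 I
  by_cases hI : I = ∅
  · subst hI; exact h
  · have : (I.card : ℤ) ≠ (0 : ℕ) := by simpa using hI
    rw [u.2 I this, v.2 I this]

lemma koszulZero_surjective : Function.Surjective (koszulZeroEquiv hz) := by
  intro r
  refine ⟨⟨fun I => if I = ∅ then r else 0, fun I hI => if_neg (by simpa using hI)⟩, ?_⟩
  exact if_pos (c := (∅ : Finset (Fin m)) = ∅) (e := (0 : PolyS k n p)) rfl

lemma koszulZero_d (u : (koszulComplex z hz).X 1) :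
    koszulZeroEquiv hz ((koszulComplex z hz).d 0 u) = ∑ j, z j * u.1 {j} := by
  change koszulD z u.1 ∅ = _
  rw [koszulD_apply]
  simp [koszulSign]

lemma exists_koszulZero_d {r : PolyS k n p} (hr : r ∈ Ideal.span (Set.range z)) :
    ∃ u, koszulZeroEquiv hz ((koszulComplex z hz).d 0 u) = r := by
  obtain ⟨c, rfl⟩ := (Ideal.mem_span_range_iff_exists_fun).1 hr
  have hmem : (fun I => ∑ j, if I = {j} then c j else 0) ∈
      cardPart (PolyS k n p) m (PolyS k n p) (0 + 1 : ℕ) := by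
    intro I hI
    refine Finset.sum_eq_zero fun j _ => if_neg ?_
    rintro rfl; simp at hI
  refine ⟨⟨_, hmem⟩, ?_⟩
  · refine (koszulZero_d _).trans ?_
    refine Finset.sum_congr rfl fun j _ => ?_
    simp [mul_comm]

lemma koszulZero_d_mem (u : (koszulComplex z hz).X 1) :
    koszulZeroEquiv hz ((koszulComplex z hz).d 0 u) ∈ Ideal.span (Set.range z) := by
  rw [koszulZero_d]
  exact sum_mem fun j _ => Ideal.mul_mem_right _ _ (Ideal.subset_span ⟨j, rfl⟩)

end Koszul

section Residual

variable {k : Type} [Field k] {n m p : ℕ} {φ : Matrix (Fin n) (Fin m) (PolyS k n p)}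

lemma zseq_mem (hφ : ∀ i j, φ i j ∈ piece k n p (0, 1)) (j : Fin m) :
    zseq k n m p φ j ∈ piece k n p (1, 1) := by
  refine sum_mem fun i _ => ?_
  exact (X_mem_piece (Sum.inl i)).mul (hφ i j)

lemma minor_mem (hφ : ∀ i j, φ i j ∈ piece k n p (0, 1)) (r : Fin n ↪ Fin n)
    (c : Fin n ↪ Fin m) : (φ.submatrix r c).det ∈ piece k n p (0, n) := by
  rw [Matrix.det_apply]
  refine sum_mem fun σ _ => ?_
  rw [Units.smul_def]
  refine zsmul_mem ?_ _
  have := IsWeightedHomogeneous.prod Finset.univ (fun i => φ.submatrix r c (σ i) i)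
    (fun _ => ((0 : ℤ), (1 : ℤ))) (fun i _ => hφ (r (σ i)) (c i))
  simpa [piece] using this

lemma X_mul_minor_mem (r : Fin n ↪ Fin n) (c : Fin n ↪ Fin m) (i : Fin n) :
    X (Sum.inl i) * (φ.submatrix r c).det ∈ Ideal.span (Set.range (zseq k n m p φ)) := by
  have hr : Function.Surjective r := Finite.surjective_of_injective r.injective
  obtain ⟨i, rfl⟩ := hr i
  let B := φ.submatrix r c
  have h1 : Matrix.vecMul (fun i => (X (Sum.inl (r i)) : PolyS k n p)) B =
      fun j => zseq k n m p φ (c j) := by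
    ext1 j
    simp only [Matrix.vecMul, dotProduct, zseq, B, Matrix.submatrix_apply]
    exact (Equiv.ofBijective r ⟨r.injective, hr⟩).sum_comp
      (fun i => (X (Sum.inl i) : PolyS k n p) * φ i (c j))
  have h2 := congrArg (fun v => Matrix.vecMul v B.adjugate) h1
  simp only [Matrix.vecMul_vecMul, Matrix.mul_adjugate, Matrix.vecMul_smul, Matrix.vecMul_one]
    at h2
  have h3 := congrFun h2 i
  rw [mul_comm]
  change B.det • (X (Sum.inl (r i)) : PolyS k n p) = _ at h3
  rw [← smul_eq_mul, h3]
  change ∑ j, zseq k n m p φ (c j) * B.adjugate j i ∈ _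
  exact sum_mem fun j _ => Ideal.mul_mem_right _ _ (Ideal.subset_span ⟨c j, rfl⟩)

lemma X_mul_resJ_mem (i : Fin n) {r : PolyS k n p} (hr : r ∈ resJ k n m p φ) :
    X (Sum.inl i) * r ∈ Ideal.span (Set.range (zseq k n m p φ)) := by
  obtain ⟨a, ha, b, hb, rfl⟩ := Submodule.mem_sup.1 hr
  rw [mul_add]
  refine add_mem (Ideal.mul_mem_left _ _ ha) ?_
  clear hr
  induction hb using Submodule.span_induction with
  | mem t ht => obtain ⟨r, c, rfl⟩ := ht; exact X_mul_minor_mem r c i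
  | zero => simp
  | add u v _ _ hu hv => rw [mul_add]; exact add_mem hu hv
  | smul s u _ hu => rw [smul_eq_mul, mul_left_comm]; exact Ideal.mul_mem_left _ _ hu

lemma resJ_eq : resJ k n m p φ = Ideal.span (Set.range (zseq k n m p φ) ∪
    { d | ∃ (r : Fin n ↪ Fin n) (c : Fin n ↪ Fin m), d = (φ.submatrix r c).det }) := by
  rw [Ideal.span_union]; rfl

lemma zspan_pr_mem (hφ : ∀ i j, φ i j ∈ piece k n p (0, 1)) (d : ℤ × ℤ) (u : PolyS k n p)
    (hu : u ∈ Ideal.span (Set.range (zseq k n m p φ))) :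
    (polyBigrading k n p).pr d u ∈ Ideal.span (Set.range (zseq k n m p φ)) := by
  refine pr_mem_span ?_ d u hu
  rintro _ ⟨j, rfl⟩
  exact ⟨_, zseq_mem hφ j⟩

lemma resJ_pr_mem (hφ : ∀ i j, φ i j ∈ piece k n p (0, 1)) (d : ℤ × ℤ) (u : PolyS k n p)
    (hu : u ∈ resJ k n m p φ) : (polyBigrading k n p).pr d u ∈ resJ k n m p φ := by
  rw [resJ_eq] at hu ⊢
  refine pr_mem_span ?_ d u hu
  rintro _ (⟨j, rfl⟩ | ⟨r, c, rfl⟩)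
  · exact ⟨_, zseq_mem hφ j⟩
  · exact ⟨_, minor_mem hφ r c⟩

lemma exists_X_inl_mul {a : (Fin n ⊕ Fin p) →₀ ℕ} {c : k} {d : ℤ × ℤ}
    (h : Finsupp.weight (bideg n p) a = d) (hd : 0 < d.1) :
    ∃ i : Fin n, ∃ b : PolyS k n p, monomial a c = b * X (Sum.inl i) := by
  rw [weight_bideg] at h
  have : ∃ i, a (Sum.inl i) ≠ 0 := by
    by_contra! h0
    have h1 : d.1 = ∑ i, (a (Sum.inl i) : ℤ) := by rw [← h]
    simp [h0] at h1
    omega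
  obtain ⟨i, hi⟩ := this
  refine ⟨i, monomial (a - Finsupp.single (Sum.inl i) 1) c, ?_⟩
  rw [X, monomial_mul, mul_one, tsub_add_cancel_of_le]
  rw [Finsupp.single_le_iff]; omega

/-- In bidegrees of positive `x`-degree, or of `y`-degree less than `n`, the ideals `J` and `(z)`
agree. -/
lemma mem_zspan_of_mem_resJ (hφ : ∀ i j, φ i j ∈ piece k n p (0, 1)) {d : ℤ × ℤ}
    {u : PolyS k n p} (hu : u ∈ resJ k n m p φ) (hd : u ∈ piece k n p d)
    (h : 0 < d.1 ∨ d.2 < n) : u ∈ Ideal.span (Set.range (zseq k n m p φ)) := by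
  rw [← Bigrading.mem_H.1 (mem_polyBigrading.2 hd)]
  obtain ⟨a, ha, b, hb, rfl⟩ := Submodule.mem_sup.1 hu
  rw [map_add]
  refine add_mem (zspan_pr_mem hφ d a ha) ?_
  clear hu hd
  have key : ∀ s : PolyS k n p, ∀ (r : Fin n ↪ Fin n) (c : Fin n ↪ Fin m),
      (polyBigrading k n p).pr d (s • (φ.submatrix r c).det) ∈
        Ideal.span (Set.range (zseq k n m p φ)) := by
    intro s r c
    induction s using MvPolynomial.induction_on' with
    | add s s' hs hs' => rw [add_smul, map_add]; exact add_mem hs hs'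
    | monomial e c' =>
      have hmem : (monomial e c' : PolyS k n p) ∈ piece k n p (Finsupp.weight (bideg n p) e) :=
        isWeightedHomogeneous_monomial _ _ _ rfl
      have hmem2 := Bigrading.smul_mem hmem (mem_polyBigrading.2 (minor_mem hφ r c))
      by_cases hde : d = (0, (n : ℤ)) + Finsupp.weight (bideg n p) e
      · rw [hde, Bigrading.mem_H.1 hmem2]
        have hw := congrArg Prod.fst hde
        have hw2 := congrArg Prod.snd hde
        simp only [Prod.fst_add, Prod.snd_add, zero_add] at hw hw2
        have hpos : 0 ≤ (Finsupp.weight (bideg n p) e).2 := by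
          rw [weight_bideg]; positivity
        obtain ⟨i, b, hb⟩ := exists_X_inl_mul (k := k) (c := c')
          (rfl : Finsupp.weight (bideg n p) e = _) (by omega)
        rw [hb, smul_eq_mul, mul_assoc]
        exact Ideal.mul_mem_left _ _ (X_mul_minor_mem r c i)
      · rw [Bigrading.pr_of_mem_ne hmem2 hde]
        exact zero_mem _
  have key2 : ∀ b ∈ minorsIdeal n φ, ∀ s : PolyS k n p,
      (polyBigrading k n p).pr d (s • b) ∈ Ideal.span (Set.range (zseq k n m p φ)) := by
    intro b hb
    induction hb using Submodule.span_induction with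
    | mem t ht => obtain ⟨r, c, rfl⟩ := ht; exact fun s => key s r c
    | zero => simp
    | add u v _ _ hu hv => intro s; rw [smul_add, map_add]; exact add_mem (hu s) (hv s)
    | smul s u _ hu => intro s'; rw [smul_smul]; exact hu _
  simpa using key2 b hb 1

/-- The bigrading of `S/J`. -/
def resQuot (hφ : ∀ i j, φ i j ∈ piece k n p (0, 1)) :
    Bigrading k n p (PolyS k n p ⧸ resJ k n m p φ) :=
  (polyBigrading k n p).quot _ (resJ_pr_mem hφ)

end Residual

section Resolution

variable {k : Type} [Field k] {n p : ℕ} {β : ℕ → ℤ × ℤ → ℕ}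
  {f : ∀ i : ℕ, FMod k n p β (i + 1) →ₗ[PolyS k n p] FMod k n p β i}

/-- A complex of bigraded free modules. -/
def freeComplex (hex : ∀ i, Function.Exact (f (i + 1)) (f i))
    (hf : ∀ i d v, inPiece k n p β (i + 1) d v → inPiece k n p β i d (f i v)) :
    BGComplex k n p where
  X i := FMod k n p β i
  gr _ := freeBigrading fun q => q.1.1
  d i := f i
  d_graded i := isGraded_of_mem (f i) fun d v hv =>
    mem_freeBigrading.2 (hf i d v (mem_freeBigrading.1 hv))
  d_d i u := (hex i).apply_apply_eq_zero u

end Resolution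

/-! ### Rigidity for torsion homology -/

section Rigidity

variable {k : Type} [Field k] {n p : ℕ}

/-- The quotient of a complex by a graded subcomplex. -/
def BGComplex.quot (C : BGComplex k n p) (N : ∀ i, Submodule (PolyS k n p) (C.X i))
    (hN : ∀ i d, ∀ u ∈ N i, (C.gr i).pr d u ∈ N i)
    (hd : ∀ i, N (i + 1) ≤ (N i).comap (C.d i)) : BGComplex k n p where
  X i := C.X i ⧸ N i
  gr i := (C.gr i).quot (N i) (hN i)
  d i := (N (i + 1)).mapQ (N i) (C.d i) (hd i)
  d_graded i d u := by
    obtain ⟨u, rfl⟩ := (N (i + 1)).mkQ_surjective u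
    exact congrArg (N i).mkQ (C.d_graded i d u)
  d_d i u := by
    obtain ⟨u, rfl⟩ := (N (i + 2)).mkQ_surjective u
    change (N i).mkQ (C.d i (C.d (i + 1) u)) = 0
    rw [C.d_d, map_zero]

/-- Cycles of a complex. -/
def BGComplex.IsCycle (C : BGComplex k n p) : (i : ℕ) → C.X i → Prop
  | 0, _ => True
  | j + 1, u => C.d j u = 0

lemma BGComplex.IsCycle.d (C : BGComplex k n p) (i : ℕ) (u : C.X (i + 1)) :
    C.IsCycle i (C.d i u) := by
  cases i with
  | zero => trivial
  | succ i => exact C.d_d i u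

lemma BGComplex.IsCycle.of_smul {C : BGComplex k n p} {i : ℕ} {t : PolyS k n p}
    (ht : ∀ i, IsSMulRegular (C.X i) t) {u : C.X i} (h : C.IsCycle i (t • u)) :
    C.IsCycle i u := by
  cases i with
  | zero => trivial
  | succ i =>
    change C.d i (t • u) = 0 at h
    rw [map_smul] at h
    exact (ht i).right_eq_zero_of_smul h

open Pointwise

lemma mem_smul_top_iff {R M : Type} [CommRing R] [AddCommGroup M] [Module R M] {t : R} {u : M} :
    u ∈ (t • ⊤ : Submodule R M) ↔ ∃ v, t • v = u := by
  rw [Submodule.mem_smul_pointwise_iff_exists]; simp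

/-- The reduction of a complex modulo a homogeneous element. -/
def BGComplex.modElem (C : BGComplex k n p) {t : PolyS k n p} {e : ℤ × ℤ} (ht : t ∈ piece k n p e) :
    BGComplex k n p :=
  C.quot (fun _ => t • ⊤)
    (fun i d u hu => by
      obtain ⟨v, rfl⟩ := mem_smul_top_iff.1 hu
      rw [Bigrading.pr_smul' _ ht]
      exact mem_smul_top_iff.2 ⟨_, rfl⟩)
    (fun i u hu => by
      obtain ⟨v, rfl⟩ := mem_smul_top_iff.1 hu
      exact mem_smul_top_iff.2 ⟨C.d i v, by rw [map_smul]⟩)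

lemma mkQ_mem_ofList {R M : Type} [CommRing R] [AddCommGroup M] [Module R M] {t : R} {rs : List R}
    {u : M} (hu : u ∈ (Ideal.ofList (t :: rs) • ⊤ : Submodule R M)) :
    (t • ⊤ : Submodule R M).mkQ u ∈
      (Ideal.ofList rs • ⊤ : Submodule R (M ⧸ (t • ⊤ : Submodule R M))) := by
  rw [Ideal.ofList_cons, Submodule.sup_smul] at hu
  obtain ⟨a, ha, b, hb, rfl⟩ := Submodule.mem_sup.1 hu
  rw [Submodule.ideal_span_singleton_smul] at ha
  rw [map_add, show (t • ⊤ : Submodule R M).mkQ a = 0 from (Submodule.Quotient.mk_eq_zero _).2 ha,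
    zero_add]
  have := Submodule.mem_map_of_mem (f := (t • ⊤ : Submodule R M).mkQ) hb
  rw [Submodule.map_smul''] at this
  exact Submodule.smul_mono le_rfl le_top this

lemma X_pow_mem_piece (l : Fin n) (N : ℕ) :
    (X (Sum.inl l) : PolyS k n p) ^ N ∈ piece k n p (N, 0) := by
  have := pow_mem_piece (X_mem_piece (k := k) (Sum.inl l : Fin n ⊕ Fin p)) N
  simpa [bideg] using this

open RingTheory.Sequence

variable {b : ℤ}

lemma torsion_mod {C : BGComplex k n p} {l l' : Fin n} {i N : ℕ}
    (hreg : ∀ i, IsSMulRegular (C.X i) ((X (Sum.inl l) : PolyS k n p) ^ N))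
    (htor : ∀ j, i ≤ j → ∀ a, ∀ h ∈ (C.gr j).H (a, b), C.IsCycle j h →
      ∃ M : ℕ, ∃ w, C.d j w = (X (Sum.inl l') : PolyS k n p) ^ M • h) (j : ℕ) (hj : i + 1 ≤ j)
    (a : ℤ) (h : (C.modElem (X_pow_mem_piece l N)).X j)
    (hh : h ∈ ((C.modElem (X_pow_mem_piece l N)).gr j).H (a, b))
    (hc : (C.modElem (X_pow_mem_piece l N)).IsCycle j h) :
    ∃ M : ℕ, ∃ w, (C.modElem (X_pow_mem_piece l N)).d j w =
      (X (Sum.inl l') : PolyS k n p) ^ M • h := by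
  obtain ⟨j, rfl⟩ : ∃ j', j = j' + 1 := ⟨j - 1, by omega⟩
  set t := (X (Sum.inl l) : PolyS k n p) ^ N with ht
  set x := (X (Sum.inl l') : PolyS k n p) with hx
  obtain ⟨h', rfl⟩ := (t • ⊤ : Submodule _ (C.X (j + 1))).mkQ_surjective h
  obtain ⟨h, hhom, hh'⟩ := (Bigrading.quot_mkQ _ _ _).lift hh rfl
  rw [← hh'] at hc ⊢
  clear hh hh' h'
  have hdt : C.d j h ∈ (t • ⊤ : Submodule _ (C.X j)) := (Submodule.Quotient.mk_eq_zero _).1 hc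
  obtain ⟨g', hg'⟩ := mem_smul_top_iff.1 hdt
  obtain ⟨g, hg, htg⟩ : ∃ g ∈ (C.gr j).H (a - N, b), t • g = C.d j h := by
    refine ⟨(C.gr j).pr (a - N, b) g', Bigrading.pr_mem _ _ _, ?_⟩
    have := (C.gr j).pr_smul' (d := (a, b)) (X_pow_mem_piece (k := k) (p := p) l N) (u := g')
    rw [← ht, hg', Bigrading.mem_H.1 ((C.d_graded j).mem hhom)] at this
    rw [this]
    simp
  have hgc : C.IsCycle j g := .of_smul hreg (htg ▸ BGComplex.IsCycle.d C j h)
  obtain ⟨M, w', hw'⟩ := htor j (by omega) _ g hg hgc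
  obtain ⟨w, hw, hww⟩ := (C.d_graded j).lift (Bigrading.smul_mem (X_pow_mem_piece l' M) hg) hw'
  have hmem : x ^ M • h - t • w ∈ (C.gr (j + 1)).H (a + M, b) := by
    have h1 := Bigrading.smul_mem (X_pow_mem_piece l' M) hhom
    have h2 := Bigrading.smul_mem (X_pow_mem_piece l N) hw
    simp only [Prod.mk_add_mk, add_zero] at h1 h2
    rw [show a - N + M + N = a + M by ring] at h2
    exact sub_mem h1 h2
  obtain ⟨M', v, hv⟩ := htor (j + 1) (by omega) _ _ hmem (by
    change C.d j _ = 0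
    rw [map_sub, map_smul, map_smul, hww, ← htg, smul_comm, sub_self])
  refine ⟨M' + M, (t • ⊤ : Submodule _ (C.X (j + 2))).mkQ v, ?_⟩
  change (t • ⊤ : Submodule _ (C.X (j + 1))).mkQ (C.d (j + 1) v) = _
  rw [hv, map_smul, map_sub, map_smul, smul_sub, smul_smul, ← pow_add]
  rw [show (t • ⊤ : Submodule _ (C.X (j + 1))).mkQ (t • w) = 0 from
    (Submodule.Quotient.mk_eq_zero _).2 (mem_smul_top_iff.2 ⟨w, rfl⟩), smul_zero, sub_zero]
  rfl

/-- If the homology of `C` is torsion with respect to each variable of a list, the powers of the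
variables are regular sequences, and `C_{i+|L|}` vanishes in high degrees modulo large powers of
the variables, then the homology of `C` vanishes at `i`. -/
theorem rigidity (L : List (Fin n)) (hL : L.Nodup) :
    ∀ (C : BGComplex k n p) (i : ℕ) (a : ℤ),
    (∀ (e : Fin n → ℕ) (j : ℕ), IsWeaklyRegular (C.X j)
      (L.map fun l => (X (Sum.inl l) : PolyS k n p) ^ e l)) →
    (∀ l ∈ L, ∀ j, i ≤ j → ∀ a, ∀ h ∈ (C.gr j).H (a, b), C.IsCycle j h →
      ∃ M : ℕ, ∃ w, C.d j w = (X (Sum.inl l) : PolyS k n p) ^ M • h) →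
    (∀ (e : Fin n → ℕ), ∀ u ∈ (C.gr (i + L.length)).H (a + (L.map fun l => (e l : ℤ)).sum, b),
      u ∈ (Ideal.ofList (L.map fun l => (X (Sum.inl l) : PolyS k n p) ^ e l) • ⊤ :
        Submodule (PolyS k n p) (C.X (i + L.length)))) →
    ∀ h ∈ (C.gr i).H (a, b), C.IsCycle i h → ∃ w, C.d i w = h := by
  induction L with
  | nil =>
    intro C i a _ _ hvan h hh _
    have := hvan (fun _ => 0) h (by simpa using hh)
    simp only [List.map_nil, Ideal.ofList_nil, Submodule.bot_smul, Submodule.mem_bot] at this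
    exact ⟨0, by rw [map_zero, this]⟩
  | cons l L ih =>
    obtain ⟨hl, hL⟩ := List.nodup_cons.1 hL
    intro C i a hreg htor hvan h hh hc
    obtain ⟨N, u', hu'⟩ := htor l List.mem_cons_self i le_rfl a h hh hc
    obtain ⟨u, hu, hdu⟩ := (C.d_graded i).lift
      (Bigrading.smul_mem (X_pow_mem_piece l N) hh) hu'
    have hupd : ∀ e : Fin n → ℕ, ∀ (α : Type) (g : Fin n → ℕ → α),
        (l :: L).map (fun j => g j (Function.update e l N j)) =
          g l N :: L.map fun j => g j (e j) := by
      intro e α g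
      rw [List.map_cons, Function.update_self]
      congr 1
      refine List.map_congr_left fun j hj => ?_
      rw [Function.update_of_ne (by rintro rfl; exact hl hj)]
    have hreg' : ∀ (e : Fin n → ℕ) (j : ℕ), IsWeaklyRegular (C.X j)
        ((X (Sum.inl l) : PolyS k n p) ^ N ::
          L.map fun l => (X (Sum.inl l) : PolyS k n p) ^ e l) := by
      intro e j
      have := hreg (Function.update e l N) j
      rwa [hupd e _ fun j q => (X (Sum.inl j) : PolyS k n p) ^ q] at this
    have hN : ∀ j, IsSMulRegular (C.X j) ((X (Sum.inl l) : PolyS k n p) ^ N) := fun j =>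
      ((isWeaklyRegular_cons_iff _ _ _).1 (hreg' (fun _ => 0) j)).1
    obtain ⟨v', hv'⟩ := ih hL (C.modElem (X_pow_mem_piece l N)) (i + 1) (a + N)
      (fun e j => ((isWeaklyRegular_cons_iff _ _ _).1 (hreg' e j)).2)
      (fun l' hl' j hj a h hh hc => torsion_mod hN (fun j hj a h hh hc =>
        htor l' (List.mem_cons_of_mem _ hl') j hj a h hh hc) j hj a h hh hc)
      (by
        intro e u hu
        obtain ⟨v', rfl⟩ := Submodule.mkQ_surjective _ u
        obtain ⟨v, hv, hvv⟩ := (Bigrading.quot_mkQ _ _ _).lift hu rfl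
        rw [← hvv]
        apply mkQ_mem_ofList
        have := hvan (Function.update e l N)
        rw [hupd e _ fun j q => (X (Sum.inl j) : PolyS k n p) ^ q,
          hupd e _ fun _ q => (q : ℤ), List.sum_cons, ← add_assoc, List.length_cons,
          add_comm L.length, ← add_assoc] at this
        exact this v hv)
      ((X (Sum.inl l) ^ N • ⊤ : Submodule _ (C.X (i + 1))).mkQ u)
      ((Bigrading.quot_mkQ _ _ _).mem (by simpa using hu))
      (by
        change (X (Sum.inl l) ^ N • ⊤ : Submodule _ (C.X i)).mkQ (C.d i u) = 0
        rw [hdu]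
        exact (Submodule.Quotient.mk_eq_zero _).2 (mem_smul_top_iff.2 ⟨h, rfl⟩))
    obtain ⟨v, rfl⟩ := Submodule.mkQ_surjective _ v'
    have hvu : C.d (i + 1) v - u ∈ (X (Sum.inl l) ^ N • ⊤ : Submodule _ (C.X (i + 1))) :=
      (Submodule.Quotient.eq _).1 hv'
    obtain ⟨w, hw⟩ := mem_smul_top_iff.1 hvu
    refine ⟨-w, hN i ?_⟩
    change X (Sum.inl l) ^ N • C.d i (-w) = X (Sum.inl l) ^ N • h
    rw [← hdu, map_neg, smul_neg, ← map_smul, hw, map_sub, C.d_d, zero_sub, neg_neg]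

end Rigidity

section Nagata

variable {k : Type} [Field k] {n : ℕ} (f : MvPolynomial (Fin (n + 1)) k)

lemma nagata_comp_neg (c : k) : (NoetherNormalization.T1 f c).comp (NoetherNormalization.T1 f (-c))
    = AlgHom.id _ _ := by
  rw [comp_aeval, ← MvPolynomial.aeval_X_left]
  ext i v
  cases i using Fin.cases <;> simp

/-- Nagata's change of variables. -/
abbrev nagata : MvPolynomial (Fin (n + 1)) k ≃ₐ[k] MvPolynomial (Fin (n + 1)) k :=
  AlgEquiv.ofAlgHom (NoetherNormalization.T1 f 1) (NoetherNormalization.T1 f (-1))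
    (nagata_comp_neg f 1) (by simpa using nagata_comp_neg f (-1))

lemma nagata_weight_ne {v w : Fin (n + 1) →₀ ℕ} (hv : ∀ i, v i < 2 + f.totalDegree)
    (hw : ∀ i, w i < 2 + f.totalDegree) (ne : v ≠ w) :
    ∑ x : Fin (n + 1), (2 + f.totalDegree) ^ x.1 * v x
      ≠ ∑ x : Fin (n + 1), (2 + f.totalDegree) ^ x.1 * w x := by
  intro h
  refine ne <| Finsupp.ext <| congrFun <| List.ofFn_inj.mp ?_
  apply Nat.ofDigits_inj_of_len_eq (Nat.lt_add_right f.totalDegree one_lt_two)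
    (by simp) (by grind) (by grind)
  simpa only [Nat.ofDigits_eq_sum_mapIdx, List.mapIdx_eq_ofFn, List.get_ofFn, List.length_ofFn,
    Fin.val_cast, mul_comm, List.sum_ofFn] using! h

lemma natDegree_nagata_monomial (v : Fin (n + 1) →₀ ℕ) {a : k} (ha : a ≠ 0) :
    (finSuccEquiv k n (nagata f (monomial v a))).natDegree =
      ∑ i : Fin (n + 1), (2 + f.totalDegree) ^ i.1 * v i := by
  rw [monomial_eq, Finsupp.prod_pow v fun a ↦ X a]
  simp only [Fin.prod_univ_succ, Fin.sum_univ_succ, map_mul, map_prod, map_pow,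
    AlgEquiv.ofAlgHom_apply, MvPolynomial.aeval_C, MvPolynomial.aeval_X, if_pos, Fin.succ_ne_zero,
    ite_false, one_smul, map_add, finSuccEquiv_X_zero, finSuccEquiv_X_succ, algebraMap_eq]
  have h (i : Fin n) :
      (Polynomial.C (X (R := k) i) + Polynomial.X ^ ((2 + f.totalDegree) ^ i.succ.1)) ^ v i.succ
        ≠ 0 :=
    pow_ne_zero (v i.succ) (Polynomial.leadingCoeff_ne_zero.mp <| by
      simp [add_comm, Polynomial.leadingCoeff_X_pow_add_C])
  rw [Polynomial.natDegree_mul (by simp [ha]) (mul_ne_zero (by simp)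
    (Finset.prod_ne_zero_iff.mpr (fun i _ ↦ h i))), Polynomial.natDegree_mul (by simp)
      (Finset.prod_ne_zero_iff.mpr (fun i _ ↦ h i)),
    Polynomial.natDegree_prod _ _ (fun i _ ↦ h i), natDegree_finSuccEquiv, degreeOf_C]
  simpa only [Polynomial.natDegree_pow, zero_add, Polynomial.natDegree_X, mul_one, Fin.val_zero,
    pow_zero, one_mul, add_right_inj] using Finset.sum_congr rfl (fun i _ ↦ by
    rw [add_comm (Polynomial.C _), Polynomial.natDegree_X_pow_add_C, mul_comm])

lemma leadingCoeff_nagata_monomial (v : Fin (n + 1) →₀ ℕ) (a : k) :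
    (finSuccEquiv k n (nagata f (monomial v a))).leadingCoeff = C a := by
  rw [monomial_eq, Finsupp.prod_fintype]
  · simp only [map_mul, map_prod, Polynomial.leadingCoeff_mul, Polynomial.leadingCoeff_prod]
    rw [AlgEquiv.ofAlgHom_apply, algHom_C, algebraMap_eq, finSuccEquiv_apply,
      eval₂Hom_C, RingHom.coe_comp]
    simp only [AlgEquiv.ofAlgHom_apply, Function.comp_apply, Polynomial.leadingCoeff_C, map_pow,
      Polynomial.leadingCoeff_pow]
    have : ∀ j, ((finSuccEquiv k n)
        ((NoetherNormalization.T1 f) 1 (X j))).leadingCoeff = 1 := fun j ↦ by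
      by_cases h : j = 0
      · simp [h, finSuccEquiv_apply]
      · simp only [aeval_eq_bind₁, bind₁_X_right, if_neg h, one_smul, map_add, map_pow]
        obtain ⟨i, rfl⟩ := Fin.exists_succ_eq.mpr h
        simp [finSuccEquiv_X_succ, finSuccEquiv_X_zero, add_comm]
    simp only [this, one_pow, Finset.prod_const_one, mul_one]
  exact fun i ↦ pow_zero _

lemma isUnit_leadingCoeff_nagata (hf : f ≠ 0) :
    IsUnit (finSuccEquiv k n (nagata f f)).leadingCoeff := by
  have hlt : ∀ v ∈ f.support, ∀ i, v i < 2 + f.totalDegree := fun v hv i => by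
    have h1 : v i ≤ f.totalDegree := (monomial_le_degreeOf i hv).trans (degreeOf_le_totalDegree f i)
    lia
  obtain ⟨F, hsum, hnat, hlc⟩ : ∃ F : (Fin (n + 1) →₀ ℕ) → Polynomial (MvPolynomial (Fin n) k),
      finSuccEquiv k n (nagata f f) = ∑ v ∈ f.support, F v ∧
      (∀ v ∈ f.support, (F v).natDegree = ∑ i : Fin (n + 1), (2 + f.totalDegree) ^ i.1 * v i) ∧
      (∀ v ∈ f.support, (F v).leadingCoeff = C (coeff v f)) := by
    refine ⟨fun v => finSuccEquiv k n (nagata f (monomial v (coeff v f))), ?_, fun v hv =>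
      natDegree_nagata_monomial f v (mem_support_iff.mp hv), fun v _ =>
      leadingCoeff_nagata_monomial f v _⟩
    rw [← map_sum (finSuccEquiv k n), ← map_sum (nagata f), support_sum_monomial_coeff]
  obtain ⟨v, vin, vs⟩ := Finset.exists_max_image f.support (fun v ↦ (F v).natDegree)
    (support_nonempty.mpr hf)
  have hdeg : ∀ x ∈ f.support \ {v}, (F x).degree < (F v).degree := by
    intro x hx
    obtain ⟨h1, h2⟩ := Finset.mem_sdiff.mp hx
    apply Polynomial.degree_lt_degree <| lt_of_le_of_ne (vs x h1) ?_
    rw [hnat x h1, hnat v vin]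
    exact nagata_weight_ne f (hlt x h1) (hlt v vin) (by simpa using h2)
  have hFv : F v ≠ 0 := by
    rw [← Polynomial.leadingCoeff_ne_zero, hlc v vin]
    simpa using vin
  rw [hsum, Finset.sum_eq_add_sum_sdiff_singleton_of_mem vin, add_comm,
    Polynomial.leadingCoeff_add_of_degree_lt, hlc v vin]
  · exact (mem_support_iff.mp vin).isUnit.map MvPolynomial.C
  · refine lt_of_le_of_lt (Polynomial.degree_sum_le _ _) ?_
    exact (Finset.sup_lt_iff <| Ne.bot_lt (fun x ↦ hFv <| Polynomial.degree_eq_bot.mp x)).mpr hdeg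

end Nagata

section Height

open Ideal Polynomial RingTheory.Sequence

variable {A : Type} [CommRing A]

attribute [local instance] Polynomial.algebra Polynomial.isLocalization in
lemma height_le_height_add_one_of_monic [IsNoetherianRing A] (p : Ideal A) (P : Ideal A[X])
    [P.IsPrime] [P.LiesOver p] {g : A[X]} (hg : g.Monic) (hgP : g ∈ P) :
    P.height ≤ p.height + 1 := by
  have : p.IsPrime := by rw [P.over_def p]; infer_instance
  let Rₚ := Localization.AtPrime p
  set p' : Ideal Rₚ := p.map (algebraMap A Rₚ) with p'_def
  have : p'.IsMaximal := by
    rw [p'_def, Localization.AtPrime.map_eq_maximalIdeal]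
    exact IsLocalRing.maximalIdeal.isMaximal Rₚ
  let P' : Ideal Rₚ[X] := P.map (algebraMap A[X] Rₚ[X])
  have disj : Disjoint (p.primeCompl.map Polynomial.C : Set A[X]) P := by
    refine Set.disjoint_left.mpr fun a ⟨b, hb⟩ ha ↦ hb.1 ?_
    rwa [SetLike.mem_coe, LiesOver.over (P := P) (p := p), mem_comap, Polynomial.algebraMap_eq,
      hb.2]
  have hP' : P'.IsPrime := IsLocalization.isPrime_of_isPrime_disjoint
    (p.primeCompl.map Polynomial.C) Rₚ[X] P ‹_› disj
  have : P'.LiesOver p' := IsLocalization.liesOver_of_isPrime_of_disjoint p.primeCompl _ _ disj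
  have hgP' : g.map (algebraMap A Rₚ) ∈ P' := Ideal.mem_map_of_mem (algebraMap A[X] Rₚ[X]) hgP
  have hint := (hg.map (algebraMap A Rₚ)).quotient_isIntegral hgP'
  have : P'.IsMaximal := by
    have := isMaximal_of_isIntegral_of_isMaximal_comap' _ hint ⊥ (by
      have h1 : Ideal.comap ((Ideal.Quotient.mk P').comp Polynomial.C) ⊥ = p' := by
        rw [this.over]
        ext x
        simp [Ideal.Quotient.eq_zero_iff_mem]
      exact h1.symm ▸ ‹p'.IsMaximal›)
    rw [← Ideal.mk_ker (I := P'), RingHom.ker_eq_comap_bot]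
    exact Ideal.comap_isMaximal_of_surjective _ Ideal.Quotient.mk_surjective
  have eq1 : p.height = p'.height := by
    rw [IsLocalization.height_map_of_disjoint p.primeCompl]
    exact Disjoint.symm <| Set.disjoint_left.mpr fun _ a b ↦ b a
  have eq2 : P.height = P'.height := by
    rw [IsLocalization.height_map_of_disjoint (Submonoid.map Polynomial.C <| p.primeCompl) _ disj]
  rw [eq1, eq2, Polynomial.height_eq_height_add_one p' P']

lemma exists_prime_comap_C_of_monic {g : A[X]} (hg : g.Monic) {I : Ideal A[X]} (hgI : g ∈ I)
    (p : Ideal A) [p.IsPrime] (hle : I.comap Polynomial.C ≤ p) :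
    ∃ P : Ideal A[X], P.IsPrime ∧ I ≤ P ∧ P.comap Polynomial.C = p := by
  have : Algebra.IsIntegral A (A[X] ⧸ I) := ⟨hg.quotient_isIntegral hgI⟩
  obtain ⟨Q, -, hQ, hQp⟩ := Ideal.exists_ideal_over_prime_of_isIntegral p
    (⊥ : Ideal (A[X] ⧸ I)) (fun x hx => hle ((Ideal.Quotient.eq_zero_iff_mem (I := I)).1 hx))
  refine ⟨Q.comap (Ideal.Quotient.mk I), inferInstance, fun x hx => ?_, hQp⟩
  rw [Ideal.mem_comap, Ideal.Quotient.eq_zero_iff_mem.2 hx]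
  exact Q.zero_mem

lemma isWeaklyRegular_map_C_append {rs : List A} (h : IsWeaklyRegular A rs) {g : A[X]}
    (hg : g.Monic) : IsWeaklyRegular A[X] (rs.map Polynomial.C ++ [g]) := by
  rw [isWeaklyRegular_append_iff, isWeaklyRegular_singleton_iff]
  refine ⟨h.of_flat, ?_⟩
  rw [isSMulRegular_quotient_iff_mem_of_smul_mem]
  intro u hu
  have hmap : Ideal.ofList (rs.map Polynomial.C) • (⊤ : Submodule A[X] A[X])
      = (Ideal.ofList rs).map Polynomial.C := by
    rw [Ideal.map_ofList]; simp
  rw [hmap] at hu ⊢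
  rw [Ideal.mem_map_C_iff] at hu ⊢
  have key : ∀ v : A[X], (∀ n, v.coeff n ∈ Ideal.ofList rs) ↔
      v.map (Ideal.Quotient.mk (Ideal.ofList rs)) = 0 := by
    intro v
    simp [Polynomial.ext_iff, Ideal.Quotient.eq_zero_iff_mem]
  rw [key] at hu ⊢
  rw [smul_eq_mul, Polynomial.map_mul] at hu
  exact ((hg.map _).mul_right_eq_zero_iff).1 hu

lemma isWeaklyRegular_replicate_one (R : Type) [CommRing R] (h : ℕ) :
    IsWeaklyRegular R (List.replicate h (1 : R)) := by
  induction h with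
  | zero => exact .nil _ _
  | succ h ih =>
    rw [List.replicate_succ', isWeaklyRegular_append_iff, isWeaklyRegular_singleton_iff]
    exact ⟨ih, IsSMulRegular.one _⟩

lemma isWeaklyRegular_ringEquiv {R R' : Type} [CommRing R] [CommRing R'] (e : R ≃+* R')
    {rs : List R} (h : IsWeaklyRegular R rs) : IsWeaklyRegular R' (rs.map e) := by
  let _ := e.toRingHom.toAlgebra
  have : Module.Flat R R' := Module.Flat.of_linearEquiv
    ({ e.symm with
        map_smul' := fun a b => by
          change e.symm (e a * b) = a * e.symm b
          simp } : R' ≃ₗ[R] R)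
  exact h.of_flat

lemma height_ringEquiv_comap {R R' : Type} [CommRing R] [CommRing R'] (e : R ≃+* R')
    (P : Ideal R') : (P.comap e).height = P.height := by
  rw [← Ideal.map_symm e]
  exact e.symm.height_map P

/-- An ideal of height at least `h` in a polynomial ring over a field contains a weakly regular
sequence of length `h`. -/
lemma exists_isWeaklyRegular_of_height (k : Type) [Field k] (N : ℕ) :
    ∀ (h : ℕ) (I : Ideal (MvPolynomial (Fin N) k)),
      (∀ P : Ideal (MvPolynomial (Fin N) k), P.IsPrime → I ≤ P → (h : ℕ∞) ≤ P.height) →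
      ∃ rs : List (MvPolynomial (Fin N) k), rs.length = h ∧ (∀ r ∈ rs, r ∈ I) ∧
        IsWeaklyRegular (MvPolynomial (Fin N) k) rs := by
  induction N with
  | zero =>
    intro h I hI
    by_cases hI' : I = ⊤
    · exact ⟨List.replicate h 1, by simp, by simp [hI'], isWeaklyRegular_replicate_one _ h⟩
    · obtain ⟨P, hP, hIP⟩ := Ideal.exists_le_maximal I hI'
      have hf : IsField (MvPolynomial (Fin 0) k) :=
        (MvPolynomial.isEmptyRingEquiv k (Fin 0)).toMulEquiv.isField (Field.toIsField k)
      let _ := hf.toField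
      have h0 := hI P hP.isPrime hIP
      have : P = ⊥ := (Ideal.eq_bot_or_top P).resolve_right hP.ne_top
      rw [this] at h0
      have hh : h = 0 := by simpa using h0
      exact ⟨[], by simp [hh], by simp, .nil _ _⟩
  | succ N ih =>
    intro h I hI
    rcases h with _ | h
    · exact ⟨[], rfl, by simp, .nil _ _⟩
    by_cases hI0 : I = ⊥
    · have := hI ⊥ Ideal.isPrime_bot hI0.le
      simp at this
    obtain ⟨f, hfI, hf⟩ := Submodule.exists_mem_ne_zero_of_ne_bot hI0
    let e : MvPolynomial (Fin (N + 1)) k ≃+* (MvPolynomial (Fin N) k)[X] :=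
      ((nagata f).trans (finSuccEquiv k N)).toRingEquiv
    let I' := I.comap e.symm
    have hu := isUnit_leadingCoeff_nagata f hf
    let g := hu.unit⁻¹ • e f
    have hg : g.Monic := Polynomial.monic_of_isUnit_leadingCoeff_inv_smul hu
    have hgI : g ∈ I' := Submodule.smul_of_tower_mem I' hu.unit⁻¹.val
      (show e.symm (e f) ∈ I by simpa using hfI)
    obtain ⟨rs, hlen, hrs, hreg⟩ := ih h (I'.comap Polynomial.C) (by
      intro p hp hle
      obtain ⟨P, hP, hI'P, hPp⟩ := exists_prime_comap_C_of_monic hg hgI p hle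
      have : P.LiesOver p := ⟨hPp.symm⟩
      have h1 := height_le_height_add_one_of_monic p P hg (hI'P hgI)
      have h2 := hI (P.comap e) inferInstance (fun x hx => hI'P (by
        change e.symm (e x) ∈ I
        simpa using hx))
      rw [height_ringEquiv_comap] at h2
      have h3 := h2.trans h1
      push_cast at h3
      exact (ENat.add_le_add_iff_right (by simp)).1 h3)
    refine ⟨(rs.map Polynomial.C ++ [g]).map e.symm, by simp [hlen], ?_,
      isWeaklyRegular_ringEquiv e.symm (isWeaklyRegular_map_C_append hreg hg)⟩
    intro r hr
    obtain ⟨s, hs, rfl⟩ := List.mem_map.1 hr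
    change s ∈ I'
    rcases List.mem_append.1 hs with hs | hs
    · obtain ⟨t, ht, rfl⟩ := List.mem_map.1 hs
      exact hrs t ht
    · rw [List.mem_singleton.1 hs]; exact hgI

end Height

open RingTheory.Sequence in
lemma exists_isWeaklyRegular_of_idealHeight {k : Type} [Field k] {n p : ℕ} (h : ℕ)
    (I : Ideal (PolyS k n p)) (hI : (h : ℕ∞) ≤ idealHeight I) :
    ∃ rs : List (PolyS k n p), rs.length = h ∧ (∀ r ∈ rs, r ∈ I) ∧
      IsWeaklyRegular (PolyS k n p) rs := by
  let e : PolyS k n p ≃+* MvPolynomial (Fin (n + p)) k :=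
    (renameEquiv k (finSumFinEquiv (m := n) (n := p))).toRingEquiv
  obtain ⟨rs, hlen, hrs, hreg⟩ := exists_isWeaklyRegular_of_height k (n + p) h (I.comap e.symm) (by
    intro P hP hIP
    have h1 : I ≤ P.comap e := fun x hx => hIP (show e.symm (e x) ∈ I by simpa using hx)
    have h2 := hI.trans (iInf₂_le (⟨P.comap e, inferInstance⟩ : PrimeSpectrum _) h1)
    rw [← height_ringEquiv_comap e P]
    exact h2.trans_eq (PrimeSpectrum.height_eq_orderHeight _).symm)
  refine ⟨rs.map e.symm, by simp [hlen], ?_, isWeaklyRegular_ringEquiv e.symm hreg⟩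
  intro r hr
  obtain ⟨s, hs, rfl⟩ := List.mem_map.1 hr
  exact hrs s hs

section KoszulHomology

variable {k : Type} [Field k] {n m p : ℕ} {z : Fin m → PolyS k n p}
  {hz : ∀ j, z j ∈ piece k n p (1, 1)}

open RingTheory.Sequence

lemma koszul_torsion (l : Fin n) {rs : List (PolyS k n p)} (hlen : rs.length = m)
    (hrs : ∀ r ∈ rs, X (Sum.inl l) * r ∈ Ideal.span (Set.range z))
    (hreg : IsWeaklyRegular (PolyS k n p) rs) {i : ℕ} (hi : 1 ≤ i)
    (h : (koszulComplex z hz).X i) (hc : (koszulComplex z hz).IsCycle i h) :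
    ∃ w, (koszulComplex z hz).d i w = (X (Sum.inl l) : PolyS k n p) ^ m • h := by
  obtain ⟨i, rfl⟩ := Nat.exists_eq_add_of_le' hi
  have h0 : koszulD z h.1 = 0 := congrArg Subtype.val (show (koszulComplex z hz).d i h = 0 from hc)
  obtain ⟨u, hu⟩ := koszul_depth z (X (Sum.inl l)) rs hrs (PolyS k n p) hreg (i + 1)
    (by omega) h.1 h.2 h0
  refine ⟨⟨cardProj ((i + 1 + 1 : ℕ) : ℤ) u, cardProj_mem _ _⟩, Subtype.ext ?_⟩
  change koszulD z (cardProj ((i + 1 + 1 : ℕ) : ℤ) u) = (X (Sum.inl l) : PolyS k n p) ^ m • h.1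
  have := koszulD_cardProj z ((i + 1 : ℕ) : ℤ) u
  push_cast at this ⊢
  rw [this, hu, hlen]
  refine cardProj_of_mem (R := PolyS k n p) ?_
  have h2 := h.2
  push_cast at h2
  exact Submodule.smul_mem _ _ h2

/-- A form of large `x`-degree lies in the ideal of given powers of the `x`-variables. -/
lemma mem_ofList_X_pow (e : Fin n → ℕ) {d : ℤ × ℤ} {u : PolyS k n p} (hu : u ∈ piece k n p d)
    (hd : (((List.finRange n).map fun l => (e l : ℤ)).sum) < d.1 + n) :
    u ∈ Ideal.ofList ((List.finRange n).map fun l => (X (Sum.inl l) : PolyS k n p) ^ e l) := by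
  have h1 : Ideal.ofList ((List.finRange n).map fun l => (X (Sum.inl l) : PolyS k n p) ^ e l) =
      Ideal.span ((fun j => (X (Sum.inl j) : PolyS k n p) ^ e j) '' Set.univ) := by
    rw [Ideal.ofList]; congr 1; ext r; simp
  rw [h1, mem_span_X_pow]
  intro a ha
  by_contra! hcon
  have hw : Finsupp.weight (bideg n p) a = d := hu (mem_support_iff.1 ha)
  rw [weight_bideg] at hw
  rw [← hw, ← List.ofFn_eq_map, List.sum_ofFn] at hd
  have h2 : ∑ i : Fin n, ((a (Sum.inl i) : ℤ) + 1) ≤ ∑ i : Fin n, (e i : ℤ) :=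
    Finset.sum_le_sum fun i _ => by have := hcon i (Set.mem_univ i); omega
  rw [Finset.sum_add_distrib] at h2
  simp at h2 hd
  omega

lemma koszul_mem_smul_top {I : Ideal (PolyS k n p)} {i : ℕ} (u : (koszulComplex z hz).X i)
    (h : ∀ T, u.1 T ∈ I) :
    u ∈ (I • ⊤ : Submodule (PolyS k n p) ((koszulComplex z hz).X i)) := by
  have hu : u = ∑ T : Finset (Fin m), u.1 T •
      (⟨cardProj i (Pi.single T 1), cardProj_mem _ _⟩ :
        cardPart (PolyS k n p) m (PolyS k n p) i) := by
    apply Subtype.ext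
    ext1 T
    rw [AddSubmonoidClass.coe_finsetSum, Finset.sum_apply]
    simp only [SetLike.val_smul, Pi.smul_apply, cardProj, smul_eq_mul]
    by_cases hT : (T.card : ℤ) = i
    · simp [hT, Pi.single_apply]
    · simp [hT, u.2 T hT]
  rw [hu]
  exact Submodule.sum_mem _ fun T _ => Submodule.smul_mem_smul (h T) trivial

variable (hrs : ∃ rs : List (PolyS k n p), rs.length = m ∧
  (∀ r ∈ rs, ∀ l, X (Sum.inl l) * r ∈ Ideal.span (Set.range z)) ∧
  IsWeaklyRegular (PolyS k n p) rs)

include hrs in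
/-- The Koszul homology of `z` in positive degree `i` is concentrated in `x`-degree `i`. -/
lemma koszul_exact_of_ne {i : ℕ} (hi : 1 ≤ i) {d : ℤ × ℤ} (hd : d.1 ≠ i)
    {h : (koszulComplex z hz).X i} (hh : h ∈ ((koszulComplex z hz).gr i).H d)
    (hc : (koszulComplex z hz).IsCycle i h) : ∃ w, (koszulComplex z hz).d i w = h := by
  obtain ⟨rs, hlen, hmul, hreg⟩ := hrs
  rcases lt_or_gt_of_ne hd with hd | hd
  · refine ⟨0, ?_⟩
    rw [map_zero]
    symm
    apply Subtype.ext
    ext1 T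
    exact piece_eq_zero_of_neg (mem_koszulComplex_gr.1 hh T) (Or.inl (by simp; omega))
  · refine rigidity (b := d.2) (List.finRange n) (List.nodup_finRange n) (koszulComplex z hz) i d.1
      (fun e j => ?_) (fun l _ j hj a g hg hgc => ?_) (fun e u hu => ?_) h hh hc
    · rw [← List.ofFn_eq_map]
      exact isWeaklyRegular_of_flat (isWeaklyRegular_X_pow _ Sum.inl_injective e)
    · exact ⟨m, koszul_torsion l hlen (fun r hr => hmul r hr l) hreg (hi.trans hj) g hgc⟩
    · refine koszul_mem_smul_top u fun T => mem_ofList_X_pow e (mem_koszulComplex_gr.1 hu T) ?_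
      simp
      omega

section Vanishing

variable {N : ℕ} {M : Type} [AddCommGroup M] [Module (PolyS k n p) M] {G : Bigrading k n p M}
  {ν : Fin N → Fin n ⊕ Fin p}

lemma sum_bideg_inl (I : Finset (Fin n)) :
    ∑ j ∈ I, bideg n p (Sum.inl j) = ((I.card : ℤ), 0) := by
  simp [bideg]

lemma kpart_eq_zero {d : ℤ × ℤ} {s : ℤ} (h : ∀ I : Finset (Fin N), (I.card : ℤ) = s →
    ∀ u ∈ G.H (d - ∑ j ∈ I, bideg n p (ν j)), u = 0) {c : Finset (Fin N) → M}
    (hc : c ∈ G.kpart ν d s) : c = 0 := by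
  ext1 I
  by_cases hI : (I.card : ℤ) = s
  · exact h I hI _ ((mem_kpart.1 hc).2 I)
  · exact hc.1 I hI

lemma kpart_eq_zero_of_lt {d : ℤ × ℤ} {s : ℤ} (h : (N : ℤ) < s) {c : Finset (Fin N) → M}
    (hc : c ∈ G.kpart ν d s) : c = 0 := by
  ext1 I
  refine hc.1 I ?_
  have := Finset.card_le_univ I
  rw [Fintype.card_fin] at this
  omega

lemma stair_of_kpart_eq_zero {Y : BGComplex k n p} {g : PolyS k n p} {e : ℤ × ℤ} {D : Set (ℤ × ℤ)}
    {s : ℤ} {i : ℕ} (h : ∀ d ∈ D, ∀ c ∈ (Y.gr i).kpart ν d s, c = 0) :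
    Stair Y ν g e D s i := fun d hd c hc _ _ =>
  ⟨0, 0, zero_mem _, 0, zero_mem _, by rw [h d hd c hc]; simp⟩

/-- The horizontal boundary of `c` is a vertical boundary as soon as it is a vertical cycle and the
relevant degrees are exact. -/
lemma condX_of_exact {Y : BGComplex k n p} {d : ℤ × ℤ} {s : ℤ} {i : ℕ}
    {c : Finset (Fin N) → Y.X (i + 1)} (hc : c ∈ (Y.gr (i + 1)).kpart ν d s)
    (hkd : varD k ν (Y.kd N i c) = 0)
    (hex : ∀ I : Finset (Fin N), (I.card : ℤ) = s - 1 →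
      ∀ u ∈ (Y.gr (i + 1)).H (d - ∑ j ∈ I, bideg n p (ν j)), Y.d i u = 0 →
        ∃ w, Y.d (i + 1) w = u) : CondX Y ν d s (i + 1) c := by
  have hv : varD k ν c ∈ (Y.gr (i + 1)).kpart ν d (s - 1) := varD_mem (by rwa [sub_add_cancel])
  obtain ⟨e, he, hee⟩ := kmap_lift (G := Y.gr (i + 2)) (Y.d (i + 1)) hv (fun I hI => by
    have h1 := (mem_kpart.1 hv).2 I
    obtain ⟨w, hw⟩ := hex I hI _ h1 (by
      rw [varD_kd] at hkd
      exact congrFun hkd I)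
    exact (Y.d_graded (i + 1)).lift h1 hw)
  exact ⟨e, he, hee.symm⟩

end Vanishing

lemma koszul_H_eq_zero {i : ℕ} {d : ℤ × ℤ} {u : (koszulComplex z hz).X i}
    (hu : u ∈ ((koszulComplex z hz).gr i).H d) (hd : d.1 < i ∨ d.2 < i) : u = 0 := by
  apply Subtype.ext
  ext1 T
  exact piece_eq_zero_of_neg (mem_koszulComplex_gr.1 hu T) (by simp; omega)

lemma isWeaklyRegular_X {N : ℕ} (ν : Fin N → Fin n ⊕ Fin p) (hν : Function.Injective ν)
    {M : Type} [AddCommGroup M] [Module (PolyS k n p) M] [Module.Flat (PolyS k n p) M] :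
    IsWeaklyRegular M (List.ofFn fun j => (X (ν j) : PolyS k n p)) := by
  have := isWeaklyRegular_of_flat (M := M) (isWeaklyRegular_X_pow (k := k) ν hν fun _ => 1)
  simpa using this

lemma koszul_zero_add {d : ℤ × ℤ} {D : Set (ℤ × ℤ)} (h : D = {d}) :
    ∀ d ∈ D, ∀ Q : ℕ, d + Q • (0 : ℤ × ℤ) ∈ D := by
  subst h; simp

lemma one_mem_piece : (1 : PolyS k n p) ∈ piece k n p 0 := isWeightedHomogeneous_one k _

include hrs in
/-- In positive degree `i`, there are no nonzero cycles of `x`-degree `i` and small `y`-degree. -/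
lemma koszul_cycle_eq_zero {i : ℕ} (hi : 1 ≤ i) {b : ℤ} (hb : b < n + i)
    {u : (koszulComplex z hz).X i} (hu : u ∈ ((koszulComplex z hz).gr i).H ((i : ℤ), b))
    (hc : (koszulComplex z hz).IsCycle i u) : u = 0 := by
  obtain ⟨i, rfl⟩ := Nat.exists_eq_add_of_le' hi
  set d : ℤ × ℤ := ((n + i + 1 : ℤ), b) with hd
  have hD : ∀ d' ∈ ({d} : Set (ℤ × ℤ)), ∀ Q : ℕ, d' + Q • (0 : ℤ × ℤ) ∈ ({d} : Set (ℤ × ℤ)) :=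
    koszul_zero_add rfl
  have h0 : Stair (koszulComplex z hz) Sum.inl 1 0 {d} (0 : ℕ) (n + (i + 1)) := by
    refine stair_of_kpart_eq_zero fun d' hd' c hc => ?_
    rw [Set.mem_singleton_iff] at hd'
    subst hd'
    refine kpart_eq_zero (fun I hI v hv => koszul_H_eq_zero hv (Or.inr ?_)) hc
    rw [sum_bideg_inl]
    simp [hd] at hb ⊢; omega
  have hst := stair_up_to  (ν := Sum.inl) (D := {d}) one_mem_piece hD
    (fun j => isWeaklyRegular_X _ Sum.inl_injective) (q := n + (i + 1))
    (fun s i' hs => vertExact_of_coeff (Q := 0) one_mem_piece ?_) h0 n (i + 1) rfl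
  swap
  · intro d' hd' I hI v hv hv0
    rw [Set.mem_singleton_iff] at hd'
    subst hd'
    rw [sum_bideg_inl] at hv
    obtain ⟨w, hw⟩ := koszul_exact_of_ne (hz := hz) hrs (i := i' + 1) (by omega) (by
      simp [hd, hI]; omega) hv hv0
    exact ⟨w, by rw [pow_zero, one_smul]; exact hw⟩
  set c : Finset (Fin n) → (koszulComplex z hz).X (i + 1) := fun I =>
    if I = Finset.univ then u else 0 with hcdef
  have hck : c ∈ ((koszulComplex z hz).gr (i + 1)).kpart Sum.inl d n := by
    rw [mem_kpart]
    refine ⟨fun I hI => ?_, fun I => ?_⟩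
    · simp only [hcdef]
      rw [if_neg]
      rintro rfl
      simp at hI
    · simp only [hcdef]
      split_ifs with hI
      · rw [hI, sum_bideg_inl]
        convert hu using 2
        simp [hd]; ring
      · exact zero_mem _
  have hkd : (koszulComplex z hz).kd n i c = 0 := by
    ext1 I
    change (koszulComplex z hz).d i (c I) = 0
    simp only [hcdef]
    split_ifs
    · exact hc
    · exact map_zero _
  have hcx : CondX (koszulComplex z hz) Sum.inl d n (i + 1) c := by
    refine condX_of_exact hck (by rw [hkd, map_zero]) fun I hI v hv hv0 =>
      koszul_exact_of_ne (hz := hz) hrs (i := i + 1) (by omega) ?_ hv hv0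
    rw [sum_bideg_inl, hI]; simp [hd]; omega
  obtain ⟨Q, w, hw, w', hw', heq⟩ := hst d rfl c hck hcx ⟨0, zero_mem _, by rw [hkd, map_zero]⟩
  rw [kpart_eq_zero_of_lt (by omega) hw, smul_zero, add_zero] at *
  rw [kpart_eq_zero (fun I hI v hv => koszul_H_eq_zero hv (Or.inl ?_)) hw', map_zero, map_zero,
    one_pow, one_smul, zero_add] at heq
  · have := congrFun heq Finset.univ
    simpa [hcdef] using this
  · rw [sum_bideg_inl]; simp [hd, hI]; omega

include hrs in
/-- The Koszul homology of `z` in positive degree `i` vanishes outside of `x`-degree `i` and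
`y`-degree at least `n + i`. -/
lemma koszul_exact {i : ℕ} (hi : 1 ≤ i) {d : ℤ × ℤ} (hd : d.1 ≠ i ∨ d.2 < n + i)
    {h : (koszulComplex z hz).X i} (hh : h ∈ ((koszulComplex z hz).gr i).H d)
    (hc : (koszulComplex z hz).IsCycle i h) : ∃ w, (koszulComplex z hz).d i w = h := by
  by_cases h1 : d.1 = i
  · obtain ⟨a, b⟩ := d
    obtain rfl : a = i := h1
    exact ⟨0, by rw [map_zero, koszul_cycle_eq_zero hrs hi (by simpa using hd) hh hc]⟩
  · exact koszul_exact_of_ne hrs hi h1 hh hc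

end KoszulHomology

section Minors

variable {R : Type} [CommRing R] {n m : ℕ}

open exteriorPower in
/-- The value of an alternating map on the rows of a matrix lies in the ideal of maximal minors. -/
lemma AlternatingMap.mem_minorsIdeal (f : (Fin m → R) [⋀^Fin n]→ₗ[R] R)
    (φ : Fin n → Fin m → R) : f φ ∈ minorsIdeal n (Matrix.of φ) := by
  have h1 : f φ = alternatingMapLinearEquiv f (ιMulti R n φ) := by simp
  rw [h1, ← ((Pi.basisFun R (Fin m)).exteriorPower n).sum_repr (ιMulti R n φ), map_sum]
  refine Ideal.sum_mem _ fun s _ => ?_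
  rw [map_smul, smul_eq_mul]
  refine Ideal.mul_mem_right _ _ (Ideal.subset_span ⟨Function.Embedding.refl _,
    (Set.powersetCard.ofFinEmbEquiv.symm s).toEmbedding, ?_⟩)
  rw [basis_repr_apply, ιMultiDual_apply_ιMulti]
  rfl

variable (R m) in
/-- The Koszul differential as a linear function of the sequence. -/
def koszulLin : (Fin m → R) →ₗ[R] Module.End R (Finset (Fin m) → R) where
  toFun c := koszulD c
  map_add' c d := by simp only [koszulD, Pi.add_apply, add_smul, Finset.sum_add_distrib]
  map_smul' a c := by
    simp only [koszulD, Pi.smul_apply, smul_eq_mul, mul_smul, Finset.smul_sum, RingHom.id_apply]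

lemma koszulD_prod_mem_minorsIdeal (φ : Fin n → Fin m → R) (v : Finset (Fin m) → R)
    (T : Finset (Fin m)) :
    ((List.finRange n).map fun j => koszulLin R m (φ j)).prod v T ∈
      minorsIdeal n (Matrix.of φ) := by
  let A : ExteriorAlgebra R (Fin m → R) →ₐ[R] Module.End R (Finset (Fin m) → R) :=
    ExteriorAlgebra.lift R ⟨koszulLin R m, fun c => LinearMap.ext fun u => koszulD_koszulD c u⟩
  let ev : Module.End R (Finset (Fin m) → R) →ₗ[R] R :=
    (LinearMap.proj T).comp (LinearMap.applyₗ v)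
  convert AlternatingMap.mem_minorsIdeal
    ((ev.comp A.toLinearMap).compAlternatingMap (ExteriorAlgebra.ιMulti R n)) φ using 1
  simp only [LinearMap.compAlternatingMap_apply, ExteriorAlgebra.ιMulti_apply,
    LinearMap.coe_comp, Function.comp_apply, AlgHom.toLinearMap_apply, map_list_prod,
    List.map_ofFn]
  rw [← List.ofFn_eq_map]
  have : (A ∘ fun i => ExteriorAlgebra.ι R (φ i)) = fun j => koszulLin R m (φ j) :=
    funext fun i => ExteriorAlgebra.lift_ι_apply _ _ _ _
  rw [this]
  rfl

end Minors
section DegreeZero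

variable {k : Type} [Field k] {n m p : ℕ} {φ : Matrix (Fin n) (Fin m) (PolyS k n p)}

open RingTheory.Sequence

lemma koszulD_zseq (u : Finset (Fin m) → PolyS k n p) :
    koszulD (zseq k n m p φ) u = ∑ i, (X (Sum.inl i) : PolyS k n p) • koszulD (φ i) u := by
  have h : zseq k n m p φ = ∑ i, (X (Sum.inl i) : PolyS k n p) • (φ i : Fin m → PolyS k n p) := by
    ext1 j
    rw [Finset.sum_apply]
    rfl
  change koszulLin _ m (zseq k n m p φ) u = _
  rw [h, map_sum, LinearMap.sum_apply]
  simp only [map_smul]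
  rfl

/-- The `x`-variables are linearly independent over the polynomials in the `y`-variables. -/
lemma eq_zero_of_sum_X_inl_mul {C : Fin n → PolyS k n p} {d : ℤ × ℤ} (hd : d.1 = 0)
    (hC : ∀ j, C j ∈ piece k n p d) (h : ∑ j, X (Sum.inl j) * C j = 0) (j : Fin n) : C j = 0 := by
  ext a
  rw [coeff_zero]
  by_contra ha
  have hw : Finsupp.weight (bideg n p) a = d := hC j ha
  rw [weight_bideg] at hw
  rw [← hw] at hd
  have h0 : ∀ i, a (Sum.inl i) = 0 := fun i => by
    have := (Finset.sum_eq_zero_iff_of_nonneg (fun i _ => by positivity)).1 hd i (Finset.mem_univ i)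
    exact_mod_cast this
  have hc := congrArg (coeff (a + Finsupp.single (Sum.inl j) 1)) h
  rw [coeff_sum, coeff_zero, Finset.sum_eq_single j] at hc
  · rw [mul_comm, coeff_mul_X] at hc
    exact ha hc
  · intro i _ hij
    rw [coeff_X_mul', if_neg]
    simp [h0, Ne.symm hij]
  · simp

variable (hφ : ∀ i j, φ i j ∈ piece k n p (0, 1))
  (hrs : ∃ rs : List (PolyS k n p), rs.length = m ∧
    (∀ r ∈ rs, ∀ l, X (Sum.inl l) * r ∈ Ideal.span (Set.range (zseq k n m p φ))) ∧
    IsWeaklyRegular (PolyS k n p) rs)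

include hrs in
lemma exists_koszulD_prod (b : ℤ) (s : ℕ) : ∀ (i : ℕ), s + i = n →
    ∀ c ∈ ((koszulComplex _ (zseq_mem hφ)).gr i).kpart (Sum.inl : Fin n → _) (n, b) s,
    CondX (koszulComplex _ (zseq_mem hφ)) Sum.inl (n, b) s i c → ∀ l : List (Fin n), l.Nodup →
    l.length = s → ∃ ε : ℤ, ∃ v ∈ cardPart (PolyS k n p) m (PolyS k n p) n,
      (c l.toFinset).1 = ε • (l.map fun j => koszulLin (PolyS k n p) m (φ j)).prod v := by
  induction s with
  | zero =>
    intro i hi c hc _ l _ hl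
    obtain rfl : i = n := by omega
    rw [List.length_eq_zero_iff] at hl
    subst hl
    exact ⟨1, (c ∅).1, (c ∅).2, by simp⟩
  | succ s ih =>
    intro i hi c hc hcx l hnd hl
    cases l with
    | nil => simp at hl
    | cons j l =>
      rw [List.nodup_cons] at hnd
      rw [List.length_cons, add_left_inj] at hl
      obtain ⟨e, he, hce⟩ := hcx
      push_cast at he
      rw [add_sub_cancel_right] at he
      have hex : CondX (koszulComplex _ (zseq_mem hφ)) Sum.inl (n, b) s (i + 1) e := by
        refine condX_of_exact he (by rw [← hce, varD_varD]) fun I hI v hv hv0 =>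
          koszul_exact_of_ne (hz := zseq_mem hφ) hrs (i := i + 1) (by omega) ?_ hv hv0
        rw [sum_bideg_inl, hI]; simp; omega
      obtain ⟨ε, v, hv, hεv⟩ := ih (i + 1) (by omega) e he hex l hnd.2 hl
      have hcard : (l.toFinset.card : ℤ) = s := by
        rw [List.toFinset_card_of_nodup hnd.2, hl]
      have hj : j ∉ l.toFinset := by simpa using hnd.1
      have key : ∀ T, koszulSign j l.toFinset • (c (insert j l.toFinset)).1 T =
          koszulD (φ j) (e l.toFinset).1 T := by
        intro T
        by_cases hT : (T.card : ℤ) = i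
        swap
        · rw [(c _).2 T hT, smul_zero]
          refine (koszulD_mem_cardPart (s := (i : ℤ)) (φ j) ?_ T hT).symm
          have := (e l.toFinset).2
          push_cast at this
          exact this
        have hC := eq_zero_of_sum_X_inl_mul (d := (0, b - i)) rfl
          (C := fun j => (contr (PolyS k n p) j c l.toFinset).1 T -
            koszulD (φ j) (e l.toFinset).1 T) (fun j => ?_) ?_ j
        · rw [contr_apply, if_neg hj] at hC
          exact sub_eq_zero.1 hC
        · refine Submodule.sub_mem _ ?_ ?_
          · rw [contr_apply]
            split_ifs with hjl
            · exact zero_mem _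
            · have h1 := mem_koszulComplex_gr.1 ((mem_kpart.1 hc).2 (insert j l.toFinset)) T
              rw [sum_bideg_inl, Finset.card_insert_of_notMem hjl] at h1
              refine zsmul_mem (S := Submodule k (PolyS k n p)) (K := piece k n p (0, b - i)) ?_ _
              convert h1 using 2
              simp [hcard]
              omega
          · rw [koszulD_apply]
            refine Submodule.sum_mem _ fun t _ => ?_
            split_ifs with ht
            · rw [smul_zero]; exact zero_mem _
            · have h1 := mem_koszulComplex_gr.1 ((mem_kpart.1 he).2 l.toFinset) (insert t T)
              rw [sum_bideg_inl] at h1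
              rw [smul_comm]
              refine zsmul_mem (S := Submodule k (PolyS k n p)) (K := piece k n p (0, b - i)) ?_ _
              rw [smul_eq_mul]
              have h2 := IsWeightedHomogeneous.mul (hφ j t) h1
              refine (mem_weightedHomogeneousSubmodule _ _ _ _).2 ?_
              convert h2 using 1
              simp [hcard]
              omega
        · have h1 := congrArg (fun w => (w l.toFinset).1 T) hce
          have h2 : ((koszulComplex _ (zseq_mem hφ)).kd n i e l.toFinset).1 T =
              ∑ j, X (Sum.inl j) * koszulD (φ j) (e l.toFinset).1 T := by
            change koszulD (zseq k n m p φ) (e l.toFinset).1 T = _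
            rw [koszulD_zseq, Finset.sum_apply]
            rfl
          have h3 : (varD k (Sum.inl : Fin n → Fin n ⊕ Fin p) c l.toFinset).1 T =
              ∑ j, X (Sum.inl j) * (contr (PolyS k n p) j c l.toFinset).1 T := by
            rw [varD, koszulD_eq_sum, Finset.sum_apply]
            exact (congrFun (AddSubmonoidClass.coe_finsetSum _ _) T).trans (Finset.sum_apply _ _ _)
          simp only [mul_sub, Finset.sum_sub_distrib]
          rw [← h2, ← h3]
          exact sub_eq_zero.2 h1
      refine ⟨koszulSign j l.toFinset * ε, v, hv, ?_⟩
      rw [List.toFinset_cons, List.map_cons, List.prod_cons, mul_smul, Module.End.mul_apply,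
        ← map_zsmul, ← hεv]
      ext1 T
      change _ = koszulSign j l.toFinset • koszulD (φ j) (e l.toFinset).1 T
      rw [← key, smul_smul, koszulSign_mul_self, one_smul]

include hφ hrs in
/-- A form in the `y`-variables which is multiplied into `(z)` by all `x`-variables lies in the
ideal of maximal minors. -/
lemma mem_minorsIdeal_of_X_mul_mem {r : PolyS k n p} {b : ℤ} (hr : r ∈ piece k n p (0, b))
    (h : ∀ j, X (Sum.inl j) * r ∈ Ideal.span (Set.range (zseq k n m p φ))) :
    r ∈ minorsIdeal n φ := by
  obtain ⟨w', hw'⟩ := koszulZero_surjective (hz := zseq_mem hφ) r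
  obtain ⟨w, hw, hwr⟩ := koszulZero_graded.lift (mem_polyBigrading.2 hr) hw'
  set c : Finset (Fin n) → (koszulComplex _ (zseq_mem hφ)).X 0 :=
    fun I => if I = Finset.univ then w else 0 with hcdef
  have hck : c ∈ ((koszulComplex _ (zseq_mem hφ)).gr 0).kpart (Sum.inl : Fin n → _) (n, b) n := by
    rw [mem_kpart]
    refine ⟨fun I hI => ?_, fun I => ?_⟩
    · simp only [hcdef]
      rw [if_neg]
      rintro rfl
      simp at hI
    · simp only [hcdef]
      split_ifs with hI
      · rw [hI, sum_bideg_inl]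
        convert hw using 2
        simp
      · exact zero_mem _
  have hval : ∀ I, koszulZeroEquiv (zseq_mem hφ) (c I) = if I = Finset.univ then r else 0 := by
    intro I
    simp only [hcdef]
    split_ifs
    · exact hwr
    · exact map_zero _
  have hcx : CondX (koszulComplex _ (zseq_mem hφ)) Sum.inl (n, b) n 0 c := by
    have hv : varD k Sum.inl c ∈ ((koszulComplex _ (zseq_mem hφ)).gr 0).kpart
      (Sum.inl : Fin n → _) (n, b) (n - 1) := varD_mem (by rwa [sub_add_cancel])
    obtain ⟨e, he, hee⟩ := kmap_lift (G := (koszulComplex _ (zseq_mem hφ)).gr 1)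
      ((koszulComplex _ (zseq_mem hφ)).d 0) hv (fun I hI => by
        have h1 := (mem_kpart.1 hv).2 I
        have h2 : koszulZeroEquiv (zseq_mem hφ) (varD k (Sum.inl : Fin n → Fin n ⊕ Fin p) c I) ∈
            Ideal.span (Set.range (zseq k n m p φ)) := by
          have h3 := congrFun (varD_kmap (ν := (Sum.inl : Fin n → Fin n ⊕ Fin p))
            (koszulZeroEquiv (zseq_mem hφ)) c) I
          refine (Eq.subst h3 ?_ : _)
          rw [varD, koszulD_apply]
          refine Ideal.sum_mem _ fun j _ => ?_
          split_ifs
          · simp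
          · rw [smul_comm]
            refine zsmul_mem ?_ _
            rw [LinearMap.compLeft_apply, Function.comp_apply, hval, smul_eq_mul]
            split_ifs
            · exact h j
            · simp
        obtain ⟨u, hu⟩ := exists_koszulZero_d (hz := zseq_mem hφ) h2
        exact ((koszulComplex _ (zseq_mem hφ)).d_graded 0).lift h1 (koszulZero_ext hu))
    exact ⟨e, he, hee.symm⟩
  obtain ⟨ε, v, hv, hεv⟩ := exists_koszulD_prod hφ hrs b n 0 (by omega) c hck hcx
    (List.finRange n) (List.nodup_finRange n) (List.length_finRange)
  have h1 := hval Finset.univ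
  rw [if_pos rfl] at h1
  have h2 : r = ε • (((List.finRange n).map
      fun j => koszulLin (PolyS k n p) m (φ j)).prod v ∅) := by
    rw [← h1]
    have : (List.finRange n).toFinset = Finset.univ := by ext; simp
    rw [this] at hεv
    exact congrFun hεv ∅
  rw [h2]
  exact zsmul_mem (koszulD_prod_mem_minorsIdeal φ v ∅) ε

end DegreeZero

section MinimalResolution

variable {k : Type} [Field k] {n m p : ℕ} {φ : Matrix (Fin n) (Fin m) (PolyS k n p)}

open RingTheory.Sequence

/-- A minimal bigraded free resolution of `S/J`. -/
structure MinRes (hφ : ∀ i j, φ i j ∈ piece k n p (0, 1)) (β : ℕ → ℤ × ℤ → ℕ) where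
  f : ∀ i : ℕ, FMod k n p β (i + 1) →ₗ[PolyS k n p] FMod k n p β i
  π : FMod k n p β 0 →ₗ[PolyS k n p] (PolyS k n p ⧸ resJ k n m p φ)
  surj : Function.Surjective π
  exact_zero : Function.Exact (f 0) π
  exact : ∀ i, Function.Exact (f (i + 1)) (f i)
  graded : ∀ i d v, inPiece k n p β (i + 1) d v → inPiece k n p β i d (f i v)
  π_graded : IsGraded (freeBigrading fun q => q.1.1) (resQuot hφ) π
  minimal : ∀ i, LinearMap.range (f i) ≤
    (varIdeal k n p) • (⊤ : Submodule (PolyS k n p) (FMod k n p β i))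

lemma IsMinBigradedFreeRes.nonempty_minRes (hφ : ∀ i j, φ i j ∈ piece k n p (0, 1))
    {β : ℕ → ℤ × ℤ → ℕ} (h : IsMinBigradedFreeRes k n p (resJ k n m p φ) β) :
    Nonempty (MinRes hφ β) := by
  obtain ⟨f, π, h1, h2, h3, h4, h5, h6⟩ := h
  refine ⟨⟨f, π, h1, h2, h3, h4, isGraded_of_mem π fun d v hv => ?_, h6⟩⟩
  obtain ⟨u, hu, huv⟩ := h5 d v (mem_freeBigrading.1 hv)
  rw [← huv]
  exact ((polyBigrading k n p).quot_mkQ _ (resJ_pr_mem hφ)).mem (mem_polyBigrading.2 hu)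

variable {hφ : ∀ i j, φ i j ∈ piece k n p (0, 1)} {β : ℕ → ℤ × ℤ → ℕ}

/-- The complex underlying a resolution. -/
def MinRes.cx (F : MinRes hφ β) : BGComplex k n p := freeComplex F.exact F.graded

instance (F : MinRes hφ β) (i : ℕ) : Module.Flat (PolyS k n p) (F.cx.X i) :=
  inferInstanceAs (Module.Flat (PolyS k n p) (FMod k n p β i))

lemma MinRes.vertExact (F : MinRes hφ β) {N : ℕ} (ν : Fin N → Fin n ⊕ Fin p) {g : PolyS k n p}
    {e : ℤ × ℤ} (hg : g ∈ piece k n p e) (D : Set (ℤ × ℤ)) (s : ℤ) (i : ℕ) :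
    VertExact F.cx ν g e D s i :=
  vertExact_of_coeff (Q := 0) hg fun d _ I _ u _ hu => by
    obtain ⟨w, hw⟩ := (F.exact i u).1 hu
    exact ⟨w, by rw [pow_zero, one_smul]; exact hw⟩

lemma MinRes.augExact (F : MinRes hφ β) {N : ℕ} (ν : Fin N → Fin n ⊕ Fin p) {g : PolyS k n p}
    {e : ℤ × ℤ} (hg : g ∈ piece k n p e) (D : Set (ℤ × ℤ)) (s : ℤ) :
    AugExact F.cx ν F.π g e D s :=
  augExact_of_coeff (Q := 0) hg fun d _ I _ u _ hu => by
    obtain ⟨w, hw⟩ := (F.exact_zero u).1 hu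
    exact ⟨w, by rw [pow_zero, one_smul]; exact hw⟩

variable {N : ℕ} {ν : Fin N → Fin n ⊕ Fin p} {g : PolyS k n p} {e : ℤ × ℤ} {D : Set (ℤ × ℤ)}
  {q : ℕ}

lemma MinRes.stair_of_koszulVanish (F : MinRes hφ β) (hν : Function.Injective ν)
    (hg : g ∈ piece k n p e) (hD : ∀ d ∈ D, ∀ Q : ℕ, d + Q • e ∈ D)
    (h : KoszulVanish (resQuot hφ) ν g e D q) : Stair F.cx ν g e D 0 q :=
  stair_down_all hg hD (fun _ => isWeaklyRegular_X ν hν) (fun _ _ _ => F.vertExact ν hg D _ _)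
    (_root_.stair_of_koszulVanish hg hD F.π_graded F.surj
      (fun u => F.exact_zero.apply_apply_eq_zero u) (F.augExact ν hg D q) h)

lemma MinRes.koszulVanish_of_stair (F : MinRes hφ β) (hν : Function.Injective ν)
    (hg : g ∈ piece k n p e) (hD : ∀ d ∈ D, ∀ Q : ℕ, d + Q • e ∈ D)
    (h : Stair F.cx ν g e D 0 q) : KoszulVanish (resQuot hφ) ν g e D q :=
  _root_.koszulVanish_of_stair hg hD F.π_graded F.surj
    (fun u => F.exact_zero.apply_apply_eq_zero u) (F.augExact ν hg D _)
    (stair_up_to hg hD (fun _ => isWeaklyRegular_X ν hν)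
      (fun _ _ _ => F.vertExact ν hg D _ _) h q 0 rfl)

variable (hφ) in
/-- The augmentation of the Koszul complex. -/
def koszulAug :
    (koszulComplex _ (zseq_mem hφ)).X 0 →ₗ[PolyS k n p] (PolyS k n p ⧸ resJ k n m p φ) :=
  (Submodule.mkQ _).comp (koszulZeroEquiv (zseq_mem hφ))

lemma koszulAug_graded :
    IsGraded ((koszulComplex _ (zseq_mem hφ)).gr 0) (resQuot hφ) (koszulAug hφ) := fun d u => by
  have h := koszulZero_graded (hz := zseq_mem hφ) d u
  change (resQuot hφ).pr d (Submodule.mkQ _ _) = Submodule.mkQ _ (koszulZeroEquiv _ _)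
  rw [← h]
  rfl

lemma koszulAug_surjective : Function.Surjective (koszulAug hφ) :=
  (Submodule.mkQ_surjective _).comp koszulZero_surjective

lemma koszulAug_d (u : (koszulComplex _ (zseq_mem hφ)).X 1) :
    koszulAug hφ ((koszulComplex _ (zseq_mem hφ)).d 0 u) = 0 :=
  (Submodule.Quotient.mk_eq_zero _).2
    ((le_sup_left : _ ≤ resJ k n m p φ) (koszulZero_d_mem (hz := zseq_mem hφ) u))

lemma koszulAug_exact {Q : ℕ} {g : PolyS k n p} {e d : ℤ × ℤ} (hg : g ∈ piece k n p e)
    {u : (koszulComplex _ (zseq_mem hφ)).X 0}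
    (hu : u ∈ ((koszulComplex _ (zseq_mem hφ)).gr 0).H d) (h : koszulAug hφ u = 0)
    (hd : 0 < (d + Q • e).1 ∨ (d + Q • e).2 < n) :
    ∃ w, (koszulComplex _ (zseq_mem hφ)).d 0 w = g ^ Q • u := by
  have h1 : koszulZeroEquiv (zseq_mem hφ) u ∈ resJ k n m p φ :=
    (Submodule.Quotient.mk_eq_zero _).1 h
  have h2 := koszulZero_graded.mem (Bigrading.smul_mem (pow_mem_piece hg Q) hu)
  have h3 := mem_zspan_of_mem_resJ hφ (u := koszulZeroEquiv (zseq_mem hφ) (g ^ Q • u)) (by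
    rw [map_smul]; exact Ideal.mul_mem_left _ _ h1) (mem_polyBigrading.1 h2) hd
  obtain ⟨w, hw⟩ := exists_koszulZero_d (hz := zseq_mem hφ) h3
  exact ⟨w, koszulZero_ext hw⟩

/-- The variables `ν` annihilate an element of homological degree zero modulo Koszul boundaries. -/
lemma exists_varD_of_mem {M : Type} [AddCommGroup M] [Module (PolyS k n p) M]
    {G : Bigrading k n p M} {d : ℤ × ℤ} {c : Finset (Fin N) → M} (hc : c ∈ G.kpart ν d 0)
    (h : c ∅ ∈ (Ideal.span (Set.range fun j => (X (ν j) : PolyS k n p)) • ⊤ :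
      Submodule (PolyS k n p) M)) : ∃ w ∈ G.kpart ν d 1, varD k ν w = c := by
  obtain ⟨v, hv⟩ : ∃ v : Fin N → M, ∑ j, (X (ν j) : PolyS k n p) • v j = c ∅ := by
    refine Submodule.smul_induction_on h (fun r hr u _ => ?_) ?_
    · obtain ⟨a, rfl⟩ := (Submodule.mem_span_range_iff_exists_fun _).1 hr
      refine ⟨fun j => a j • u, ?_⟩
      rw [Finset.sum_smul]
      exact Finset.sum_congr rfl fun j _ => by rw [smul_eq_mul, mul_comm, mul_smul]
    · rintro u u' ⟨v, rfl⟩ ⟨v', rfl⟩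
      exact ⟨v + v', by simp [Finset.sum_add_distrib]⟩
  have h0 : varD k ν (fun I : Finset (Fin N) => ∑ j, if I = {j} then v j else 0) = c := by
    ext1 I
    rw [varD, koszulD_apply]
    by_cases hI : I = ∅
    · subst hI
      rw [← hv]
      refine Finset.sum_congr rfl fun j _ => ?_
      rw [if_neg (Finset.notMem_empty _), Finset.sum_eq_single j]
      · simp [koszulSign]
      · intro j' _ hj'; simp [Ne.symm hj']
      · simp
    · rw [hc.1 I (by simpa using hI)]
      refine Finset.sum_eq_zero fun j _ => ?_
      split_ifs with hj
      · simp
      · rw [Finset.sum_eq_zero, smul_zero, smul_zero]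
        intro j' _
        rw [if_neg]
        intro h1
        have h2 := congrArg Finset.card h1
        rw [Finset.card_insert_of_notMem hj, Finset.card_singleton] at h2
        exact hI (Finset.card_eq_zero.1 (by omega))
  exact varD_lift hc h0

lemma varD_empty_mem {M : Type} [AddCommGroup M] [Module (PolyS k n p) M]
    (w : Finset (Fin N) → M) :
    varD k ν w ∅ ∈ (Ideal.span (Set.range fun j => (X (ν j) : PolyS k n p)) • ⊤ :
      Submodule (PolyS k n p) M) := by
  rw [varD, koszulD_apply]
  exact Submodule.sum_mem _ fun j _ =>
    Submodule.smul_mem_smul (Ideal.subset_span ⟨j, rfl⟩) trivial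

lemma finsupp_mem_smul_top {ι : Type} {I : Ideal (PolyS k n p)} {u : ι →₀ PolyS k n p}
    (h : ∀ q, u q ∈ I) : u ∈ (I • ⊤ : Submodule (PolyS k n p) (ι →₀ PolyS k n p)) := by
  rw [← Finsupp.sum_single u]
  refine Submodule.sum_mem _ fun q _ => ?_
  rw [← mul_one (u q), ← smul_eq_mul, ← Finsupp.smul_single]
  exact Submodule.smul_mem_smul (h q) trivial

lemma mem_of_finsupp_mem_smul_top {ι : Type} {I : Ideal (PolyS k n p)} {u : ι →₀ PolyS k n p}
    (h : u ∈ (I • ⊤ : Submodule (PolyS k n p) (ι →₀ PolyS k n p))) (q : ι) : u q ∈ I := by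
  refine Submodule.smul_induction_on h (fun r hr v _ => Ideal.mul_mem_right _ _ hr) ?_
  intro u v hu hv
  exact add_mem hu hv

end MinimalResolution

section Generators

variable {k : Type} [Field k] {n m p : ℕ} {φ : Matrix (Fin n) (Fin m) (PolyS k n p)}
  {hφ : ∀ i j, φ i j ∈ piece k n p (0, 1)} {β : ℕ → ℤ × ℤ → ℕ}

open RingTheory.Sequence

lemma varIdeal_le_ker :
    varIdeal k n p ≤ RingHom.ker (constantCoeff (R := k) (σ := Fin n ⊕ Fin p)) := by
  rw [varIdeal, Ideal.span_le]
  rintro _ ⟨j, rfl⟩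
  simp

lemma one_notMem_varIdeal : (1 : PolyS k n p) ∉ varIdeal k n p := fun h => by
  have := varIdeal_le_ker h
  simp at this

lemma span_X_le_varIdeal {N : ℕ} (ν : Fin N → Fin n ⊕ Fin p) :
    Ideal.span (Set.range fun j => (X (ν j) : PolyS k n p)) ≤ varIdeal k n p :=
  Ideal.span_mono (by rintro _ ⟨j, rfl⟩; exact ⟨ν j, rfl⟩)

lemma MinRes.single_ne (F : MinRes hφ β) {i : ℕ} (q : RIdx β i) {u : FMod k n p β i}
    (hu : u ∈ (varIdeal k n p • ⊤ : Submodule (PolyS k n p) (FMod k n p β i)))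
    (w : FMod k n p β (i + 1)) : Finsupp.single q 1 ≠ u + F.f i w := fun h => by
  have h1 : Finsupp.single q (1 : PolyS k n p) ∈
      (varIdeal k n p • ⊤ : Submodule (PolyS k n p) (FMod k n p β i)) := by
    rw [h]; exact add_mem hu (F.minimal i ⟨w, rfl⟩)
  have h2 := mem_of_finsupp_mem_smul_top h1 q
  rw [Finsupp.single_eq_same] at h2
  exact one_notMem_varIdeal h2

lemma MinRes.single_mem (F : MinRes hφ β) {i : ℕ} (q : RIdx β i) :
    (Finsupp.single q 1 : FMod k n p β i) ∈ (F.cx.gr i).H q.1.1 := by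
  refine mem_freeBigrading.2 fun q' => ?_
  by_cases h : q' = q
  · subst h
    rw [Finsupp.single_eq_same, sub_self]
    exact one_mem_piece
  · rw [Finsupp.single_eq_of_ne h]
    exact zero_mem _

/-- An element of `M` as an element of homological degree zero of a Koszul complex. -/
def koszulPure (N : ℕ) {M : Type} [Zero M] (u : M) : Finset (Fin N) → M :=
  fun I => if I = ∅ then u else 0

lemma koszulPure_mem {N : ℕ} {M : Type} [AddCommGroup M] [Module (PolyS k n p) M]
    {G : Bigrading k n p M} (ν : Fin N → Fin n ⊕ Fin p) {d : ℤ × ℤ} {u : M} (hu : u ∈ G.H d) :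
    koszulPure N u ∈ G.kpart ν d 0 := by
  refine mem_kpart.2 ⟨fun I hI => if_neg ?_, fun I => ?_⟩
  · rintro rfl
    simp at hI
  · unfold koszulPure
    split_ifs with h
    · subst h; simpa using hu
    · exact zero_mem _

lemma varD_eq_zero_of_mem {N : ℕ} {M : Type} [AddCommGroup M] [Module (PolyS k n p) M]
    {G : Bigrading k n p M} {ν : Fin N → Fin n ⊕ Fin p} {d : ℤ × ℤ} {c : Finset (Fin N) → M}
    (hc : c ∈ G.kpart ν d 0) : varD k ν c = 0 := by
  have h := varD_mem (s := -1) (by simpa using hc)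
  exact kpart_eq_zero (fun I hI => by omega) h

/-- The staircase statement for `F` at homological degree zero of the Koszul complex of `ν`, for a
single homogeneous element. -/
lemma MinRes.exists_of_stair (F : MinRes hφ β) {N : ℕ} {ν : Fin N → Fin n ⊕ Fin p}
    {g : PolyS k n p} {e : ℤ × ℤ} {D : Set (ℤ × ℤ)} {i : ℕ} (h : Stair F.cx ν g e D 0 i)
    {d : ℤ × ℤ} (hd : d ∈ D) {u : F.cx.X i} (hu : u ∈ (F.cx.gr i).H d)
    (hz : ∀ j, ∀ hj : i = j + 1, F.f j (hj ▸ u : FMod k n p β (j + 1)) ∈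
      (Ideal.span (Set.range fun j => (X (ν j) : PolyS k n p)) • ⊤ :
        Submodule (PolyS k n p) (FMod k n p β j))) :
    ∃ Q : ℕ, ∃ v ∈ (Ideal.span (Set.range fun j => (X (ν j) : PolyS k n p)) • ⊤ :
      Submodule (PolyS k n p) (FMod k n p β i)),
      ∃ w, (g ^ Q • u : FMod k n p β i) = v + F.f i w := by
  have hc := koszulPure_mem (N := N) ν hu
  obtain ⟨Q, w, -, w', -, heq⟩ := h d hd _ hc
    ⟨0, zero_mem _, by rw [varD_eq_zero_of_mem hc, map_zero]⟩ (by
      cases i with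
      | zero => trivial
      | succ j =>
        obtain ⟨e, he, hee⟩ := exists_varD_of_mem (kd_mem (Y := F.cx) (i := j) hc) (hz j rfl)
        exact ⟨e, by simpa using he, hee.symm⟩)
  exact ⟨Q, varD k ν w ∅, varD_empty_mem w, w' ∅, congrFun heq ∅⟩

lemma MinRes.false_of_stair (F : MinRes hφ β) {N : ℕ} {ν : Fin N → Fin n ⊕ Fin p} {i : ℕ}
    (q : RIdx β i) (h : Stair F.cx ν 1 0 {q.1.1} 0 i)
    (hz : ∀ j, ∀ hj : i = j + 1, F.f j (hj ▸ Finsupp.single q 1 : FMod k n p β (j + 1)) ∈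
      (Ideal.span (Set.range fun j => (X (ν j) : PolyS k n p)) • ⊤ :
        Submodule (PolyS k n p) (FMod k n p β j))) : False := by
  obtain ⟨Q, v, hv, w, h⟩ := F.exists_of_stair h rfl (F.single_mem q) hz
  refine F.single_ne q (Submodule.smul_mono_left (span_X_le_varIdeal _) hv) w ?_
  rw [← h, one_pow]
  exact (one_smul (PolyS k n p) (Finsupp.single q (1 : PolyS k n p))).symm

lemma mem_span_X_inl {d : ℤ × ℤ} {u : PolyS k n p} (hu : u ∈ piece k n p d) (hd : 0 < d.1) :
    u ∈ Ideal.span (Set.range fun j : Fin n => (X (Sum.inl j) : PolyS k n p)) := by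
  rw [u.as_sum]
  refine Ideal.sum_mem _ fun a ha => ?_
  obtain ⟨i, b, hb⟩ := exists_X_inl_mul (c := coeff a u) (hu (mem_support_iff.1 ha)) hd
  rw [hb]
  exact Ideal.mul_mem_left _ _ (Ideal.subset_span ⟨i, rfl⟩)

end Generators
section XDegree

variable {k : Type} [Field k] {n m p : ℕ} {φ : Matrix (Fin n) (Fin m) (PolyS k n p)}
  {hφ : ∀ i j, φ i j ∈ piece k n p (0, 1)} {β : ℕ → ℤ × ℤ → ℕ}
  (hrs : ∃ rs : List (PolyS k n p), rs.length = m ∧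
    (∀ r ∈ rs, ∀ l, X (Sum.inl l) * r ∈ Ideal.span (Set.range (zseq k n m p φ))) ∧
    RingTheory.Sequence.IsWeaklyRegular (PolyS k n p) rs)

lemma resQuot_lift {d : ℤ × ℤ} {u : PolyS k n p ⧸ resJ k n m p φ} (hu : u ∈ (resQuot hφ).H d) :
    ∃ r ∈ piece k n p d, Submodule.mkQ _ r = u := by
  obtain ⟨r, rfl⟩ := Submodule.mkQ_surjective _ u
  obtain ⟨r', hr', h⟩ := ((polyBigrading k n p).quot_mkQ _ (resJ_pr_mem hφ)).lift hu rfl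
  exact ⟨r', mem_polyBigrading.1 hr', h⟩

lemma resQuot_H_eq_zero {d : ℤ × ℤ} {u : PolyS k n p ⧸ resJ k n m p φ}
    (hu : u ∈ (resQuot hφ).H d) (hd : d.1 < 0 ∨ d.2 < 0) : u = 0 := by
  obtain ⟨r, hr, rfl⟩ := resQuot_lift hu
  rw [piece_eq_zero_of_neg hr hd, map_zero]

include hrs in
lemma koszulVanish_inl {q : ℕ} {a b : ℤ} (h : a ≠ q ∨ (n : ℤ) ≤ a) :
    KoszulVanish (resQuot hφ) (Sum.inl : Fin n → Fin n ⊕ Fin p) 1 0 {(a, b)} q := by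
  rcases lt_trichotomy a q with haq | haq | haq
  · rintro d rfl c hc -
    refine ⟨0, 0, zero_mem _, ?_⟩
    rw [kpart_eq_zero (fun I hI u hu => resQuot_H_eq_zero hu (Or.inl ?_)) hc, map_zero, smul_zero]
    rw [sum_bideg_inl, hI]; simpa using haq
  · subst haq
    rcases eq_or_lt_of_le (h.resolve_left (by simp)) with hq | hq
    swap
    · rintro d rfl c hc -
      exact ⟨0, 0, zero_mem _, by rw [kpart_eq_zero_of_lt hq hc]; simp⟩
    · obtain rfl : n = q := by exact_mod_cast hq
      rintro d rfl c hc hv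
      refine ⟨0, 0, zero_mem _, ?_⟩
      rw [map_zero, pow_zero, one_smul]
      symm
      ext1 I
      by_cases hI : (I.card : ℤ) = n
      swap
      · exact hc.1 I hI
      have hIu : I = Finset.univ := by
        rw [← Finset.card_eq_iff_eq_univ, Fintype.card_fin]; exact_mod_cast hI
      subst hIu
      have h1 := (mem_kpart.1 hc).2 Finset.univ
      rw [sum_bideg_inl] at h1
      obtain ⟨r, hr, hrc⟩ := resQuot_lift h1
      rw [← hrc]
      refine (Submodule.Quotient.mk_eq_zero _).2 ((le_sup_right : _ ≤ resJ k n m p φ)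
        (mem_minorsIdeal_of_X_mul_mem hφ hrs (b := b) (by simpa using hr) fun j => ?_))
      refine mem_zspan_of_mem_resJ hφ ?_ (IsWeightedHomogeneous.mul (X_mem_piece (Sum.inl j)) hr)
        (Or.inl (by simp [bideg]))
      refine (Submodule.Quotient.mk_eq_zero _).1 ?_
      change Submodule.mkQ _ ((X (Sum.inl j) : PolyS k n p) • r) = 0
      rw [map_smul, hrc]
      have h2 := congrFun hv (Finset.univ.erase j)
      rw [varD, koszulD_apply, Finset.sum_eq_single j] at h2
      · rw [if_neg (Finset.notMem_erase _ _), Finset.insert_erase (Finset.mem_univ j),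
          smul_comm] at h2
        have h3 : koszulSign j (Finset.univ.erase j) • (koszulSign j (Finset.univ.erase j) •
            ((X (Sum.inl j) : PolyS k n p) • c Finset.univ)) =
              koszulSign j (Finset.univ.erase j) • 0 := congrArg _ h2
        rwa [smul_smul, koszulSign_mul_self, one_smul, smul_zero] at h3
      · intro i _ hij
        rw [if_pos (Finset.mem_erase.2 ⟨hij, Finset.mem_univ i⟩), smul_zero]
      · simp
  · have hD := koszul_zero_add (d := (a, b)) rfl
    refine koszulVanish_of_stair one_mem_piece hD koszulAug_graded koszulAug_surjective
      koszulAug_d ?_ (stair_up_to one_mem_piece hD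
        (fun _ => isWeaklyRegular_X _ Sum.inl_injective) (q := q) ?_ ?_ q 0 rfl)
    · refine augExact_of_coeff (Q := 0) one_mem_piece ?_
      rintro d rfl I hI u hu hu0
      refine koszulAug_exact one_mem_piece hu hu0 (Or.inl ?_)
      rw [sum_bideg_inl, hI]; simp; omega
    · intro s i hs
      refine vertExact_of_coeff (Q := 0) one_mem_piece ?_
      rintro d rfl I hI u hu hu0
      rw [sum_bideg_inl, hI] at hu
      obtain ⟨w, hw⟩ := koszul_exact (hz := zseq_mem hφ) hrs (i := i + 1) (by omega)
        (Or.inl (by simp; omega)) hu hu0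
      exact ⟨w, by rw [pow_zero, one_smul]; exact hw⟩
    · rintro d rfl c hc - -
      obtain ⟨w, hw, hwc⟩ := exists_varD_of_mem hc (koszul_mem_smul_top _ fun T =>
        mem_span_X_inl (mem_koszulComplex_gr.1 ((mem_kpart.1 hc).2 ∅) T) (by simp; omega))
      exact ⟨0, w, by simpa using hw, 0, zero_mem _, by simp [hwc]⟩

include hrs in
/-- The generators of the `i`-th free module have `x`-degree between `0` and `min i (n - 1)`. -/
lemma MinRes.xdeg_bound (F : MinRes hφ β) (i : ℕ) : ∀ q : RIdx β i,
    0 ≤ q.1.1.1 ∧ q.1.1.1 ≤ i ∧ q.1.1.1 < n := by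
  induction i with
  | zero =>
    intro q
    by_contra hcon
    refine F.false_of_stair q
      (F.stair_of_koszulVanish Sum.inl_injective one_mem_piece (koszul_zero_add rfl)
        (koszulVanish_inl (a := q.1.1.1) (b := q.1.1.2) hrs (by push_cast at hcon ⊢; omega)))
      (fun j hj => by omega)
  | succ i ih =>
    intro q
    by_contra hcon
    refine F.false_of_stair q
      (F.stair_of_koszulVanish Sum.inl_injective one_mem_piece (koszul_zero_add rfl)
        (koszulVanish_inl (a := q.1.1.1) (b := q.1.1.2) hrs (by push_cast at hcon ⊢; omega)))
      (fun j hj => by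
        obtain rfl : i = j := by omega
        refine finsupp_mem_smul_top fun q' => ?_
        have h1 := mem_freeBigrading.1 ((F.cx.d_graded i).mem (F.single_mem q)) q'
        rcases lt_trichotomy q'.1.1.1 q.1.1.1 with hlt | heq | hgt
        · exact mem_span_X_inl h1 (by simpa using hlt)
        · have := ih q'
          push_cast at hcon
          omega
        · have h2 := piece_eq_zero_of_neg h1 (Or.inl (by simpa using hgt))
          have h3 : F.f i (Finsupp.single q 1) q' = 0 := h2
          rw [h3]
          exact zero_mem _)

end XDegree

section AllVariables

variable {k : Type} [Field k] {n m p : ℕ} {φ : Matrix (Fin n) (Fin m) (PolyS k n p)}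
  {hφ : ∀ i j, φ i j ∈ piece k n p (0, 1)} {β : ℕ → ℤ × ℤ → ℕ}
  (hrs : ∃ rs : List (PolyS k n p), rs.length = m ∧
    (∀ r ∈ rs, ∀ l, X (Sum.inl l) * r ∈ Ideal.span (Set.range (zseq k n m p φ))) ∧
    RingTheory.Sequence.IsWeaklyRegular (PolyS k n p) rs)

variable (n p) in
/-- An enumeration of all the variables. -/
def allVars : Fin (n + p) → Fin n ⊕ Fin p := finSumFinEquiv.symm

lemma allVars_injective : Function.Injective (allVars n p) := finSumFinEquiv.symm.injective

variable (k n p) in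
lemma span_allVars :
    Ideal.span (Set.range fun j => (X (allVars n p j) : PolyS k n p)) = varIdeal k n p := by
  congr 1
  exact finSumFinEquiv.symm.surjective.range_comp (X : (Fin n ⊕ Fin p) → PolyS k n p)

lemma sum_bideg_nonneg {N : ℕ} (ν : Fin N → Fin n ⊕ Fin p) (I : Finset (Fin N)) :
    0 ≤ (∑ j ∈ I, bideg n p (ν j)).1 ∧ 0 ≤ (∑ j ∈ I, bideg n p (ν j)).2 := by
  rw [Prod.fst_sum, Prod.snd_sum]
  exact ⟨Finset.sum_nonneg fun j _ => by rcases ν j with i | i <;> simp [bideg],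
    Finset.sum_nonneg fun j _ => by rcases ν j with i | i <;> simp [bideg]⟩

lemma mem_varIdeal_of_ne {d : ℤ × ℤ} {u : PolyS k n p} (hu : u ∈ piece k n p d) (hd : d ≠ 0) :
    u ∈ varIdeal k n p := by
  rw [varIdeal, ← Set.image_univ, mem_ideal_span_X_image]
  intro a ha
  by_contra! h
  have : a = 0 := by ext i; exact h i trivial
  subst this
  exact hd (by simpa using (hu (mem_support_iff.1 ha)).symm)

variable {N : ℕ} {ν : Fin N → Fin n ⊕ Fin p} {a b : ℤ}

include hrs in
lemma koszul_vertExact (hb : b < n) (s : ℤ) (i : ℕ) :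
    VertExact (koszulComplex _ (zseq_mem hφ)) ν 1 0 {(a, b)} s i := by
  refine vertExact_of_coeff (Q := 0) one_mem_piece ?_
  rintro d rfl I hI u hu hu0
  have h := (sum_bideg_nonneg ν I).2
  obtain ⟨w, hw⟩ := koszul_exact (hz := zseq_mem hφ) hrs (i := i + 1) (by omega)
    (Or.inr (by rw [Prod.snd_sub]; push_cast; omega)) hu hu0
  exact ⟨w, by rw [pow_zero, one_smul]; exact hw⟩

lemma koszul_augExact (hb : b < n) (s : ℤ) :
    AugExact (koszulComplex _ (zseq_mem hφ)) ν (koszulAug hφ) 1 0 {(a, b)} s := by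
  refine augExact_of_coeff (Q := 0) one_mem_piece ?_
  rintro d rfl I hI u hu hu0
  have h := (sum_bideg_nonneg ν I).2
  exact koszulAug_exact one_mem_piece hu hu0 (Or.inr (by simp; omega))

lemma MinRes.f_single_mem (F : MinRes hφ β) {i : ℕ} (q : RIdx β i) (j : ℕ) (hj : i = j + 1) :
    F.f j (hj ▸ Finsupp.single q 1 : FMod k n p β (j + 1)) ∈
      (Ideal.span (Set.range fun j => (X (allVars n p j) : PolyS k n p)) • ⊤ :
        Submodule (PolyS k n p) (FMod k n p β j)) := by
  rw [span_allVars]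
  exact F.minimal j ⟨_, rfl⟩

include hrs in
/-- Generators in homological degree greater than their `x`-degree have `y`-degree at least `n`. -/
lemma MinRes.le_ydeg (F : MinRes hφ β) {i : ℕ} (q : RIdx β i) (hq : q.1.1.1 < i) :
    (n : ℤ) ≤ q.1.1.2 := by
  by_contra! hb
  have hD := koszul_zero_add (d := (q.1.1.1, q.1.1.2)) rfl
  refine F.false_of_stair (ν := allVars n p) q
    (F.stair_of_koszulVanish allVars_injective one_mem_piece hD
      (_root_.koszulVanish_of_stair one_mem_piece hD koszulAug_graded koszulAug_surjective
      koszulAug_d (koszul_augExact hb _) (stair_up_to one_mem_piece hD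
        (fun _ => isWeaklyRegular_X _ allVars_injective) (q := i)
          (fun s i _ => koszul_vertExact (hφ := hφ) hrs hb s i) ?_ i 0 rfl))) (F.f_single_mem q)
  refine stair_of_kpart_eq_zero fun d hd c hc => kpart_eq_zero (fun I hI u hu => ?_) hc
  obtain rfl : d = _ := hd
  refine koszul_H_eq_zero hu (Or.inl ?_)
  have := (sum_bideg_nonneg (allVars n p) I).1
  rw [Prod.fst_sub]
  omega

lemma koszul_d_mem_varIdeal {i : ℕ} (u : (koszulComplex _ (zseq_mem hφ)).X (i + 1)) :
    (koszulComplex _ (zseq_mem hφ)).d i u ∈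
      (varIdeal k n p • ⊤ : Submodule (PolyS k n p) ((koszulComplex _ (zseq_mem hφ)).X i)) := by
  refine koszul_mem_smul_top _ fun T => ?_
  rw [coe_koszulComplex_d, koszulD_apply]
  exact Ideal.sum_mem _ fun j _ => Ideal.mul_mem_right _ _
    (mem_varIdeal_of_ne (zseq_mem hφ j) (by simp [Prod.ext_iff]))

/-- A basis element of the Koszul complex. -/
def koszulBasis {z : Fin m → PolyS k n p} (hz : ∀ j, z j ∈ piece k n p (1, 1)) {i : ℕ}
    (T : Finset (Fin m)) (hT : T.card = i) : (koszulComplex z hz).X i :=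
  ⟨Pi.single T 1, fun I hI => Pi.single_eq_of_ne (by rintro rfl; exact hI (by rw [hT])) _⟩

lemma koszulBasis_mem {z : Fin m → PolyS k n p} (hz : ∀ j, z j ∈ piece k n p (1, 1)) {i : ℕ}
    (T : Finset (Fin m)) (hT : T.card = i) :
    koszulBasis hz T hT ∈ ((koszulComplex z hz).gr i).H (i, i) := by
  refine mem_koszulComplex_gr.2 fun I => ?_
  by_cases h : I = T
  · subst h
    have : (koszulBasis hz I hT).1 I = 1 := Pi.single_eq_same _ _
    rw [this]
    convert one_mem_piece using 1
    simp
  · have : (koszulBasis hz T hT).1 I = 0 := Pi.single_eq_of_ne h _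
    rw [this]
    exact zero_mem _

lemma koszulBasis_ne {z : Fin m → PolyS k n p} (hz : ∀ j, z j ∈ piece k n p (1, 1)) {i : ℕ}
    (T : Finset (Fin m)) (hT : T.card = i) :
    koszulBasis hz T hT ∉
      (varIdeal k n p • ⊤ : Submodule (PolyS k n p) ((koszulComplex z hz).X i)) := fun h => by
  have h1 : ∀ u ∈ (varIdeal k n p • ⊤ : Submodule (PolyS k n p) ((koszulComplex z hz).X i)),
      u.1 T ∈ varIdeal k n p := by
    intro u hu
    refine Submodule.smul_induction_on hu (fun r hr v _ => ?_) fun v w hv hw => ?_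
    · exact Ideal.mul_mem_right _ _ hr
    · exact add_mem hv hw
  have h2 := h1 _ h
  have h3 : (koszulBasis hz T hT).1 T = 1 := Pi.single_eq_same _ _
  rw [h3] at h2
  exact one_notMem_varIdeal h2

lemma koszul_not_stair {i : ℕ} (hi : i ≤ m) :
    ¬ Stair (koszulComplex _ (zseq_mem hφ)) (allVars n p) 1 0 {((i : ℤ), (i : ℤ))} 0 i := by
  intro h
  obtain ⟨T, -, hT⟩ := Finset.exists_subset_card_eq (s := (Finset.univ : Finset (Fin m))) (n := i)
    (by simpa using hi)
  have hc := koszulPure_mem (N := n + p) (allVars n p) (koszulBasis_mem (zseq_mem hφ) T hT)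
  obtain ⟨Q, w, -, w', -, heq⟩ := h _ rfl _ hc
    ⟨0, zero_mem _, by rw [varD_eq_zero_of_mem hc, map_zero]⟩ (by
      cases i with
      | zero => trivial
      | succ j =>
        obtain ⟨e, he, hee⟩ := exists_varD_of_mem
          (kd_mem (Y := koszulComplex _ (zseq_mem hφ)) (i := j) hc)
          (by rw [span_allVars]; exact koszul_d_mem_varIdeal (hφ := hφ) _)
        exact ⟨e, by simpa using he, hee.symm⟩)
  rw [one_pow, one_smul] at heq
  refine koszulBasis_ne (zseq_mem hφ) T hT ?_
  have h1 : koszulBasis (zseq_mem hφ) T hT = varD k (allVars n p) w ∅ +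
    (koszulComplex _ (zseq_mem hφ)).d i (w' ∅) := congrFun heq ∅
  rw [h1]
  refine add_mem ?_ (koszul_d_mem_varIdeal (hφ := hφ) _)
  rw [← span_allVars]
  exact varD_empty_mem w

include hrs in
/-- There are generators of bidegree `(i, i)` in homological degree `i < n`. -/
lemma MinRes.exists_diag (F : MinRes hφ β) {i : ℕ} (hi : i < n) (him : i ≤ m) :
    ∃ q : RIdx β i, q.1.1 = ((i : ℤ), (i : ℤ)) := by
  by_contra! hcon
  have hD := koszul_zero_add (d := ((i : ℤ), (i : ℤ))) rfl
  have hb : (i : ℤ) < n := by exact_mod_cast hi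
  refine koszul_not_stair (hφ := hφ) him (stair_down_all one_mem_piece hD
    (fun _ => isWeaklyRegular_X _ allVars_injective)
    (fun s i _ => koszul_vertExact (hφ := hφ) hrs hb s i)
    (_root_.stair_of_koszulVanish one_mem_piece hD koszulAug_graded koszulAug_surjective koszulAug_d
      (koszul_augExact hb _) (F.koszulVanish_of_stair allVars_injective one_mem_piece hD ?_)))
  rintro d rfl c hc - -
  obtain ⟨w, hw, hwc⟩ := exists_varD_of_mem hc (by
    rw [span_allVars]
    exact finsupp_mem_smul_top fun q => mem_varIdeal_of_ne
      (mem_freeBigrading.1 ((mem_kpart.1 hc).2 ∅) q) (by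
        rw [Finset.sum_empty, sub_zero]
        exact sub_ne_zero.2 (hcon q).symm))
  exact ⟨0, w, by simpa using hw, 0, zero_mem _, by simp [hwc]⟩

end AllVariables

section YDegree

variable {k : Type} [Field k] {n m p : ℕ} {φ : Matrix (Fin n) (Fin m) (PolyS k n p)}
  {hφ : ∀ i j, φ i j ∈ piece k n p (0, 1)} {β : ℕ → ℤ × ℤ → ℕ}
  (hrs : ∃ rs : List (PolyS k n p), rs.length = m ∧
    (∀ r ∈ rs, ∀ l, X (Sum.inl l) * r ∈ Ideal.span (Set.range (zseq k n m p φ))) ∧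
    RingTheory.Sequence.IsWeaklyRegular (PolyS k n p) rs)

open RingTheory.Sequence

variable (k n p) in
/-- The ideal generated by the `y`-variables. -/
def yIdeal : Ideal (PolyS k n p) :=
  Ideal.span (Set.range fun j : Fin p => (X (Sum.inr j) : PolyS k n p))

lemma yIdeal_le : yIdeal k n p ≤ varIdeal k n p := span_X_le_varIdeal _

lemma mem_yIdeal {d : ℤ × ℤ} {u : PolyS k n p} (hu : u ∈ piece k n p d) (hd : 0 < d.2) :
    u ∈ yIdeal k n p := by
  rw [yIdeal, ← Set.image_univ, ← Set.image_image (fun i => (X i : PolyS k n p)) Sum.inr,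
    mem_ideal_span_X_image]
  intro a ha
  by_contra! h
  have h1 := hu (mem_support_iff.1 ha)
  rw [weight_bideg] at h1
  have : ∑ j, (a (Sum.inr j) : ℤ) = 0 := Finset.sum_eq_zero fun j _ => by
    simpa using h (Sum.inr j) ⟨j, trivial, rfl⟩
  rw [← h1] at hd
  simp only [this] at hd
  exact lt_irrefl _ hd

lemma pr_mem_yIdeal_smul {M : Type} [AddCommGroup M] [Module (PolyS k n p) M]
    (G : Bigrading k n p M) (d : ℤ × ℤ) (u : M)
    (hu : u ∈ (yIdeal k n p • ⊤ : Submodule (PolyS k n p) M)) :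
    G.pr d u ∈ (yIdeal k n p • ⊤ : Submodule (PolyS k n p) M) := by
  refine Submodule.smul_induction_on hu (fun r hr v _ => ?_) fun v w hv hw => ?_
  · clear hu
    induction hr using Submodule.span_induction generalizing v with
    | mem x hx =>
      obtain ⟨j, rfl⟩ := hx
      rw [G.pr_smul' (X_mem_piece (Sum.inr j))]
      exact Submodule.smul_mem_smul (Ideal.subset_span ⟨j, rfl⟩) trivial
    | zero => rw [zero_smul, map_zero]; exact zero_mem _
    | add x y _ _ hx hy =>
      rw [add_smul, map_add]
      exact add_mem (hx v trivial) (hy v trivial)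
    | smul s x _ hx =>
      rw [smul_eq_mul, mul_comm, mul_smul]
      exact hx _ trivial
  · rw [map_add]; exact add_mem hv hw

/-- The reduction of a resolution modulo the `y`-variables. -/
def MinRes.modY (F : MinRes hφ β) : BGComplex k n p :=
  F.cx.quot (fun _ => yIdeal k n p • ⊤) (fun _ d u hu => pr_mem_yIdeal_smul _ d u hu)
    (fun i u hu => by
      have : Submodule.map (F.cx.d i) (yIdeal k n p • ⊤) ≤ yIdeal k n p • ⊤ := by
        rw [Submodule.map_smul'']
        exact Submodule.smul_mono le_rfl le_top
      exact this ⟨u, hu, rfl⟩)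

lemma isWeaklyRegular_quot {R M : Type} [CommRing R] [AddCommGroup M] [Module R M] {I : Ideal R}
    {rs₁ rs₂ : List R} (hI : I = Ideal.ofList rs₁) (h : IsWeaklyRegular M (rs₁ ++ rs₂)) :
    IsWeaklyRegular (M ⧸ (I • ⊤ : Submodule R M)) rs₂ := by
  subst hI
  exact ((isWeaklyRegular_append_iff M rs₁ rs₂).1 h).2

lemma MinRes.modY_isWeaklyRegular (F : MinRes hφ β) (e : Fin n → ℕ) (j : ℕ) :
    IsWeaklyRegular (F.modY.X j)
      ((List.finRange n).map fun l => (X (Sum.inl l) : PolyS k n p) ^ e l) := by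
  refine isWeaklyRegular_quot (M := FMod k n p β j)
    (rs₁ := List.ofFn fun j : Fin p => (X (Sum.inr j) : PolyS k n p)) ?_
    (isWeaklyRegular_of_flat ?_)
  · rw [Ideal.ofList, yIdeal]
    congr 1
    ext x
    simp [List.mem_ofFn, Set.mem_range]
  · rw [← List.ofFn_eq_map]
    have h := isWeaklyRegular_X_pow (k := k) (Fin.append (Sum.inr : Fin p → Fin n ⊕ Fin p) Sum.inl)
      (by
        rw [Fin.append_injective_iff]
        exact ⟨Sum.inr_injective, Sum.inl_injective, fun _ _ => by simp⟩)
      (Fin.append (fun _ => 1) e)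
    rw [← List.ofFn_fin_append]
    rwa [show (Fin.append (fun j : Fin p => (X (Sum.inr j) : PolyS k n p))
        fun j => X (Sum.inl j) ^ e j) = fun j => X (Fin.append Sum.inr Sum.inl j) ^
          (Fin.append (fun _ => 1) e j) from funext fun j => by
      refine Fin.addCases (fun j => ?_) (fun j => ?_) j <;> simp]

variable {b : ℤ}

include hrs in
lemma MinRes.stair_inr (F : MinRes hφ β) (hb : (m : ℤ) < b) (l : Fin n) (q : ℕ) :
    Stair F.cx (Sum.inr : Fin p → Fin n ⊕ Fin p) (X (Sum.inl l)) (bideg n p (Sum.inl l))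
      {d | d.2 = b} 0 q := by
  have hD : ∀ d ∈ {d : ℤ × ℤ | d.2 = b}, ∀ Q : ℕ, d + Q • bideg n p (Sum.inl l) ∈
      {d : ℤ × ℤ | d.2 = b} := by
    intro d hd Q
    simpa [bideg, Set.mem_ofPred_eq] using hd
  have hg := X_mem_piece (k := k) (n := n) (p := p) (Sum.inl l)
  obtain ⟨rs, hlen, hz, hreg⟩ := hrs
  refine F.stair_of_koszulVanish Sum.inr_injective hg hD
    (_root_.koszulVanish_of_stair hg hD koszulAug_graded koszulAug_surjective koszulAug_d ?_
      (stair_up_to hg hD (fun _ => isWeaklyRegular_X _ Sum.inr_injective) (q := q) ?_ ?_ q 0 rfl))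
  · refine augExact_of_coeff (Q := 1) hg fun d _ I _ u _ hu => ?_
    obtain ⟨w, hw⟩ := exists_koszulZero_d (hz := zseq_mem hφ)
      (X_mul_resJ_mem l ((Submodule.Quotient.mk_eq_zero _).1 hu))
    refine ⟨w, koszulZero_ext ?_⟩
    rw [hw, pow_one]
    rfl
  · intro s i _
    refine vertExact_of_coeff (Q := m) hg fun d _ I _ u _ hu => ?_
    exact koszul_torsion l hlen (fun r hr => hz r hr l) hreg (by omega) u hu
  · intro d hd c hc _ _
    by_cases hq : q ≤ m
    · obtain ⟨w, hw, hwc⟩ := exists_varD_of_mem hc (koszul_mem_smul_top _ fun T =>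
        mem_yIdeal (mem_koszulComplex_gr.1 ((mem_kpart.1 hc).2 ∅) T) (by
          have : d.2 = b := hd
          simp; omega))
      refine ⟨0, w, by simpa using hw, 0, zero_mem _, by simp [hwc]⟩
    · have : c = 0 := by
        refine kpart_eq_zero (fun I _ u _ => ?_) hc
        refine Subtype.ext (funext fun T => u.2 T ?_)
        have := T.card_le_univ
        simp at this
        omega
      exact ⟨0, 0, zero_mem _, 0, zero_mem _, by rw [this]; simp⟩

include hrs in
lemma MinRes.modY_exact (F : MinRes hφ β) (hb : (m : ℤ) < b) (i : ℕ) (a : ℤ) (ha : 0 ≤ a) :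
    ∀ h ∈ (F.modY.gr i).H (a, b), F.modY.IsCycle i h → ∃ w, F.modY.d i w = h := by
  refine rigidity (List.finRange n) (List.nodup_finRange n) F.modY i a
    (fun e j => F.modY_isWeaklyRegular e j) ?_ ?_
  · intro l _ j _ a h hh hc
    obtain ⟨h', rfl⟩ := Submodule.mkQ_surjective _ h
    obtain ⟨u, hu, huh⟩ := (Bigrading.quot_mkQ _ _ _).lift hh rfl
    rw [← huh] at hc ⊢
    obtain ⟨Q, v, hv, w, hw⟩ := F.exists_of_stair (F.stair_inr hrs hb l j) rfl hu (by
      rintro j rfl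
      exact (Submodule.Quotient.mk_eq_zero _).1 hc)
    refine ⟨Q, Submodule.mkQ _ w, ?_⟩
    symm
    refine (Submodule.Quotient.eq _).2 ?_
    have : (X (Sum.inl l) : PolyS k n p) ^ Q • u - F.cx.d j w = v :=
      sub_eq_iff_eq_add.2 hw
    rw [this]
    exact hv
  · intro e u hu
    obtain ⟨h', rfl⟩ := Submodule.mkQ_surjective _ u
    obtain ⟨v, hv, hvh⟩ := (Bigrading.quot_mkQ _ _ _).lift hu rfl
    rw [← hvh]
    have h1 : v ∈ (Ideal.ofList ((List.finRange n).map fun l =>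
        (X (Sum.inl l) : PolyS k n p) ^ e l) • ⊤ :
          Submodule (PolyS k n p) (FMod k n p β _)) := by
      refine finsupp_mem_smul_top fun q => mem_ofList_X_pow e (mem_freeBigrading.1 hv q) ?_
      have := F.xdeg_bound hrs _ q
      simp; omega
    have h2 := Submodule.mem_map_of_mem (f := Submodule.mkQ
      (yIdeal k n p • ⊤ : Submodule (PolyS k n p) (FMod k n p β (i + (List.finRange n).length)))) h1
    rw [Submodule.map_smul''] at h2
    exact Submodule.smul_mono le_rfl le_top h2

lemma MinRes.modY_d_ne (F : MinRes hφ β) {i : ℕ} (q : RIdx β i) (w : F.modY.X (i + 1))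
    (hw : F.modY.d i w = Submodule.mkQ _ (Finsupp.single q (1 : PolyS k n p))) : False := by
  obtain ⟨w, rfl⟩ := Submodule.mkQ_surjective _ w
  have h1 : Finsupp.single q (1 : PolyS k n p) - F.f i w ∈
      (yIdeal k n p • ⊤ : Submodule (PolyS k n p) (FMod k n p β i)) :=
    (Submodule.Quotient.eq _).1 hw.symm
  exact F.single_ne q (Submodule.smul_mono_left yIdeal_le h1) w (sub_add_cancel _ _).symm

include hrs in
/-- The generators have `y`-degree at most `m`. -/
lemma MinRes.ydeg_le (F : MinRes hφ β) (i : ℕ) : ∀ q : RIdx β i, q.1.1.2 ≤ m := by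
  suffices H : ∀ b : ℤ, (m : ℤ) < b → ∀ q : RIdx β i, q.1.1.2 ≠ b by
    intro q
    by_contra! h
    exact H _ h q rfl
  intro b hb
  induction i with
  | zero =>
    rintro q rfl
    obtain ⟨w, hw⟩ := F.modY_exact hrs hb 0 q.1.1.1 (F.xdeg_bound hrs 0 q).1
      (Submodule.mkQ _ (Finsupp.single q 1)) ((Bigrading.quot_mkQ _ _ _).mem (F.single_mem q))
      trivial
    exact F.modY_d_ne q w hw
  | succ i ih =>
    rintro q rfl
    obtain ⟨w, hw⟩ := F.modY_exact hrs hb (i + 1) q.1.1.1 (F.xdeg_bound hrs _ q).1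
      (Submodule.mkQ _ (Finsupp.single q 1)) ((Bigrading.quot_mkQ _ _ _).mem (F.single_mem q)) (by
        refine (Submodule.Quotient.mk_eq_zero _).2 ?_
        refine finsupp_mem_smul_top fun q' => ?_
        have h1 := mem_freeBigrading.1 ((F.cx.d_graded i).mem (F.single_mem q)) q'
        rcases lt_or_ge q'.1.1.2 q.1.1.2 with h | h
        · exact mem_yIdeal h1 (by simpa using h)
        · have h2 := piece_eq_zero_of_neg h1 (Or.inr (by
            have := ih q'
            rw [Prod.snd_sub]
            omega))
          exact (show F.f i (Finsupp.single q 1) q' = 0 from h2) ▸ zero_mem (yIdeal k n p))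
    exact F.modY_d_ne q w hw

end YDegree

section Strands

variable {k : Type} [Field k] {n m p : ℕ} {φ : Matrix (Fin n) (Fin m) (PolyS k n p)}
  {hφ : ∀ i j, φ i j ∈ piece k n p (0, 1)} {β : ℕ → ℤ × ℤ → ℕ}

/-- Multiplication by `r` on the resolution is null-homotopic, through a homotopy that does not
raise `x`-degrees. -/
def MinRes.NullHomotopic (F : MinRes hφ β) (r : PolyS k n p) : Prop :=
  ∃ h : ∀ i, FMod k n p β i →ₗ[PolyS k n p] FMod k n p β (i + 1),
    (∀ u, F.f 0 (h 0 u) = r • u) ∧ (∀ i u, F.f (i + 1) (h (i + 1) u) + h i (F.f i u) = r • u) ∧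
    ∀ i (q : RIdx β i) (q' : RIdx β (i + 1)), q.1.1.1 < q'.1.1.1 → h i (Finsupp.single q 1) q' = 0

lemma finsupp_map_congr {R ι M : Type} [CommRing R] [AddCommGroup M] [Module R M]
    {f g : (ι →₀ R) →ₗ[R] M} {u : ι →₀ R}
    (h : ∀ q, u q ≠ 0 → f (Finsupp.single q 1) = g (Finsupp.single q 1)) : f u = g u := by
  rw [← Finsupp.sum_single u, Finsupp.sum, map_sum, map_sum]
  refine Finset.sum_congr rfl fun q hq => ?_
  rw [← mul_one (u q), ← smul_eq_mul, ← Finsupp.smul_single, map_smul, map_smul,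
    h q (Finsupp.mem_support_iff.1 hq)]

/-- Homogeneous solutions on the generators extend to a linear map. -/
lemma MinRes.exists_lift (F : MinRes hφ β) {i j : ℕ} {e : ℤ × ℤ}
    (g : FMod k n p β i →ₗ[PolyS k n p] FMod k n p β j)
    (hg : ∀ q : RIdx β i, g (Finsupp.single q 1) ∈ (F.cx.gr j).H (q.1.1 + e))
    (h : ∀ q : RIdx β i, ∃ w, F.f j w = g (Finsupp.single q 1)) :
    ∃ t : FMod k n p β i →ₗ[PolyS k n p] FMod k n p β (j + 1),
      (∀ u, F.f j (t u) = g u) ∧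
      ∀ q : RIdx β i, t (Finsupp.single q 1) ∈ (F.cx.gr (j + 1)).H (q.1.1 + e) := by
  have h1 : ∀ q : RIdx β i, ∃ w : FMod k n p β (j + 1), w ∈ (F.cx.gr (j + 1)).H (q.1.1 + e) ∧
      F.f j w = g (Finsupp.single q 1) := fun q => by
    obtain ⟨w, hw⟩ := h q
    exact (F.cx.d_graded j).lift (hg q) hw
  choose w hw hwq using h1
  let t : FMod k n p β i →ₗ[PolyS k n p] FMod k n p β (j + 1) :=
    Finsupp.linearCombination (PolyS k n p) w
  have ht : ∀ q, t (Finsupp.single q 1) = w q := fun q =>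
    (Finsupp.linearCombination_single _ _ _).trans (one_smul _ _)
  refine ⟨t, fun u => finsupp_map_congr (f := (F.f j).comp t) fun q _ => ?_, fun q => ?_⟩
  · rw [LinearMap.comp_apply, ht, hwq]
  · rw [ht]; exact hw q

lemma isGraded_mem_of_single {β : ℕ → ℤ × ℤ → ℕ} {i j : ℕ} {e : ℤ × ℤ}
    (t : FMod k n p β i →ₗ[PolyS k n p] FMod k n p β j)
    (ht : ∀ q : RIdx β i, t (Finsupp.single q 1) ∈
      (freeBigrading (k := k) fun q : RIdx β j => q.1.1).H (q.1.1 + e))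
    {d : ℤ × ℤ} {u : FMod k n p β i}
    (hu : u ∈ (freeBigrading (k := k) fun q : RIdx β i => q.1.1).H d) :
    t u ∈ (freeBigrading (k := k) fun q : RIdx β j => q.1.1).H (d + e) := by
  rw [← Finsupp.sum_single u, Finsupp.sum, map_sum]
  refine sum_mem fun q _ => ?_
  rw [← mul_one (u q), ← smul_eq_mul, ← Finsupp.smul_single, map_smul]
  have := Bigrading.smul_mem (mem_freeBigrading.1 hu q) (ht q)
  rwa [show q.1.1 + e + (d - q.1.1) = d + e by ring] at this

lemma MinRes.nullHomotopic_minor (F : MinRes hφ β) {r : PolyS k n p} {e : ℤ × ℤ}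
    (hr : r ∈ piece k n p e) (he : e.1 ≤ 0) (hJ : r ∈ resJ k n m p φ) : F.NullHomotopic r := by
  let P : ∀ i, (FMod k n p β i →ₗ[PolyS k n p] FMod k n p β (i + 1)) → Prop := fun i h =>
    (∀ u, F.f i (h (F.f i u)) = r • F.f i u) ∧
    ∀ q : RIdx β i, h (Finsupp.single q 1) ∈ (F.cx.gr (i + 1)).H (q.1.1 + e)
  have h0 : ∃ h, P 0 h ∧ ∀ u, F.f 0 (h u) = r • u := by
    obtain ⟨t, ht, ht'⟩ := F.exists_lift (i := 0) (j := 0) (e := e)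
      (r • (LinearMap.id : FMod k n p β 0 →ₗ[PolyS k n p] FMod k n p β 0))
      (fun q => Bigrading.smul_mem (G := F.cx.gr 0) hr (F.single_mem q)) (fun q => by
        refine (F.exact_zero _).1 ?_
        rw [LinearMap.smul_apply, LinearMap.id_apply, map_smul]
        obtain ⟨s, hs⟩ := Submodule.mkQ_surjective _ (F.π (Finsupp.single q 1))
        rw [← hs, ← map_smul]
        exact (Submodule.Quotient.mk_eq_zero _).2 (Ideal.mul_mem_right _ _ hJ))
    exact ⟨t, ⟨fun u => by rw [ht]; rfl, ht'⟩, fun u => ht u⟩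
  have hstep : ∀ i h, P i h → ∃ h', P (i + 1) h' ∧
      ∀ u, F.f (i + 1) (h' u) + h (F.f i u) = r • u := by
    intro i h ⟨h1, h2⟩
    obtain ⟨t, ht, ht'⟩ := F.exists_lift (i := i + 1) (j := i + 1) (e := e)
      (r • (LinearMap.id : FMod k n p β (i + 1) →ₗ[PolyS k n p] FMod k n p β (i + 1)) -
        h.comp (F.f i))
      (fun q => by
        refine sub_mem (Bigrading.smul_mem (G := F.cx.gr (i + 1)) hr (F.single_mem q)) ?_
        exact isGraded_mem_of_single h h2 ((F.cx.d_graded i).mem (F.single_mem q)))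
      (fun q => by
        refine (F.exact i _).1 ?_
        rw [LinearMap.sub_apply, map_sub, LinearMap.smul_apply, LinearMap.id_apply, map_smul,
          LinearMap.comp_apply, h1, sub_self])
    have ht2 : ∀ u, F.f (i + 1) (t u) + h (F.f i u) = r • u := fun u => by
      rw [ht, LinearMap.sub_apply]
      exact sub_add_cancel _ _
    refine ⟨t, ⟨fun u => ?_, ht'⟩, ht2⟩
    have := ht2 (F.f (i + 1) u)
    rwa [(F.exact i).apply_apply_eq_zero, map_zero, add_zero] at this
  let H : ∀ i, { h // P i h } := fun i => Nat.rec ⟨h0.choose, h0.choose_spec.1⟩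
    (fun i h => ⟨(hstep i h.1 h.2).choose, (hstep i h.1 h.2).choose_spec.1⟩) i
  refine ⟨fun i => (H i).1, h0.choose_spec.2,
    fun i u => (hstep i (H i).1 (H i).2).choose_spec.2 u, fun i q q' hlt => ?_⟩
  exact piece_eq_zero_of_neg (mem_freeBigrading.1 ((H i).2.2 q) q') (Or.inl (by
    rw [Prod.fst_sub, Prod.fst_add]; omega))

lemma MinRes.nullHomotopic_of_mem (F : MinRes hφ β) {r : PolyS k n p}
    (hr : r ∈ minorsIdeal n φ) : F.NullHomotopic r := by
  induction hr using Submodule.span_induction with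
  | mem x hx =>
    obtain ⟨s, c, rfl⟩ := hx
    exact F.nullHomotopic_minor (minor_mem hφ s c) le_rfl
      ((le_sup_right : _ ≤ resJ k n m p φ) (Ideal.subset_span ⟨s, c, rfl⟩))
  | zero => exact ⟨fun _ => 0, by simp, by simp, by simp⟩
  | add x y _ _ hx hy =>
    obtain ⟨h, h1, h2, h3⟩ := hx
    obtain ⟨h', h1', h2', h3'⟩ := hy
    refine ⟨fun i => h i + h' i, fun u => ?_, fun i u => ?_, fun i q q' hlt => ?_⟩
    · rw [LinearMap.add_apply, map_add, h1, h1', add_smul]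
    · rw [LinearMap.add_apply, LinearMap.add_apply, map_add, add_smul, ← h2 i u, ← h2' i u]
      abel
    · rw [LinearMap.add_apply, Finsupp.add_apply, h3 i q q' hlt, h3' i q q' hlt, add_zero]
  | smul s x _ hx =>
    obtain ⟨h, h1, h2, h3⟩ := hx
    refine ⟨fun i => s • h i, fun u => ?_, fun i u => ?_, fun i q q' hlt => ?_⟩
    · rw [LinearMap.smul_apply, map_smul, h1, smul_assoc]
    · rw [LinearMap.smul_apply, LinearMap.smul_apply, map_smul, smul_assoc, ← h2 i u, smul_add]
    · rw [LinearMap.smul_apply, Finsupp.smul_apply, h3 i q q' hlt, smul_zero]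

end Strands

section Chains

variable {k : Type} [Field k] {n m p : ℕ} {φ : Matrix (Fin n) (Fin m) (PolyS k n p)}
  {hφ : ∀ i j, φ i j ∈ piece k n p (0, 1)} {β : ℕ → ℤ × ℤ → ℕ}
  (hrs : ∃ rs : List (PolyS k n p), rs.length = m ∧
    (∀ r ∈ rs, ∀ l, X (Sum.inl l) * r ∈ Ideal.span (Set.range (zseq k n m p φ))) ∧
    RingTheory.Sequence.IsWeaklyRegular (PolyS k n p) rs)

open RingTheory.Sequence

lemma MinRes.f_apply_eq_zero (F : MinRes hφ β) {i : ℕ} {q : RIdx β (i + 1)} {q' : RIdx β i}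
    (h : q.1.1.1 < q'.1.1.1 ∨ q.1.1.2 < q'.1.1.2) : F.f i (Finsupp.single q 1) q' = 0 := by
  refine piece_eq_zero_of_neg (mem_freeBigrading.1 ((F.cx.d_graded i).mem (F.single_mem q)) q') ?_
  rw [Prod.fst_sub, Prod.snd_sub]
  omega

variable {N : Type} [AddCommGroup N] [Module (PolyS k n p) N]

include hrs in
lemma MinRes.functional_eq_zero (F : MinRes hφ β) {a : ℤ} {rs : List (PolyS k n p)}
    (hF : ∀ r ∈ rs, F.NullHomotopic r) (hN : IsWeaklyRegular N rs) (ha : 1 ≤ a + rs.length)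
    (t : FMod k n p β 0 →ₗ[PolyS k n p] N)
    (ht : ∀ q : RIdx β 0, q.1.1.1 < a → t (Finsupp.single q 1) = 0)
    (htf : ∀ q : RIdx β 1, q.1.1.1 ≤ a → t (F.f 0 (Finsupp.single q 1)) = 0)
    (q : RIdx β 0) (hq : q.1.1.1 ≤ a) : t (Finsupp.single q 1) = 0 := by
  cases rs with
  | nil =>
    have := (F.xdeg_bound hrs 0 q).2.1
    exact ht q (by simp at ha; omega)
  | cons r rs =>
    obtain ⟨h, h1, h2, h3⟩ := hF r List.mem_cons_self
    refine ((isWeaklyRegular_cons_iff _ _ _).1 hN).1 ?_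
    change r • t _ = r • (0 : N)
    rw [← map_smul, ← h1, smul_zero]
    refine (finsupp_map_congr (f := t.comp (F.f 0)) (g := 0) fun q' hq' => ?_)
    refine htf q' ?_
    by_contra hlt
    exact hq' (h3 0 q q' (by omega))

include hrs in
lemma MinRes.functional_factors (F : MinRes hφ β) {a : ℤ} {rs : List (PolyS k n p)}
    (hF : ∀ r ∈ rs, F.NullHomotopic r) : ∀ {N : Type} [AddCommGroup N] [Module (PolyS k n p) N],
    IsWeaklyRegular N rs → ∀ j : ℕ, (j : ℤ) + 2 ≤ a + rs.length →
    ∀ t : FMod k n p β (j + 1) →ₗ[PolyS k n p] N,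
    (∀ q : RIdx β (j + 1), q.1.1.1 < a → t (Finsupp.single q 1) = 0) →
    (∀ q : RIdx β (j + 2), q.1.1.1 ≤ a → t (F.f (j + 1) (Finsupp.single q 1)) = 0) →
    ∃ s : FMod k n p β j →ₗ[PolyS k n p] N,
      (∀ q : RIdx β j, q.1.1.1 < a → s (Finsupp.single q 1) = 0) ∧
      ∀ q : RIdx β (j + 1), q.1.1.1 ≤ a →
        t (Finsupp.single q 1) = s (F.f j (Finsupp.single q 1)) := by
  induction rs with
  | nil =>
    intro N _ _ _ j ha t ht _
    refine ⟨0, fun _ _ => rfl, fun q _ => ht q ?_⟩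
    have := (F.xdeg_bound hrs (j + 1) q).2.1
    simp at ha
    omega
  | cons r rs ih =>
    intro N _ _ hN j ha t ht htf
    obtain ⟨hr, hN'⟩ := (isWeaklyRegular_cons_iff _ _ _).1 hN
    obtain ⟨h, -, h2, h3⟩ := hF r List.mem_cons_self
    have hF' : ∀ r ∈ rs, F.NullHomotopic r := fun r hr => hF r (List.mem_cons_of_mem _ hr)
    rw [List.length_cons] at ha
    push_cast at ha
    let s₀ := t.comp (h j)
    have hs₀ : ∀ q : RIdx β j, q.1.1.1 < a → s₀ (Finsupp.single q 1) = 0 := fun q hq =>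
      finsupp_map_congr (f := t) (g := 0) fun q' hq' => ht q' (by
        by_contra hlt
        exact hq' (h3 j q q' (by omega)))
    have hs₀f : ∀ q : RIdx β (j + 1), q.1.1.1 ≤ a →
        s₀ (F.f j (Finsupp.single q 1)) = r • t (Finsupp.single q 1) := fun q hq => by
      rw [← map_smul, ← h2, map_add]
      have : t (F.f (j + 1) (h (j + 1) (Finsupp.single q 1))) = 0 :=
        finsupp_map_congr (f := t.comp (F.f (j + 1))) (g := 0) fun q' hq' => htf q' (by
          by_contra hlt
          exact hq' (h3 _ q q' (by omega)))
      rw [this, zero_add]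
      rfl
    let π : N →ₗ[PolyS k n p] QuotSMulTop r N := Submodule.mkQ _
    have hπ : ∀ u, π (r • u) = 0 := fun u =>
      (Submodule.Quotient.mk_eq_zero _).2 (Submodule.smul_mem_pointwise_smul _ _ _ trivial)
    have hs₀q : ∀ q : RIdx β j, q.1.1.1 < a → (π.comp s₀) (Finsupp.single q 1) = 0 :=
      fun q hq => by rw [LinearMap.comp_apply, hs₀ q hq, map_zero]
    have hs₀fq : ∀ q : RIdx β (j + 1), q.1.1.1 ≤ a →
        (π.comp s₀) (F.f j (Finsupp.single q 1)) = 0 :=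
      fun q hq => by rw [LinearMap.comp_apply, hs₀f q hq, hπ]
    have hs₁ : ∃ s₁ : FMod k n p β j →ₗ[PolyS k n p] N,
        (∀ q : RIdx β j, q.1.1.1 < a → s₁ (Finsupp.single q 1) = 0) ∧
        (∀ u, s₁ (F.f j u) = 0) ∧
        ∀ q : RIdx β j, q.1.1.1 ≤ a →
          π (s₀ (Finsupp.single q 1)) = π (s₁ (Finsupp.single q 1)) := by
      cases j with
      | zero =>
        refine ⟨0, fun _ _ => rfl, fun _ => rfl, fun q hq => ?_⟩
        rw [LinearMap.zero_apply, map_zero]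
        exact F.functional_eq_zero hrs hF' hN' (by simp at ha; omega) (π.comp s₀) hs₀q hs₀fq q hq
      | succ l =>
        obtain ⟨w, hw, hwf⟩ := ih hF' hN' l (by push_cast at ha; omega) (π.comp s₀) hs₀q hs₀fq
        have hlift : ∀ q : RIdx β l, ∃ v : N, π v = w (Finsupp.single q 1) ∧
            (q.1.1.1 < a → v = 0) := fun q => by
          by_cases hq : q.1.1.1 < a
          · exact ⟨0, by rw [hw q hq, map_zero], fun _ => rfl⟩
          · obtain ⟨v, hv⟩ := Submodule.mkQ_surjective _ (w (Finsupp.single q 1))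
            exact ⟨v, hv, fun h => absurd h hq⟩
        choose v hv hv0 using hlift
        let w' : FMod k n p β l →ₗ[PolyS k n p] N := Finsupp.linearCombination (PolyS k n p) v
        have hw' : ∀ q, w' (Finsupp.single q 1) = v q := fun q =>
          (Finsupp.linearCombination_single _ _ _).trans (one_smul _ _)
        refine ⟨w'.comp (F.f l), fun q hq => ?_, fun u => ?_, fun q hq => ?_⟩
        · refine finsupp_map_congr (f := w') (g := 0) fun q' hq' => ?_
          rw [hw']
          refine hv0 q' ?_
          by_contra hlt
          exact hq' (F.f_apply_eq_zero (Or.inl (by omega)))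
        · rw [LinearMap.comp_apply, (F.exact l).apply_apply_eq_zero, map_zero]
        · refine (hwf q hq).trans (finsupp_map_congr (g := π.comp w') fun q' _ => ?_)
          rw [LinearMap.comp_apply, hw', hv]
    obtain ⟨s₁, hs₁, hs₁f, hs⟩ := hs₁
    have hdiv : ∀ q : RIdx β j, ∃ v : N, q.1.1.1 ≤ a →
        r • v = (s₀ - s₁) (Finsupp.single q 1) := fun q => by
      by_cases hq : q.1.1.1 ≤ a
      · have := (Submodule.Quotient.eq _).1 (hs q hq)
        obtain ⟨v, -, hv⟩ := (Submodule.mem_smul_pointwise_iff_exists _ _ _).1 this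
        exact ⟨v, fun _ => hv⟩
      · exact ⟨0, fun h => absurd h hq⟩
    choose v hv using hdiv
    let s : FMod k n p β j →ₗ[PolyS k n p] N := Finsupp.linearCombination (PolyS k n p) v
    have hsv : ∀ q, s (Finsupp.single q 1) = v q := fun q =>
      (Finsupp.linearCombination_single _ _ _).trans (one_smul _ _)
    refine ⟨s, fun q hq => hr ?_, fun q hq => hr ?_⟩
    · change r • s _ = r • (0 : N)
      rw [hsv, hv q hq.le, LinearMap.sub_apply, hs₀ q hq, hs₁ q hq, sub_zero, smul_zero]
    · change r • t _ = r • s _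
      have : (r • s) (F.f j (Finsupp.single q 1)) = (s₀ - s₁) (F.f j (Finsupp.single q 1)) :=
        finsupp_map_congr fun q' hq' => by
          rw [LinearMap.smul_apply, hsv, hv]
          by_contra hlt
          exact hq' (F.f_apply_eq_zero (Or.inl (by omega)))
      rw [LinearMap.smul_apply, LinearMap.sub_apply, hs₁f, sub_zero, hs₀f q hq] at this
      exact this.symm

lemma eq_zero_of_mem_piece_zero {u : PolyS k n p} (hu : u ∈ piece k n p 0)
    (hm : u ∈ varIdeal k n p) : u = 0 := by
  have h0 : coeff 0 u = 0 := varIdeal_le_ker hm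
  ext c
  rw [coeff_zero]
  by_contra hc
  have h2 := hu hc
  rw [weight_bideg, Prod.mk_eq_zero, Finset.sum_eq_zero_iff_of_nonneg (fun _ _ => by positivity),
    Finset.sum_eq_zero_iff_of_nonneg (fun _ _ => by positivity)] at h2
  refine hc ((congrArg (fun c => coeff c u) (Finsupp.ext fun x => ?_)).trans h0)
  obtain x | x := x
  · exact_mod_cast h2.1 x (Finset.mem_univ _)
  · exact_mod_cast h2.2 x (Finset.mem_univ _)

lemma map_mem_of_mem_smul_top {R M : Type} [CommRing R] [AddCommGroup M] [Module R M]
    (s : M →ₗ[R] R) {I : Ideal R} {u : M} (hu : u ∈ (I • ⊤ : Submodule R M)) : s u ∈ I := by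
  refine Submodule.smul_induction_on hu (fun r hr v _ => ?_) fun u v hu hv => ?_
  · rw [map_smul]
    exact Ideal.mul_mem_right _ _ hr
  · rw [map_add]
    exact add_mem hu hv

include hrs in
/-- Below homological degree `a + grade`, each generator of `x`-degree `a` has a successor of the
same `x`-degree and larger `y`-degree. -/
lemma MinRes.exists_next (F : MinRes hφ β) {rs : List (PolyS k n p)}
    (hI : ∀ r ∈ rs, r ∈ minorsIdeal n φ) (hreg : IsWeaklyRegular (PolyS k n p) rs) {i : ℕ}
    (q : RIdx β i) (hq : (i : ℤ) < q.1.1.1 + rs.length) :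
    ∃ q' : RIdx β (i + 1), q'.1.1.1 = q.1.1.1 ∧ q.1.1.2 < q'.1.1.2 := by
  by_contra! hno
  have hF : ∀ r ∈ rs, F.NullHomotopic r := fun r hr => F.nullHomotopic_of_mem (hI r hr)
  let t : FMod k n p β i →ₗ[PolyS k n p] PolyS k n p := Finsupp.lapply q
  have ht : ∀ q' : RIdx β i, q'.1.1.1 < q.1.1.1 → t (Finsupp.single q' 1) = 0 := fun q' hq' =>
    Finsupp.single_eq_of_ne (by rintro rfl; exact lt_irrefl _ hq')
  have ht1 : t (Finsupp.single q 1) = 1 := Finsupp.single_eq_same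
  have htf : ∀ q' : RIdx β (i + 1), q'.1.1.1 ≤ q.1.1.1 →
      t (F.f i (Finsupp.single q' 1)) = 0 := fun q' hq' => by
    by_cases h1 : q'.1.1.1 < q.1.1.1 ∨ q'.1.1.2 < q.1.1.2
    · exact F.f_apply_eq_zero h1
    · have h2 := hno q' (by omega)
      refine eq_zero_of_mem_piece_zero ?_
        (mem_of_finsupp_mem_smul_top (F.minimal i ⟨_, rfl⟩) q)
      have := mem_freeBigrading.1 ((F.cx.d_graded i).mem (F.single_mem q')) q
      rwa [show q'.1.1 - q.1.1 = 0 from Prod.ext (by rw [Prod.fst_sub, Prod.fst_zero]; omega)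
        (by rw [Prod.snd_sub, Prod.snd_zero]; omega)] at this
  cases i with
  | zero =>
    have := F.functional_eq_zero hrs hF hreg (by simp at hq; omega) t ht htf q le_rfl
    exact one_ne_zero (ht1.symm.trans this)
  | succ j =>
    obtain ⟨s, -, hs⟩ := F.functional_factors hrs hF hreg j (by push_cast at hq; omega) t ht htf
    have h1 := hs q le_rfl
    rw [ht1] at h1
    refine one_notMem_varIdeal (k := k) (n := n) (p := p) ?_
    rw [h1]
    exact map_mem_of_mem_smul_top s (F.minimal j ⟨_, rfl⟩)

end Chains

section Main

variable {k : Type} [Field k] {n m p : ℕ} {φ : Matrix (Fin n) (Fin m) (PolyS k n p)}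
  {hφ : ∀ i j, φ i j ∈ piece k n p (0, 1)} {β : ℕ → ℤ × ℤ → ℕ}
  (hrs : ∃ rs : List (PolyS k n p), rs.length = m ∧
    (∀ r ∈ rs, ∀ l, X (Sum.inl l) * r ∈ Ideal.span (Set.range (zseq k n m p φ))) ∧
    RingTheory.Sequence.IsWeaklyRegular (PolyS k n p) rs)
  (hgr : gradeGE (minorsIdeal n φ) (m - n + 1))

include hrs hgr

lemma MinRes.exists_chain (F : MinRes hφ β) {i j : ℕ} (q : RIdx β i) (s : ℕ)
    (hj : i + s = j) (hs : (i : ℤ) + s ≤ q.1.1.1 + (m - n + 1 : ℕ)) :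
    ∃ q' : RIdx β j, q'.1.1.1 = q.1.1.1 ∧ q.1.1.2 + s ≤ q'.1.1.2 := by
  induction s generalizing j with
  | zero =>
    subst hj
    exact ⟨q, rfl, by simp⟩
  | succ s ih =>
    obtain ⟨q', h1, h2⟩ := ih rfl (by omega)
    subst hj
    obtain ⟨rs, hlen, hI, hreg⟩ := hgr
    obtain ⟨q'', h3, h4⟩ := F.exists_next hrs hI hreg.toIsWeaklyRegular q' (by omega)
    exact ⟨q'', h3.trans h1, by push_cast; omega⟩

variable (hnm : n ≤ m)
include hnm

lemma MinRes.ydeg_le_sub (F : MinRes hφ β) {i : ℕ} (q : RIdx β i)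
    (hi : (i : ℤ) ≤ q.1.1.1 + (m - n + 1 : ℕ)) : q.1.1.2 ≤ n - 1 + i - q.1.1.1 := by
  obtain ⟨q', h1, h2⟩ := F.exists_chain hrs hgr q (q.1.1.1 + (m - n + 1 : ℕ) - i).toNat
    rfl (by omega)
  have := F.ydeg_le hrs _ q'
  omega

/-- There are generators of bidegree `(a, n - 1 + s)` in homological degree `a + s` for `a < n` and
`1 ≤ s ≤ m - n + 1`. -/
lemma MinRes.exists_offdiag (F : MinRes hφ β) {i a s : ℕ} (ha : a < n) (hs : 1 ≤ s)
    (hs' : s ≤ m - n + 1) (hi : a + s = i) :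
    ∃ q : RIdx β i, q.1.1 = ((a : ℤ), (n : ℤ) - 1 + s) := by
  obtain ⟨q₀, hq₀⟩ := F.exists_diag hrs ha (by omega)
  obtain ⟨q₁, h1, -⟩ := F.exists_chain hrs hgr q₀ 1 rfl (by rw [hq₀]; push_cast; omega)
  rw [hq₀] at h1
  have h2 := F.le_ydeg hrs q₁ (by rw [h1]; push_cast; omega)
  obtain ⟨s, rfl⟩ := Nat.exists_eq_add_of_le hs
  obtain ⟨q₂, h3, h4⟩ := F.exists_chain hrs hgr q₁ s ((add_assoc _ _ _).trans hi) (by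
    rw [h1]; push_cast; omega)
  rw [h1] at h3
  have h5 := F.ydeg_le_sub hrs hgr hnm q₂ (by rw [h3]; omega)
  exact ⟨q₂, Prod.ext h3 (by rw [h3] at h5; push_cast; omega)⟩

end Main

/-- Under the residual-intersection hypotheses, for any minimal
bigraded free resolution with multiplicities `β`: for `0 ≤ i ≤ m`, the largest `a` with
`β i (a,b) ≠ 0` for some `b` is `min{i, n-1}`; moreover, if `m ≤ 2n-1`, the largest `b`
with `β i (a,b) ≠ 0` for some `a` is `n-1+i` for `1 ≤ i ≤ m-n` and `m` for
`m-n+1 ≤ i ≤ m`. -/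
theorem stmt10
    (k : Type) [Field k] (n m p : ℕ)
    (hn : 0 < n) (hp : 0 < p) (hnm : n ≤ m)
    (φ : Matrix (Fin n) (Fin m) (PolyS k n p))
    (hφ : ∀ i j, φ i j ∈ piece k n p (0, 1))
    (hgrade : gradeGE (minorsIdeal n φ) (m - n + 1))
    (hhtJ : (m : ℕ∞) ≤ idealHeight (resJ k n m p φ))
    (hgeom : geomResCond k n m p φ) :
    ∀ β : ℕ → ℤ × ℤ → ℕ, IsMinBigradedFreeRes k n p (resJ k n m p φ) β →
      (∀ i : ℕ, i ≤ m →
        IsGreatest { a : ℤ | ∃ b : ℤ, β i (a, b) ≠ 0 } ((min i (n - 1) : ℕ) : ℤ)) ∧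
      (m ≤ 2 * n - 1 →
        (∀ i : ℕ, 1 ≤ i → i ≤ m - n →
          IsGreatest { b : ℤ | ∃ a : ℤ, β i (a, b) ≠ 0 } ((n - 1 + i : ℕ) : ℤ)) ∧
        (∀ i : ℕ, m - n + 1 ≤ i → i ≤ m →
          IsGreatest { b : ℤ | ∃ a : ℤ, β i (a, b) ≠ 0 } ((m : ℕ) : ℤ))) := by
  intro β hβ
  obtain ⟨F⟩ := hβ.nonempty_minRes hφ
  have hrs : ∃ rs : List (PolyS k n p), rs.length = m ∧
      (∀ r ∈ rs, ∀ l, X (Sum.inl l) * r ∈ Ideal.span (Set.range (zseq k n m p φ))) ∧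
      RingTheory.Sequence.IsWeaklyRegular (PolyS k n p) rs := by
    obtain ⟨rs, h1, h2, h3⟩ := exists_isWeaklyRegular_of_idealHeight m (resJ k n m p φ) hhtJ
    exact ⟨rs, h1, fun r hr l => X_mul_resJ_mem l (h2 r hr), h3⟩
  have hne : ∀ {i : ℕ} (q : RIdx β i) {d : ℤ × ℤ}, q.1.1 = d → β i d ≠ 0 := fun q d h =>
    h ▸ (Nat.zero_le _).trans_lt q.2 |>.ne'
  have hidx : ∀ {i : ℕ} {d : ℤ × ℤ}, β i d ≠ 0 → ∃ q : RIdx β i, q.1.1 = d := fun {_ d} h =>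
    ⟨⟨(d, 0), Nat.pos_of_ne_zero h⟩, rfl⟩
  have hoff : ∀ {i a s : ℕ}, a < n → 1 ≤ s → s ≤ m - n + 1 → a + s = i →
      β i (a, (n : ℤ) - 1 + s) ≠ 0 := by
    intro i a s ha hs hs' hi
    obtain ⟨q, hq⟩ := F.exists_offdiag hrs hgrade hnm ha hs hs' hi
    exact hne q hq
  refine ⟨fun i hi => ⟨?_, ?_⟩, fun _ => ⟨fun i hi hi' => ⟨?_, ?_⟩, fun i hi hi' => ⟨?_, ?_⟩⟩⟩
  · by_cases hin : i < n
    · obtain ⟨q, hq⟩ := F.exists_diag hrs hin hi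
      rw [min_eq_left (by omega)]
      exact ⟨i, hne q hq⟩
    · rw [min_eq_right (by omega)]
      exact ⟨_, hoff (s := i - (n - 1)) (by omega) (by omega) (by omega) (by omega)⟩
  · rintro a ⟨b, hb⟩
    obtain ⟨q, hq⟩ := hidx hb
    have := F.xdeg_bound hrs i q
    rw [hq] at this
    omega
  · rw [show ((n - 1 + i : ℕ) : ℤ) = (n : ℤ) - 1 + i by omega]
    exact ⟨_, hoff (a := 0) (s := i) hn hi (by omega) (by omega)⟩
  · rintro b ⟨a, hb⟩
    obtain ⟨q, hq⟩ := hidx hb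
    have h1 := F.xdeg_bound hrs i q
    have h2 := F.ydeg_le_sub hrs hgrade hnm q (by omega)
    rw [hq] at h1 h2
    dsimp only at h1 h2
    omega
  · rw [show (m : ℤ) = (n : ℤ) - 1 + (m - n + 1 : ℕ) by omega]
    exact ⟨_, hoff (a := i - (m - n + 1)) (by omega) (by omega) le_rfl (by omega)⟩
  · rintro b ⟨a, hb⟩
    obtain ⟨q, hq⟩ := hidx hb
    have := F.ydeg_le hrs i q
    rwa [hq] at this
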